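/- arXiv:2205.04704 — 5 statements merged into one kernel-verified Lean document; each statement's English description precedes it below -/
import Mathlib

section
/- Let A be a unital C*-algebra and let 𝒞 be a class of unital C*-algebras, closed under *-isomorphism (modeled as an isomorphism-invariant predicate on C*-subalgebras of A). Then A decomposes over 𝒞 if and only if: for every finite subset X of A and every ε > 0 there exist C*-subalgebras C, D, E of A belonging to 𝒞 and a positive contraction h ∈ A such that (i) ‖[h, x]‖ < ε for all x ∈ X; (ii) hx ∈_ε C, (1_A − h)x ∈_ε D, and h(1_A − h)x ∈_ε E for all x ∈ X; (iii) E ⊆_ε C, E ⊆_ε D, and the unit 1_E of E lies in C ∩ D; and (iv) h = h_E + p and 1_A − h = (1_E − h_E) + q, where h_E is a positive contraction in E, and p ∈ C and q ∈ D are projections orthogonal to 1_E satisfying 1_A = 1_E + p + q. -/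
universe u

/-- `a ∈_ε S`: there is `s ∈ S` with `‖a - s‖ < ε`. -/
def MemEps {A : Type u} [CStarAlgebra A] (ε : ℝ) (S : Set A) (a : A) : Prop :=
  ∃ s ∈ S, ‖a - s‖ < ε

/-- `S ⊆_ε T`: every element of the closed unit ball of `S` is within `ε` of an element of
the closed unit ball of `T`. -/
def SubsetEps {A : Type u} [CStarAlgebra A] (ε : ℝ) (S T : Set A) : Prop :=
  ∀ s ∈ S, ‖s‖ ≤ 1 → ∃ t ∈ T, ‖t‖ ≤ 1 ∧ ‖s - t‖ < ε

/-- A unital C*-algebra `A` decomposes over a class `𝒞` of C*-subalgebras of `A`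
(Definition 2.3 of the paper). -/
def Decomposes (A : Type u) [CStarAlgebra A]
    (𝒞 : NonUnitalStarSubalgebra ℂ A → Prop) : Prop :=
  ∀ (X : Finset A) (ε : ℝ), 0 < ε →
    ∃ C D E : NonUnitalStarSubalgebra ℂ A, 𝒞 C ∧ 𝒞 D ∧ 𝒞 E ∧
      ∃ h : A, (∃ x : A, h = star x * x) ∧ ‖h‖ ≤ 1 ∧
        (∀ x ∈ X, ‖h * x - x * h‖ < ε) ∧
        (∀ x ∈ X, MemEps ε (C : Set A) (h * x)) ∧
        (∀ x ∈ X, MemEps ε (D : Set A) ((1 - h) * x)) ∧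
        (∀ x ∈ X, MemEps ε (E : Set A) (h * ((1 - h) * x))) ∧
        SubsetEps ε (E : Set A) (C : Set A) ∧
        SubsetEps ε (E : Set A) (D : Set A) ∧
        (∀ e ∈ E, ‖e‖ ≤ 1 → MemEps ε (E : Set A) (h * e))

set_option linter.unusedSimpArgs false

section helpers

variable {A : Type u} [CStarAlgebra A]

/-- cutoff function -/
noncomputable def cutF (t : ℝ) : ℝ := max 0 (min 1 (2 * t - 1 / 2))

lemma cutF_cont : Continuous cutF := by unfold cutF; fun_prop

lemma cutF_zero : cutF 0 = 0 := by unfold cutF; norm_num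

lemma cutF_small {t : ℝ} (h : t ≤ 1 / 4) : cutF t = 0 := by
  unfold cutF
  exact max_eq_left (le_trans (min_le_right _ _) (by linarith))

lemma cutF_large {t : ℝ} (h : 3 / 4 ≤ t) : cutF t = 1 := by
  unfold cutF
  rw [min_eq_left (by linarith)]; norm_num

lemma cut_cases {t : ℝ} (h : |t * t - t| ≤ 3 / 16) : t ≤ 1 / 4 ∨ 3 / 4 ≤ t := by
  by_contra! hc
  have := (abs_le.mp h).1
  nlinarith [mul_pos (sub_pos.mpr hc.1) (sub_pos.mpr hc.2)]

lemma spec_bound (a : A) (ha : IsSelfAdjoint a) (t : ℝ) (ht : t ∈ quasispectrum ℝ a) :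
    |t * t - t| ≤ ‖a * a - a‖ := by
  have h1 : cfcₙ (fun x : ℝ => x * x - x) a = a * a - a := by
    rw [cfcₙ_sub (fun x : ℝ => x * x) (fun x => x) a, cfcₙ_mul (fun x : ℝ => x) (fun x => x) a,
      cfcₙ_id' ℝ a]
  rw [← h1]
  exact norm_apply_le_norm_cfcₙ (fun x : ℝ => x * x - x) a ht

lemma exists_proj (S : NonUnitalStarSubalgebra ℂ A) (hS : IsClosed (S : Set A)) (a : A)
    (haS : a ∈ S) (ha : IsSelfAdjoint a) (hs : ‖a * a - a‖ ≤ 3 / 16) :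
    ∃ p ∈ S, star p = p ∧ p * p = p ∧ ‖p - a‖ ≤ 2 * ‖a * a - a‖ := by
  have hb := spec_bound a ha
  have hco : ContinuousOn cutF (quasispectrum ℝ a) := cutF_cont.continuousOn
  refine ⟨cfcₙ cutF a, cfcₙ_mem (𝕜' := ℂ) cutF haS, ?_, ?_, ?_⟩
  · exact cfcₙ_predicate cutF a
  · rw [← cfcₙ_mul cutF cutF a hco cutF_zero hco cutF_zero]
    apply cfcₙ_congr
    intro t ht
    rcases cut_cases ((hb t ht).trans hs) with h | h
    · simp [cutF_small h]
    · simp [cutF_large h]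
  · nth_rw 2 [← cfcₙ_id' ℝ a]
    rw [← cfcₙ_sub cutF (fun x => x) a hco cutF_zero]
    apply norm_cfcₙ_le
    intro t ht
    refine le_trans ?_ (mul_le_mul_of_nonneg_left (hb t ht) (by norm_num))
    rw [Real.norm_eq_abs, show t * t - t = t * (t - 1) by ring, abs_mul]
    rcases cut_cases ((hb t ht).trans hs) with h | h
    · rw [cutF_small h, zero_sub, abs_neg, abs_of_nonpos (show t - 1 ≤ 0 by linarith)]
      nlinarith [abs_nonneg t]
    · rw [cutF_large h, abs_of_nonneg (show 0 ≤ t by linarith), abs_sub_comm]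
      nlinarith [abs_nonneg (t - 1)]

lemma proj_norm_le {p : A} (h1 : star p = p) (h2 : p * p = p) : ‖p‖ ≤ 1 := by
  have h := CStarRing.norm_star_mul_self (x := p)
  rw [h1, h2] at h
  by_contra! hc
  nlinarith

lemma nmul_le {a b : A} {r s : ℝ} (ha : ‖a‖ ≤ r) (hb : ‖b‖ ≤ s) : ‖a * b‖ ≤ r * s :=
  (norm_mul_le _ _).trans (mul_le_mul ha hb (norm_nonneg _) ((norm_nonneg _).trans ha))

/-- real part stays in the algebra and does not increase the distance to a self-adjoint. -/
lemma exists_re (S : NonUnitalStarSubalgebra ℂ A) (c b : A) (hc : c ∈ S) (hb : star b = b)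
    {η : ℝ} (h : ‖b - c‖ ≤ η) : ∃ c' ∈ S, IsSelfAdjoint c' ∧ ‖c' - b‖ ≤ η := by
  refine ⟨(1 / 2 : ℂ) • (c + star c), SMulMemClass.smul_mem _ (add_mem hc (star_mem hc)), ?_, ?_⟩
  · rw [isSelfAdjoint_iff, star_smul]
    simp [add_comm]
  · have : (1 / 2 : ℂ) • (c + star c) - b = (1 / 2 : ℂ) • ((c - b) + star (c - b)) := by
      rw [star_sub, hb]
      have : b = (1 / 2 : ℂ) • (b + b) := by rw [← two_smul ℂ b, smul_smul]; norm_num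
      nth_rw 1 [this]
      rw [← smul_sub]; congr 1; abel
    rw [this, norm_smul]
    have h2 : ‖(c - b) + star (c - b)‖ ≤ η + η := by
      refine (norm_add_le _ _).trans ?_
      rw [norm_star, norm_sub_rev]; linarith
    norm_num
    norm_num at h2
    linarith

lemma exists_proj_near (S : NonUnitalStarSubalgebra ℂ A) (hS : IsClosed (S : Set A)) (p c : A)
    (hp1 : star p = p) (hp2 : p * p = p) (hc : c ∈ S) {η : ℝ} (h : ‖p - c‖ ≤ η)
    (hη : η ≤ 1 / 22) :
    ∃ p' ∈ S, star p' = p' ∧ p' * p' = p' ∧ ‖p' - p‖ ≤ 9 * η := by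
  obtain ⟨a, haS, ha, hap⟩ := exists_re S c p hc hp1 h
  have hp := proj_norm_le hp1 hp2
  have hη0 : 0 ≤ η := (norm_nonneg _).trans h
  have e1 : a * a - a = (a - p) * (a - p) + p * (a - p) + (a - p) * p - (a - p) := by
    have : a * a - a = (a - p) * (a - p) + p * (a - p) + (a - p) * p - (a - p) + (p * p - p) := by
      noncomm_ring
    rw [this, hp2]; simp
  have e2 : ‖a * a - a‖ ≤ 4 * η := by
    rw [e1]
    have i1 := nmul_le hap hap
    have i2 := nmul_le hp hap
    have i3 := nmul_le hap hp
    have := norm_sub_le ((a - p) * (a - p) + p * (a - p) + (a - p) * p) (a - p)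
    have := norm_add₃_le (a := (a - p) * (a - p)) (b := p * (a - p)) (c := (a - p) * p)
    nlinarith
  obtain ⟨p', h1, h2, h3, h4⟩ := exists_proj S hS a haS ha (by linarith)
  refine ⟨p', h1, h2, h3, ?_⟩
  have := norm_add_le (p' - a) (a - p)
  rw [sub_add_sub_cancel] at this
  linarith

lemma exists_unitary (p p' : A) (hp1 : star p = p) (hp2 : p * p = p)
    (hq1 : star p' = p') (hq2 : p' * p' = p') (hd : ‖p' - p‖ ≤ 1 / 2) :
    ∃ u ∈ unitary A, u * p' = p * u ∧ ‖u - 1‖ ≤ 4 * ‖p' - p‖ ∧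
      ∀ x, x * p = p * x → x * p' = p' * x → x * u = u * x := by
  set d := p' - p with hdd
  have hp := proj_norm_le hp1 hp2
  have hdn := norm_nonneg d
  have hdsa : star d = d := by rw [hdd, star_sub, hp1, hq1]
  have hbsa : IsSelfAdjoint (d * d) := by
    rw [isSelfAdjoint_iff, star_mul, hdsa]
  have hbn : ‖d * d‖ ≤ ‖d‖ * ‖d‖ := norm_mul_le _ _
  have hdd2 : d * d = p + p' - p * p' - p' * p := by
    have : d * d = p * p + p' * p' - p * p' - p' * p := by rw [hdd]; noncomm_ring
    rw [this, hp2, hq2]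
  let f : ℝ → ℝ := fun t => (Real.sqrt (1 - t))⁻¹
  have hsp : ∀ t ∈ spectrum ℝ (d * d), |t| ≤ ‖d‖ * ‖d‖ := by
    intro t ht
    have h := norm_apply_le_norm_cfc (fun x : ℝ => x) (d * d) ht
    rw [cfc_id' ℝ (d * d)] at h
    exact h.trans hbn
  have hsp2 : ∀ t ∈ spectrum ℝ (d * d), 0 < Real.sqrt (1 - t) ∧ 3 / 4 ≤ Real.sqrt (1 - t) := by
    intro t ht
    have h1 := (abs_le.mp (hsp t ht)).2
    have : 3 / 4 ≤ Real.sqrt (1 - t) := Real.le_sqrt_of_sq_le (by nlinarith)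
    exact ⟨by linarith, this⟩
  have hfc : ContinuousOn f (spectrum ℝ (d * d)) := by
    apply ContinuousOn.inv₀ (by fun_prop)
    intro t ht; exact (hsp2 t ht).1.ne'
  set w := cfc f (d * d) with hw
  have hwsa : star w = w := cfc_predicate f (d * d)
  have hww : w * w * (1 - d * d) = 1 := by
    have h1 : cfc (fun t : ℝ => 1 - t) (d * d) = 1 - d * d := by
      rw [cfc_sub (fun _ : ℝ => (1 : ℝ)) (fun t => t) (d * d), cfc_const_one ℝ (d * d), cfc_id' ℝ (d * d)]
    rw [← h1, hw, ← cfc_mul f f (d * d) hfc hfc,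
      ← cfc_mul (fun x => f x * f x) (fun t : ℝ => 1 - t) (d * d) (hfc.mul hfc) (by fun_prop)]
    rw [← cfc_const_one ℝ (d * d)]
    apply cfc_congr
    intro t ht
    have h2 := (hsp2 t ht).1
    have h3 : Real.sqrt (1 - t) * Real.sqrt (1 - t) = 1 - t :=
      Real.mul_self_sqrt (Real.sqrt_pos.mp h2).le
    simp only [f]
    generalize Real.sqrt (1 - t) = s at h2 h3
    rw [← h3]; field_simp
  have hw1 : ‖w - 1‖ ≤ ‖d‖ := by
    rw [← cfc_const_one ℝ (d * d), hw, ← cfc_sub f (fun _ => 1) (d * d) hfc]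
    apply norm_cfc_le hdn
    intro t ht
    have h2 := (hsp2 t ht)
    have h3 : Real.sqrt (1 - t) * Real.sqrt (1 - t) = 1 - t :=
      Real.mul_self_sqrt (Real.sqrt_pos.mp h2.1).le
    have h4 := hsp t ht
    simp only [f]
    set s := Real.sqrt (1 - t)
    have h5 : s⁻¹ - 1 = t * (s * (1 + s))⁻¹ := by
      have : 1 + s ≠ 0 := by linarith
      have := h2.1.ne'
      field_simp
      nlinarith
    rw [h5, Real.norm_eq_abs, abs_mul]
    have h6 : |(s * (1 + s))⁻¹| ≤ 1 := by
      rw [abs_of_nonneg (by have := h2.1; positivity)]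
      apply inv_le_one_of_one_le₀
      nlinarith
    nlinarith [abs_nonneg t, abs_nonneg (s * (1 + s))⁻¹]
  have hcomm : ∀ x, x * (d * d) = d * d * x → x * w = w * x := by
    intro x hx
    exact (Commute.cfc_real (show Commute (d * d) x from hx.symm) f).symm.eq
  have ppp : ∀ x, p * (p * x) = p * x := fun x => by rw [← mul_assoc, hp2]
  have qqq : ∀ x, p' * (p' * x) = p' * x := fun x => by rw [← mul_assoc, hq2]
  have cp : p * w = w * p := hcomm p (by
    rw [hdd2]; simp only [mul_sub, mul_add, sub_mul, add_mul, mul_assoc, hp2, hq2, ppp, qqq]; abel)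
  have cq : p' * w = w * p' := hcomm p' (by
    rw [hdd2]; simp only [mul_sub, mul_add, sub_mul, add_mul, mul_assoc, hp2, hq2, ppp, qqq]; abel)
  set z := p * p' + (1 - p) * (1 - p') with hz
  have hzw : z * w = w * z := by
    rw [hz]
    have : p * p' * w = w * (p * p') := by rw [mul_assoc, cq, ← mul_assoc, cp, mul_assoc]
    simp only [mul_sub, mul_add, sub_mul, add_mul, mul_one, one_mul, this, cp, cq]
  have hzs : star z = p' * p + (1 - p') * (1 - p) := by
    simp [hz, hp1, hq1]
  have hz1 : star z * z = 1 - d * d := by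
    rw [hzs, hz, hdd2]
    simp only [mul_sub, mul_add, sub_mul, add_mul, mul_assoc, hp2, hq2, ppp, qqq, one_mul, mul_one]; abel
  have hz2 : z * star z = 1 - d * d := by
    rw [hzs, hz, hdd2]
    simp only [mul_sub, mul_add, sub_mul, add_mul, mul_assoc, hp2, hq2, ppp, qqq, one_mul, mul_one]; abel
  refine ⟨z * w, ?_, ?_, ?_, ?_⟩
  · rw [Unitary.mem_iff]
    constructor
    · rw [star_mul, hwsa, hzw]
      have : star z * w = w * star z := by
        have := congrArg star hzw
        simpa [hwsa] using this.symm
      calc w * star z * (w * z) = w * (star z * w) * z := by noncomm_ring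
        _ = w * w * (star z * z) := by rw [this]; noncomm_ring
        _ = 1 := by rw [hz1, hww]
    · rw [star_mul, hwsa]
      have : star z * w = w * star z := by
        have := congrArg star hzw
        simpa [hwsa] using this.symm
      calc z * w * (w * star z) = (z * w) * w * star z := by noncomm_ring
        _ = w * (z * w) * star z := by nth_rw 1 [hzw]; noncomm_ring
        _ = w * w * (z * star z) := by rw [hzw]; noncomm_ring
        _ = 1 := by rw [hz2, hww]
  · have : z * p' = p * z := by
      rw [hz]
      simp only [mul_sub, mul_add, sub_mul, add_mul, mul_assoc, hp2, hq2, ppp, qqq, one_mul, mul_one]; abel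
    rw [mul_assoc, ← cq, ← mul_assoc, this, mul_assoc]
  · have e : z * w - 1 = (z - 1) * w + (w - 1) := by noncomm_ring
    have e2 : z - 1 = p * d - d * p' := by
      rw [hz, hdd]
      simp only [mul_sub, mul_add, sub_mul, add_mul, mul_assoc, hp2, hq2, ppp, qqq, one_mul, mul_one]; abel
    have hq := proj_norm_le hq1 hq2
    have n1 : ‖z - 1‖ ≤ 2 * ‖d‖ := by
      rw [e2]
      have := norm_sub_le (p * d) (d * p')
      have := nmul_le hp le_rfl (b := d)
      have := nmul_le le_rfl hq (a := d)
      linarith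
    have n2 : ‖w‖ ≤ 3 / 2 := by
      rcases subsingleton_or_nontrivial A with hA | hA
      · rw [Subsingleton.elim w 0]; norm_num
      · have := norm_add_le (w - 1) 1
        rw [sub_add_cancel, CStarRing.norm_one] at this
        linarith
    rw [e]
    have := norm_add_le ((z - 1) * w) (w - 1)
    have := nmul_le n1 n2
    linarith
  · intro x hx hx'
    have hxd : x * (d * d) = d * d * x := by
      have : x * d = d * x := by rw [hdd, mul_sub, sub_mul, hx, hx']
      rw [← mul_assoc, this, mul_assoc, this, mul_assoc]
    have h1 : x * (p * p') = p * p' * x := by rw [← mul_assoc, hx, mul_assoc, hx', mul_assoc]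
    have h2 : x * z = z * x := by
      rw [hz]
      simp only [mul_sub, mul_add, sub_mul, add_mul, mul_one, one_mul, h1, hx, hx']
    rw [← mul_assoc, h2, mul_assoc, hcomm x hxd, mul_assoc]

/-- two-sided annihilator of a self-adjoint element -/
def annih (e : A) (he : star e = e) : NonUnitalStarSubalgebra ℂ A where
  carrier := {x | e * x = 0 ∧ x * e = 0}
  add_mem' := by
    rintro a b ⟨h1, h2⟩ ⟨h3, h4⟩
    exact ⟨by rw [mul_add, h1, h3, add_zero], by rw [add_mul, h2, h4, add_zero]⟩
  zero_mem' := by simp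
  mul_mem' := by
    rintro a b ⟨h1, h2⟩ ⟨h3, h4⟩
    exact ⟨by rw [← mul_assoc, h1, zero_mul], by rw [mul_assoc, h4, mul_zero]⟩
  smul_mem' := by
    rintro c a ⟨h1, h2⟩
    exact ⟨by rw [mul_smul_comm, h1, smul_zero], by rw [smul_mul_assoc, h2, smul_zero]⟩
  star_mem' := by
    rintro a ⟨h1, h2⟩
    constructor
    · have := congrArg star h2
      simpa [he] using this
    · have := congrArg star h1
      simpa [he] using this

lemma mem_annih (e : A) (he : star e = e) (x : A) : x ∈ annih e he ↔ e * x = 0 ∧ x * e = 0 :=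
  Iff.rfl

lemma annih_closed (e : A) (he : star e = e) : IsClosed (annih e he : Set A) := by
  have : (annih e he : Set A) = {x | e * x = 0} ∩ {x | x * e = 0} := rfl
  rw [this]
  exact (isClosed_eq (by fun_prop) (by fun_prop)).inter (isClosed_eq (by fun_prop) (by fun_prop))

lemma conj_near (u c : A) (hu : u ∈ unitary A) : ‖u * c * star u‖ ≤ ‖c‖ ∧
    ‖c - u * c * star u‖ ≤ ‖u - 1‖ * ‖c‖ * 2 := by
  have hu1 : ‖u‖ ≤ 1 := by
    have h := CStarRing.norm_star_mul_self (x := u)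
    rw [(Unitary.mem_iff.mp hu).1] at h
    have h1 : ‖(1 : A)‖ ≤ 1 := proj_norm_le (star_one A) (mul_one 1)
    by_contra! hc
    nlinarith
  have hu2 : ‖star u‖ ≤ 1 := by rw [norm_star]; exact hu1
  constructor
  · have := nmul_le (nmul_le hu1 (le_refl ‖c‖)) hu2
    linarith
  · have e : c - u * c * star u = (c * u - u * c) * star u := by
      rw [sub_mul, mul_assoc c, (Unitary.mem_iff.mp hu).2, mul_one]
    have e2 : c * u - u * c = c * (u - 1) - (u - 1) * c := by noncomm_ring
    rw [e, e2]
    have i1 := nmul_le (le_refl ‖c‖) (le_refl ‖u - 1‖)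
    have i2 := nmul_le (le_refl ‖u - 1‖) (le_refl ‖c‖)
    have i3 := norm_sub_le (c * (u - 1)) ((u - 1) * c)
    have := nmul_le (i3.trans (add_le_add i1 i2)) hu2
    linarith

/-- conjugating a subalgebra by a unitary -/
lemma exists_conj (𝒞 : NonUnitalStarSubalgebra ℂ A → Prop)
    (h𝒞iso : ∀ S T : NonUnitalStarSubalgebra ℂ A, (S ≃⋆ₐ[ℂ] T) → 𝒞 S → 𝒞 T)
    (C : NonUnitalStarSubalgebra ℂ A) (hC : 𝒞 C) (u : A) (hu : u ∈ unitary A) :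
    ∃ C' : NonUnitalStarSubalgebra ℂ A, 𝒞 C' ∧ ∀ c ∈ C, u * c * star u ∈ C' := by
  have hus := (Unitary.mem_iff.mp hu).1
  have hk : ∀ x : A, star u * (u * x) = x := fun x => by rw [← mul_assoc, hus, one_mul]
  let φ : A →⋆ₙₐ[ℂ] A :=
    { toFun := fun x => u * x * star u
      map_smul' := fun c x => by simp
      map_zero' := by simp
      map_add' := fun x y => by simp [mul_add, add_mul]
      map_mul' := fun x y => by simp [mul_assoc, hk]
      map_star' := fun x => by simp [mul_assoc] }
  have hφ : ∀ x, φ x = u * x * star u := fun x => rfl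
  have hinj : Function.Injective φ := by
    intro x y hxy
    rw [hφ, hφ] at hxy
    have := congrArg (fun z => star u * (z * u)) hxy
    simpa [mul_assoc, hk, hus] using this
  let ψ : C →⋆ₙₐ[ℂ] (C.map φ) :=
    { toFun := fun x => ⟨φ x, x, x.2, rfl⟩
      map_smul' := fun c x => Subtype.ext (by simp)
      map_zero' := Subtype.ext (by simp)
      map_add' := fun x y => Subtype.ext (by simp)
      map_mul' := fun x y => Subtype.ext (by simp)
      map_star' := fun x => Subtype.ext (by simp [map_star]) }
  have hψ : Function.Bijective ψ := by
    constructor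
    · intro x y hxy
      exact Subtype.ext (hinj (congrArg Subtype.val hxy))
    · rintro ⟨y, x, hx, rfl⟩
      exact ⟨⟨x, hx⟩, rfl⟩
  exact ⟨C.map φ, h𝒞iso C _ (StarAlgEquiv.ofBijective ψ hψ) hC, fun c hc => ⟨c, hc, rfl⟩⟩

lemma exists_good (𝒞 : NonUnitalStarSubalgebra ℂ A → Prop)
    (h𝒞closed : ∀ S, 𝒞 S → IsClosed (S : Set A))
    (h𝒞iso : ∀ S T : NonUnitalStarSubalgebra ℂ A, (S ≃⋆ₐ[ℂ] T) → 𝒞 S → 𝒞 T)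
    (C : NonUnitalStarSubalgebra ℂ A) (hC : 𝒞 C) (e p : A) (he1 : star e = e) (he2 : e * e = e)
    (hp1 : star p = p) (hp2 : p * p = p) (hpe : p * e = 0) (hep : e * p = 0) (η : ℝ)
    (hη : η ≤ 1 / 4000) (c₁ c₂ : A) (hc₁ : c₁ ∈ C) (hc₂ : c₂ ∈ C) (h₁ : ‖e - c₁‖ ≤ η)
    (h₂ : ‖p - c₂‖ ≤ η) :
    ∃ C' : NonUnitalStarSubalgebra ℂ A, 𝒞 C' ∧ e ∈ C' ∧ p ∈ C' ∧
      ∀ c ∈ C, ∃ c' ∈ C', ‖c'‖ ≤ ‖c‖ ∧ ‖c - c'‖ ≤ 12000 * η * ‖c‖ := by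
  have hη0 : 0 ≤ η := (norm_nonneg _).trans h₁
  obtain ⟨e', he'C, he'1, he'2, he'⟩ :=
    exists_proj_near C (h𝒞closed C hC) e c₁ he1 he2 hc₁ h₁ (by linarith)
  obtain ⟨u, hu, hue, hun, -⟩ := exists_unitary e e' he1 he2 he'1 he'2 (by linarith)
  obtain ⟨C₁, hC₁, hcon⟩ := exists_conj 𝒞 h𝒞iso C hC u hu
  have heC₁ : e ∈ C₁ := by
    have := hcon e' he'C
    rwa [hue, mul_assoc, (Unitary.mem_iff.mp hu).2, mul_one] at this
  have hun' : ‖u - 1‖ ≤ 36 * η := by linarith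
  have hpn := proj_norm_le hp1 hp2
  have hc₂n : ‖c₂‖ ≤ 2 := by
    have := norm_sub_le p (p - c₂)
    rw [sub_sub_cancel] at this
    linarith
  set c := u * c₂ * star u with hc
  have hcC₁ : c ∈ C₁ := hcon c₂ hc₂
  have hpc : ‖p - c‖ ≤ 145 * η := by
    have i1 := (conj_near u c₂ hu).2
    have i2 := norm_add_le (p - c₂) (c₂ - c)
    rw [sub_add_sub_cancel] at i2
    have i3 : ‖u - 1‖ * ‖c₂‖ ≤ 36 * η * 2 :=
      mul_le_mul hun' hc₂n (norm_nonneg _) (by linarith)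
    linarith
  have hen := proj_norm_le he1 he2
  have h1en : ‖1 - e‖ ≤ 1 := proj_norm_le (by simp [he1]) (by
    simp [mul_sub, sub_mul, he2])
  have eee : ∀ x, e * (e * x) = e * x := fun x => by rw [← mul_assoc, he2]
  set a := (1 - e) * c * (1 - e) with ha
  have hae : a = c - e * c - c * e + e * c * e := by rw [ha]; noncomm_ring
  have haC₁ : a ∈ C₁ := by
    rw [hae]
    exact add_mem (sub_mem (sub_mem hcC₁ (mul_mem heC₁ hcC₁)) (mul_mem hcC₁ heC₁))
      (mul_mem (mul_mem heC₁ hcC₁) heC₁)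
  have haann : a ∈ annih e he1 := by
    rw [mem_annih, hae]
    constructor
    · simp only [mul_add, mul_sub, mul_assoc, he2, eee]; abel
    · simp only [add_mul, sub_mul, mul_assoc, he2, eee]; abel
  have hpa : ‖p - a‖ ≤ 145 * η := by
    have : p - a = (1 - e) * (p - c) * (1 - e) := by
      have : (1 - e) * p * (1 - e) = p := by
        simp [sub_mul, mul_sub, hpe, hep]
      rw [mul_sub (1 - e) p c, sub_mul _ _ (1 - e), this]
    rw [this]
    have := nmul_le (nmul_le h1en hpc) h1en
    linarith
  obtain ⟨p', ⟨hp'C, hp'ann⟩, hp'1, hp'2, hp'⟩ := exists_proj_near (C₁ ⊓ annih e he1)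
    ((h𝒞closed C₁ hC₁).inter (annih_closed e he1)) p a hp1 hp2 ⟨haC₁, haann⟩ hpa (by linarith)
  obtain ⟨hp'e, hep'⟩ := (mem_annih e he1 p').mp hp'ann
  obtain ⟨v, hv, hvp, hvn, hvc⟩ := exists_unitary p p' hp1 hp2 hp'1 hp'2 (by linarith)
  have hve := hvc e (by rw [hpe, hep]) (by rw [hp'e, hep'])
  obtain ⟨C₂, hC₂, hcon₂⟩ := exists_conj 𝒞 h𝒞iso C₁ hC₁ v hv
  have hvv := (Unitary.mem_iff.mp hv).2
  refine ⟨C₂, hC₂, ?_, ?_, ?_⟩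
  · have := hcon₂ e heC₁
    rwa [← hve, mul_assoc, hvv, mul_one] at this
  · have := hcon₂ p' hp'C
    rwa [hvp, mul_assoc, hvv, mul_one] at this
  · intro x hx
    obtain ⟨n1, n2⟩ := conj_near u x hu
    obtain ⟨n3, n4⟩ := conj_near v (u * x * star u) hv
    refine ⟨_, hcon₂ _ (hcon x hx), n3.trans n1, ?_⟩
    have i := norm_add_le (x - u * x * star u) (u * x * star u - v * (u * x * star u) * star v)
    rw [sub_add_sub_cancel] at i
    have i1 : ‖u - 1‖ * ‖x‖ ≤ 36 * η * ‖x‖ := mul_le_mul_of_nonneg_right hun' (norm_nonneg _)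
    have i2 : ‖v - 1‖ * ‖u * x * star u‖ ≤ 5220 * η * ‖x‖ :=
      mul_le_mul (by linarith) n1 (norm_nonneg _) (by linarith)
    have : 0 ≤ η * ‖x‖ := by positivity
    linarith

lemma exists_pos (E : NonUnitalStarSubalgebra ℂ A) (hE : IsClosed (E : Set A)) [PartialOrder A]
    [StarOrderedRing A] (a b : A) (ha : 0 ≤ a) (ha1 : ‖a‖ ≤ 1) (hb : b ∈ E)
    (hbs : IsSelfAdjoint b) {δ : ℝ} (hδ : ‖b - a‖ ≤ δ) :
    ∃ k ∈ E, 0 ≤ k ∧ ‖k‖ ≤ 1 ∧ ‖k - b‖ ≤ δ := by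
  have hδ0 : 0 ≤ δ := (norm_nonneg _).trans hδ
  have hsa : IsSelfAdjoint (b - a) := hbs.sub (IsSelfAdjoint.of_nonneg ha)
  have m : algebraMap ℝ A ‖b - a‖ ≤ algebraMap ℝ A δ := algebraMap_mono A hδ
  have u1 : b ≤ algebraMap ℝ A (1 + δ) := by
    have i1 : b - a ≤ algebraMap ℝ A δ := hsa.le_algebraMap_norm_self.trans m
    have i2 : a ≤ 1 := (CStarAlgebra.norm_le_one_iff_of_nonneg a ha).mp ha1
    have := add_le_add i2 i1
    rw [map_add, map_one]
    simpa using this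
  have u2 : algebraMap ℝ A (-δ) ≤ b := by
    have i1 : - algebraMap ℝ A δ ≤ b - a :=
      (neg_le_neg m).trans hsa.neg_algebraMap_norm_le_self
    have := add_le_add i1 ha
    rw [map_neg]
    simpa using this
  have s1 := (le_algebraMap_iff_spectrum_le (R := ℝ) (a := b)).mp u1
  have s2 := (algebraMap_le_iff_le_spectrum (R := ℝ) (a := b)).mp u2
  let g : ℝ → ℝ := fun t => max 0 (min 1 t)
  have hg : Continuous g := by fun_prop
  have hgo : ContinuousOn g (quasispectrum ℝ b) := hg.continuousOn
  have hg0 : g 0 = 0 := by simp [g]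
  have hg1 : ∀ t, 0 ≤ g t := fun t => le_max_left _ _
  have hg2 : ∀ t, g t ≤ 1 := fun t => max_le zero_le_one (min_le_left _ _)
  refine ⟨cfcₙ g b, cfcₙ_mem (𝕜' := ℂ) g hb, cfcₙ_nonneg (fun t _ => hg1 t), ?_, ?_⟩
  · apply norm_cfcₙ_le
    intro t _
    rw [Real.norm_eq_abs, abs_of_nonneg (hg1 t)]; exact hg2 t
  · nth_rw 2 [← cfcₙ_id' ℝ b]
    rw [← cfcₙ_sub g (fun x => x) b hgo hg0]
    apply norm_cfcₙ_le
    intro t ht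
    have : -δ ≤ t ∧ t ≤ 1 + δ := by
      rw [quasispectrum_eq_spectrum_union_zero] at ht
      rcases ht with ht | ht
      · exact ⟨s2 t ht, s1 t ht⟩
      · rw [Set.mem_singleton_iff.mp ht]; constructor <;> linarith
    rw [Real.norm_eq_abs, abs_le]
    simp only [g]
    rcases max_cases 0 (min 1 t) with h | h <;> rcases min_cases 1 t with h' | h' <;>
      constructor <;> linarith

/-- The core perturbation step: replacing `h` by a good `h'`. -/
lemma exists_split [PartialOrder A] [StarOrderedRing A]
    (E : NonUnitalStarSubalgebra ℂ A) (hE : IsClosed (E : Set A)) (e : A)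
    (heE : e ∈ E) (hu : ∀ x ∈ E, e * x = x ∧ x * e = x) (he1 : star e = e) (he2 : e * e = e)
    (h : A) (hpos : 0 ≤ h) (hn : ‖h‖ ≤ 1) (δ : ℝ) (hδ : δ ≤ 1 / 100) (k m : A)
    (hk : k ∈ E) (hm : m ∈ E) (hhk : ‖h * e - k‖ ≤ δ) (hhm : ‖h * (1 - h) - m‖ ≤ δ) :
    ∃ hE ∈ E, ∃ p : A, 0 ≤ hE ∧ ‖hE‖ ≤ 1 ∧ star p = p ∧ p * p = p ∧ p * e = 0 ∧ e * p = 0 ∧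
      0 ≤ hE + p ∧ ‖hE + p‖ ≤ 1 ∧ ‖h - (hE + p)‖ ≤ 8 * δ := by
  have hδ0 : 0 ≤ δ := (norm_nonneg _).trans hhk
  have hs : star h = h := (IsSelfAdjoint.of_nonneg hpos).star_eq
  have hen := proj_norm_le he1 he2
  have h1e1 : star (1 - e) = 1 - e := by simp [he1]
  have h1e2 : (1 - e) * (1 - e) = 1 - e := by simp [mul_sub, sub_mul, he2]
  have h1en := proj_norm_le h1e1 h1e2
  have eee : ∀ x, e * (e * x) = e * x := fun x => by rw [← mul_assoc, he2]
  have j1 : ‖(1 - e) * (h * e)‖ ≤ δ := by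
    have : (1 - e) * (h * e) = (1 - e) * (h * e - k) := by
      rw [mul_sub (1 - e) (h * e), sub_mul 1 e k, (hu k hk).1]; simp
    rw [this]
    simpa using nmul_le h1en hhk
  have j2 : ‖e * h * (1 - e)‖ ≤ δ := by
    rw [← norm_star]
    simpa [hs, he1, mul_assoc] using j1
  have j3 : ‖e * h * e - k‖ ≤ δ := by
    have : e * h * e - k = e * (h * e - k) := by rw [mul_sub, (hu k hk).1, mul_assoc]
    rw [this]
    simpa using nmul_le hen hhk
  have hehe : 0 ≤ e * h * e := by
    have := star_left_conjugate_nonneg hpos e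
    rwa [he1] at this
  have hehen : ‖e * h * e‖ ≤ 1 := by simpa using nmul_le (nmul_le hen hn) hen
  obtain ⟨b, hbE, hbs, hb⟩ := exists_re E k (e * h * e) hk
    (IsSelfAdjoint.of_nonneg hehe).star_eq j3
  obtain ⟨hE', hE'E, hE'0, hE'1, hE'b⟩ := exists_pos E hE (e * h * e) b hehe hehen hbE hbs hb
  set a := (1 - e) * h * (1 - e) with ha
  have hasa : IsSelfAdjoint a := by
    rw [isSelfAdjoint_iff, ha, star_mul, star_mul, h1e1, hs, mul_assoc]
  have haa : a * a - a = -((1 - e) * (h * (1 - h) - m) * (1 - e)) -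
      (1 - e) * (h * e) * (e * h * (1 - e)) := by
    have x1 : (1 - e) * m = 0 := by rw [sub_mul, (hu m hm).1]; simp
    have x2 : (1 - e) * (h * (1 - h) - m) * (1 - e) = (1 - e) * (h * (1 - h)) * (1 - e) := by
      rw [mul_sub (1 - e) _ m, x1, sub_zero]
    have x3 : a * a = (1 - e) * h * ((1 - e) * (1 - e)) * h * (1 - e) := by
      rw [ha]; simp only [mul_assoc]
    have x4 : (1 - e) * (h * e) * (e * h * (1 - e)) = (1 - e) * h * (e * e) * h * (1 - e) := by
      simp only [mul_assoc]
    rw [x2, x3, x4, h1e2, he2, ha]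
    noncomm_ring
  have haan : ‖a * a - a‖ ≤ 2 * δ := by
    rw [haa]
    have i1 := nmul_le (nmul_le h1en hhm) h1en
    have i2 := nmul_le j1 j2
    have := norm_sub_le (-((1 - e) * (h * (1 - h) - m) * (1 - e)))
      ((1 - e) * (h * e) * (e * h * (1 - e)))
    rw [norm_neg] at this
    nlinarith
  have haann : a ∈ annih e he1 := by
    rw [mem_annih, ha]
    constructor
    · simp only [mul_sub, sub_mul, mul_assoc, he2, eee, mul_one, one_mul]; abel
    · simp only [mul_sub, sub_mul, mul_assoc, he2, eee, mul_one, one_mul]; abel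
  obtain ⟨p, hpann, hp1, hp2, hpa⟩ := exists_proj (annih e he1) (annih_closed e he1) a haann hasa
    (by linarith)
  obtain ⟨hep, hpe⟩ := (mem_annih e he1 p).mp hpann
  have hp0 : 0 ≤ p := by
    have := star_mul_self_nonneg p
    rwa [hp1, hp2] at this
  have hsum0 : 0 ≤ hE' + p := add_nonneg hE'0 hp0
  refine ⟨hE', hE'E, p, hE'0, hE'1, hp1, hp2, hpe, hep, hsum0, ?_, ?_⟩
  · rw [CStarAlgebra.norm_le_one_iff_of_nonneg _ hsum0]
    have i1 : hE' ≤ e := by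
      have := star_left_conjugate_le_conjugate
        ((CStarAlgebra.norm_le_one_iff_of_nonneg _ hE'0).mp hE'1) e
      rwa [he1, (hu hE' hE'E).1, (hu hE' hE'E).2, mul_one, he2] at this
    have i2 : 0 ≤ 1 - e - p := by
      have := star_mul_self_nonneg (1 - e - p)
      have x : star (1 - e - p) * (1 - e - p) = 1 - e - p := by
        simp [he1, hp1, mul_sub, sub_mul, he2, hp2, hep, hpe]
      rwa [x] at this
    have := add_le_add i1 (le_refl p)
    refine this.trans ?_
    rw [← sub_nonneg]
    simpa [sub_sub] using i2
  · have x : h - (hE' + p) = (1 - e) * (h * e) + e * h * (1 - e) - (hE' - b) - (b - e * h * e)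
        - (p - a) := by
      rw [ha]; noncomm_ring
    rw [x]
    have n1 := norm_sub_le ((1 - e) * (h * e) + e * h * (1 - e) - (hE' - b) - (b - e * h * e))
      (p - a)
    have n2 := norm_sub_le ((1 - e) * (h * e) + e * h * (1 - e) - (hE' - b)) (b - e * h * e)
    have n3 := norm_sub_le ((1 - e) * (h * e) + e * h * (1 - e)) (hE' - b)
    have n4 := norm_add_le ((1 - e) * (h * e)) (e * h * (1 - e))
    linarith

/-- transfer of approximate membership -/
lemma memEps_transfer (C C' : NonUnitalStarSubalgebra ℂ A) (κ : ℝ) (hκ : 0 ≤ κ)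
    (ht : ∀ c ∈ C, ∃ c' ∈ C', ‖c'‖ ≤ ‖c‖ ∧ ‖c - c'‖ ≤ κ * ‖c‖) (y y' : A) (δ δ' R ε : ℝ)
    (hy : MemEps δ (C : Set A) y) (hyy : ‖y' - y‖ ≤ δ') (hR : ‖y‖ + δ ≤ R)
    (hε : δ + δ' + κ * R ≤ ε) : MemEps ε (C' : Set A) y' := by
  obtain ⟨c, hc, hyc⟩ := hy
  obtain ⟨c', hc', h1, h2⟩ := ht c hc
  refine ⟨c', hc', ?_⟩
  have n1 : ‖c‖ ≤ R := by
    have := norm_sub_le y (y - c)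
    rw [sub_sub_cancel] at this
    linarith
  have n2 := mul_le_mul_of_nonneg_left n1 hκ
  have x : y' - c' = (y' - y) + (y - c) + (c - c') := by abel
  rw [x]
  have := norm_add₃_le (a := y' - y) (b := y - c) (c := c - c')
  linarith

lemma subsetEps_transfer (E C C' : NonUnitalStarSubalgebra ℂ A) (κ : ℝ) (hκ : 0 ≤ κ)
    (ht : ∀ c ∈ C, ∃ c' ∈ C', ‖c'‖ ≤ ‖c‖ ∧ ‖c - c'‖ ≤ κ * ‖c‖) (δ ε : ℝ)
    (hs : SubsetEps δ (E : Set A) (C : Set A)) (hε : δ + κ ≤ ε) :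
    SubsetEps ε (E : Set A) (C' : Set A) := by
  intro s hsE hsn
  obtain ⟨t, htC, htn, hst⟩ := hs s hsE hsn
  obtain ⟨t', ht', h1, h2⟩ := ht t htC
  refine ⟨t', ht', h1.trans htn, ?_⟩
  have n2 := mul_le_mul_of_nonneg_left htn hκ
  have := norm_add_le (s - t) (t - t')
  rw [sub_add_sub_cancel] at this
  linarith

lemma nonneg_iff_sq [PartialOrder A] [StarOrderedRing A] (a : A) :
    (∃ x : A, a = star x * x) ↔ 0 ≤ a :=
  CStarAlgebra.nonneg_iff_eq_star_mul_self.symm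

end helpers

/-- Let `A` be a unital C*-algebra and `𝒞` a class of unital C*-algebras,
closed under *-isomorphism, modeled as an isomorphism-invariant predicate on (closed, unital)
C*-subalgebras of `A`.  Then `A` decomposes over `𝒞` if and only if the strengthened
condition of Lemma 2.8 of the paper holds. -/
theorem decomposes_iff_good_h {A : Type u} [CStarAlgebra A]
    (𝒞 : NonUnitalStarSubalgebra ℂ A → Prop)
    (h𝒞closed : ∀ S, 𝒞 S → IsClosed (S : Set A))
    (h𝒞unital : ∀ S, 𝒞 S → ∃ e ∈ S, ∀ x ∈ S, e * x = x ∧ x * e = x)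
    (h𝒞iso : ∀ S T : NonUnitalStarSubalgebra ℂ A, (S ≃⋆ₐ[ℂ] T) → 𝒞 S → 𝒞 T) :
    Decomposes A 𝒞 ↔
      ∀ (X : Finset A) (ε : ℝ), 0 < ε →
        ∃ C D E : NonUnitalStarSubalgebra ℂ A, 𝒞 C ∧ 𝒞 D ∧ 𝒞 E ∧
          ∃ h : A, (∃ x : A, h = star x * x) ∧ ‖h‖ ≤ 1 ∧
            -- (i) `h` almost commutes with `X`
            (∀ x ∈ X, ‖h * x - x * h‖ < ε) ∧
            -- (ii) cutting conditions
            (∀ x ∈ X, MemEps ε (C : Set A) (h * x)) ∧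
            (∀ x ∈ X, MemEps ε (D : Set A) ((1 - h) * x)) ∧
            (∀ x ∈ X, MemEps ε (E : Set A) (h * ((1 - h) * x))) ∧
            -- (iii) `E ⊆_ε C`, `E ⊆_ε D`, and `1_E ∈ C ∩ D`
            SubsetEps ε (E : Set A) (C : Set A) ∧
            SubsetEps ε (E : Set A) (D : Set A) ∧
            ∃ oneE ∈ E, (∀ x ∈ E, oneE * x = x ∧ x * oneE = x) ∧
              oneE ∈ C ∧ oneE ∈ D ∧
              -- (iv) the spectral decomposition of `h`
              ∃ hE ∈ E, (∃ x : A, hE = star x * x) ∧ ‖hE‖ ≤ 1 ∧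
                ∃ p ∈ C, star p = p ∧ p * p = p ∧ p * oneE = 0 ∧ oneE * p = 0 ∧
                  ∃ q ∈ D, star q = q ∧ q * q = q ∧ q * oneE = 0 ∧ oneE * q = 0 ∧
                    h = hE + p ∧ 1 - h = (oneE - hE) + q ∧ (1 : A) = oneE + p + q := by
  letI : PartialOrder A := CStarAlgebra.spectralOrder A
  haveI : StarOrderedRing A := CStarAlgebra.spectralOrderedRing A
  constructor
  · intro hdec X ε hε
    obtain ⟨M, hM0, hM⟩ : ∃ M : ℝ, 1 ≤ M ∧ ∀ x ∈ X, ‖x‖ ≤ M := by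
      refine ⟨1 + ∑ x ∈ X, ‖x‖, ?_, ?_⟩
      · have := Finset.sum_nonneg (s := X) (f := fun x => ‖x‖) (fun x _ => norm_nonneg x)
        linarith
      · intro x hx
        have := Finset.single_le_sum (s := X) (f := fun x => ‖x‖) (fun x _ => norm_nonneg x) hx
        linarith
    obtain ⟨δ, hδ0, hδ1, hδ2⟩ : ∃ δ : ℝ, 0 < δ ∧ δ ≤ 1 / 1000000 ∧ δ * (1000000 * M) ≤ ε := by
      refine ⟨min (1 / 1000000) (ε / (1000000 * M)), ?_, min_le_left _ _, ?_⟩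
      · have : 0 < ε / (1000000 * M) := by positivity
        exact lt_min (by norm_num) this
      · rw [← le_div_iff₀ (by positivity)]
        exact min_le_right _ _
    have hδM : δ ≤ δ * M := by nlinarith
    classical
    obtain ⟨C, D, E, hC, hD, hE, h, hpos, hn, hcomm, hXC, hXD, hXE, hEC, hED, hhE⟩ :=
      hdec (insert 1 X) δ hδ0
    rw [nonneg_iff_sq] at hpos
    obtain ⟨e, heE, hu⟩ := h𝒞unital E hE
    have he2 : e * e = e := (hu e heE).1
    have he1 : star e = e := by
      have h1 := (hu (star e) (star_mem heE)).1
      have h2 := congrArg star h1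
      rw [star_mul, star_star] at h2
      exact h1.symm.trans h2
    have hen := proj_norm_le he1 he2
    obtain ⟨k, hk, hhk⟩ := hhE e heE hen
    obtain ⟨m, hm, hhm⟩ := hXE 1 (Finset.mem_insert_self _ _)
    rw [mul_one] at hhm
    obtain ⟨hE', hE'E, p, hE'0, hE'1, hp1, hp2, hpe, hep, hh'0, hh'1, hhh'⟩ :=
      exists_split E (h𝒞closed E hE) e heE hu he1 he2 h hpos hn δ (by linarith) k m hk hm
        hhk.le hhm.le
    set h' := hE' + p with hh'
    set q := 1 - e - p with hq
    have hq1 : star q = q := by simp [hq, he1, hp1]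
    have hq2 : q * q = q := by
      simp [hq, mul_sub, sub_mul, he2, hp2, hep, hpe]
    have hqe : q * e = 0 := by simp [hq, sub_mul, he2, hpe]
    have heq : e * q = 0 := by simp [hq, mul_sub, he2, hep]
    obtain ⟨c₁, hc₁, -, hec₁⟩ := hEC e heE hen
    obtain ⟨c₂, hc₂, -, hEc₂⟩ := hEC hE' hE'E hE'1
    obtain ⟨c₃, hc₃, hhc₃⟩ := hXC 1 (Finset.mem_insert_self _ _)
    rw [mul_one] at hhc₃
    obtain ⟨d₁, hd₁, -, hed₁⟩ := hED e heE hen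
    obtain ⟨d₂, hd₂, -, hEd₂⟩ := hED hE' hE'E hE'1
    obtain ⟨d₃, hd₃, hhd₃⟩ := hXD 1 (Finset.mem_insert_self _ _)
    rw [mul_one] at hhd₃
    have hpC : ‖p - (c₃ - c₂)‖ ≤ 11 * δ := by
      have x : p - (c₃ - c₂) = (h - c₃) - (h - h') - (hE' - c₂) := by rw [hh']; abel
      rw [x]
      have n1 := norm_sub_le ((h - c₃) - (h - h')) (hE' - c₂)
      have n2 := norm_sub_le (h - c₃) (h - h')
      linarith
    have hqD : ‖q - (d₃ - d₁ + d₂)‖ ≤ 11 * δ := by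
      have x : q - (d₃ - d₁ + d₂) = (1 - h - d₃) + (h - h') + (hE' - d₂) - (e - d₁) := by
        rw [hh', hq]; abel
      rw [x]
      have n1 := norm_sub_le ((1 - h - d₃) + (h - h') + (hE' - d₂)) (e - d₁)
      have n2 := norm_add₃_le (a := 1 - h - d₃) (b := h - h') (c := hE' - d₂)
      linarith
    obtain ⟨C', hC', heC', hpC', htC⟩ := exists_good 𝒞 h𝒞closed h𝒞iso C hC e p he1 he2 hp1 hp2
      hpe hep (11 * δ) (by linarith) c₁ (c₃ - c₂) hc₁ (sub_mem hc₃ hc₂) (by linarith) hpC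
    obtain ⟨D', hD', heD', hqD', htD⟩ := exists_good 𝒞 h𝒞closed h𝒞iso D hD e q he1 he2 hq1 hq2
      hqe heq (11 * δ) (by linarith) d₁ (d₃ - d₁ + d₂) hd₁
      (add_mem (sub_mem hd₃ hd₁) hd₂) (by linarith) hqD
    have hκ : 0 ≤ 12000 * (11 * δ) := by positivity
    have h1n : ‖(1 : A)‖ ≤ 1 := proj_norm_le (star_one A) (mul_one 1)
    have h1h : ‖1 - h‖ ≤ 2 := (norm_sub_le _ _).trans (by linarith)
    have hsubn : ‖h' - h‖ ≤ 8 * δ := by rw [norm_sub_rev]; exact hhh'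
    refine ⟨C', D', E, hC', hD', hE, h', (nonneg_iff_sq h').mpr hh'0, hh'1, ?_, ?_, ?_, ?_, ?_,
      ?_, e, heE, hu, heC', heD', hE', hE'E, (nonneg_iff_sq hE').mpr hE'0, hE'1, p, hpC', hp1,
      hp2, hpe, hep, q, hqD', hq1, hq2, hqe, heq, hh', ?_, ?_⟩
    · intro x hx
      have n0 := hcomm x (Finset.mem_insert_of_mem hx)
      have y : h' * x - x * h' = (h * x - x * h) + (h' - h) * x - x * (h' - h) := by
        noncomm_ring
      rw [y]
      have n1 := norm_sub_le ((h * x - x * h) + (h' - h) * x) (x * (h' - h))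
      have n2 := norm_add_le (h * x - x * h) ((h' - h) * x)
      have n3 := nmul_le hsubn (hM x hx)
      have n4 := nmul_le (hM x hx) hsubn
      nlinarith
    · intro x hx
      refine memEps_transfer C C' _ hκ htC (h * x) (h' * x) δ (8 * δ * M) (M + 1) ε
        (hXC x (Finset.mem_insert_of_mem hx)) ?_ ?_ ?_
      · rw [← sub_mul]; exact nmul_le hsubn (hM x hx)
      · have := nmul_le hn (hM x hx)
        linarith
      · nlinarith
    · intro x hx
      refine memEps_transfer D D' _ hκ htD ((1 - h) * x) ((1 - h') * x) δ (8 * δ * M)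
        (2 * M + 1) ε (hXD x (Finset.mem_insert_of_mem hx)) ?_ ?_ ?_
      · rw [← sub_mul, sub_sub_sub_cancel_left]; exact nmul_le hhh' (hM x hx)
      · have := nmul_le h1h (hM x hx)
        linarith
      · nlinarith
    · intro x hx
      refine memEps_transfer E E 0 le_rfl (fun c hc => ⟨c, hc, le_rfl, by simp⟩)
        (h * ((1 - h) * x)) (h' * ((1 - h') * x)) δ (24 * δ * M)
        (2 * M + 1) ε (hXE x (Finset.mem_insert_of_mem hx)) ?_ ?_ ?_
      · have y : h' * ((1 - h') * x) - h * ((1 - h) * x) =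
            (h' - h) * ((1 - h) * x) + h' * ((h - h') * x) := by noncomm_ring
        rw [y]
        have n1 := nmul_le hsubn (nmul_le h1h (hM x hx))
        have n2 := nmul_le hh'1 (nmul_le hhh' (hM x hx))
        have n3 := norm_add_le ((h' - h) * ((1 - h) * x)) (h' * ((h - h') * x))
        nlinarith
      · have := nmul_le hn (nmul_le h1h (hM x hx))
        linarith
      · nlinarith
    · exact subsetEps_transfer E C C' _ hκ htC δ ε hEC (by linarith)
    · exact subsetEps_transfer E D D' _ hκ htD δ ε hED (by linarith)
    · rw [hh', hq]; abel
    · rw [hq]; abel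
  · intro hgood X ε hε
    obtain ⟨C, D, E, hC, hD, hE, h, hpos, hn, hcomm, hXC, hXD, hXE, hEC, hED, e, heE, hu, -, -,
      hE', hE'E, -, -, p, -, -, -, hpe, -, q, -, -, -, -, -, hh, -, -⟩ := hgood X ε hε
    refine ⟨C, D, E, hC, hD, hE, h, hpos, hn, hcomm, hXC, hXD, hXE, hEC, hED, ?_⟩
    intro x hx _
    refine ⟨hE' * x, mul_mem hE'E hx, ?_⟩
    have : p * x = 0 := by rw [← (hu x hx).1, ← mul_assoc, hpe, zero_mul]
    rw [hh, add_mul, this]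
    simpa using hε
end

section
/- Let 𝒞 be a class of unital C*-algebras that contains ℂ, is closed under finite direct sums, and is closed under *-isomorphism (modeled as a suitably closed, isomorphism-invariant predicate on C*-subalgebras). A unital C*-algebra A decomposes over 𝒞 if and only if: for every finite subset X of A and every ε > 0 there exist C*-subalgebras C, D, E of A belonging to 𝒞 that each contain the unit 1_A, and a positive contraction h ∈ E, such that (i) ‖[h, x]‖ < ε for all x ∈ X; (ii) hx ∈_ε C, (1 − h)x ∈_ε D, and h(1 − h)x ∈_ε E for all x ∈ X; and (iii) E ⊆_ε C and E ⊆_ε D. -/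
universe u

/-- The one-dimensional C*-subalgebra spanned by a projection. -/
def projLine {A : Type u} [CStarAlgebra A] (q : A) (hq : IsStarProjection q) :
    NonUnitalStarSubalgebra ℂ A where
  carrier := {x | ∃ c : ℂ, x = c • q}
  add_mem' := by
    rintro _ _ ⟨c, rfl⟩ ⟨d, rfl⟩
    exact ⟨c + d, by rw [add_smul]⟩
  zero_mem' := ⟨0, by simp⟩
  mul_mem' := by
    rintro _ _ ⟨c, rfl⟩ ⟨d, rfl⟩
    exact ⟨c * d, by rw [smul_mul_smul_comm, hq.isIdempotentElem.eq]⟩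
  smul_mem' := by
    rintro c _ ⟨d, rfl⟩
    exact ⟨c * d, by rw [mul_smul]⟩
  star_mem' := by
    rintro _ ⟨c, rfl⟩
    exact ⟨star c, by rw [star_smul, hq.isSelfAdjoint.star_eq]⟩

theorem mem_projLine {A : Type u} [CStarAlgebra A] {q : A} (hq : IsStarProjection q) {x : A} :
    x ∈ projLine q hq ↔ ∃ c : ℂ, x = c • q := Iff.rfl

/-- The line through a nonzero projection is `ℂ`. -/
theorem projLine_equiv {A : Type u} [CStarAlgebra A] (q : A) (hq : IsStarProjection q)
    (h0 : q ≠ 0) : Nonempty (projLine q hq ≃⋆ₐ[ℂ] ℂ) := by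
  let f : ℂ → projLine q hq := fun c => ⟨c • q, c, rfl⟩
  have hf : Function.Bijective f := by
    constructor
    · intro c d h
      have h1 : c • q = d • q := congrArg Subtype.val h
      exact smul_left_injective ℂ h0 h1
    · rintro ⟨x, c, rfl⟩
      exact ⟨c, rfl⟩
  let g : ℂ ≃⋆ₐ[ℂ] projLine q hq :=
    { Equiv.ofBijective f hf with
      map_mul' := by
        intro c d
        apply Subtype.ext
        change (c * d) • q = (c • q) * (d • q)
        rw [smul_mul_smul_comm, hq.isIdempotentElem.eq]
      map_add' := by
        intro c d
        apply Subtype.ext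
        change (c + d) • q = (c • q) + (d • q)
        rw [add_smul]
      map_star' := by
        intro c
        apply Subtype.ext
        change (star c) • q = star (c • q)
        rw [star_smul, hq.isSelfAdjoint.star_eq]
      map_smul' := by
        intro c d
        apply Subtype.ext
        change (c • d) • q = c • (d • q)
        rw [smul_assoc] }
  exact ⟨g.symm⟩

/-- Elements of an orthogonal sum. -/
theorem mem_sup_projLine {A : Type u} [CStarAlgebra A] (S : NonUnitalStarSubalgebra ℂ A)
    (q : A) (hq : IsStarProjection q) (ho : ∀ s ∈ S, s * q = 0 ∧ q * s = 0) {x : A}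
    (hx : x ∈ S ⊔ projLine q hq) : ∃ s ∈ S, ∃ c : ℂ, x = s + c • q := by
  let U : NonUnitalStarSubalgebra ℂ A :=
    { carrier := {x | ∃ s ∈ S, ∃ c : ℂ, x = s + c • q}
      add_mem' := by
        rintro _ _ ⟨s, hs, c, rfl⟩ ⟨t, ht, d, rfl⟩
        exact ⟨s + t, add_mem hs ht, c + d, by rw [add_smul]; abel⟩
      zero_mem' := ⟨0, zero_mem _, 0, by simp⟩
      mul_mem' := by
        rintro _ _ ⟨s, hs, c, rfl⟩ ⟨t, ht, d, rfl⟩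
        refine ⟨s * t, mul_mem hs ht, c * d, ?_⟩
        rw [add_mul, mul_add, mul_add, smul_mul_smul_comm, hq.isIdempotentElem.eq,
          mul_smul_comm, smul_mul_assoc, (ho s hs).1, (ho t ht).2]
        simp
      smul_mem' := by
        rintro c _ ⟨s, hs, d, rfl⟩
        exact ⟨c • s, SMulMemClass.smul_mem c hs, c * d, by rw [smul_add, mul_smul]⟩
      star_mem' := by
        rintro _ ⟨s, hs, c, rfl⟩
        exact ⟨star s, star_mem hs, star c, by
          rw [star_add, star_smul, hq.isSelfAdjoint.star_eq]⟩ }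
  have h1 : S ⊔ projLine q hq ≤ U := by
    apply sup_le
    · intro s hs
      exact ⟨s, hs, 0, by simp⟩
    · rintro _ ⟨c, rfl⟩
      exact ⟨0, zero_mem _, c, by simp⟩
  exact h1 hx

theorem class_sup_projLine {A : Type u} [CStarAlgebra A]
    (𝒞 : NonUnitalStarSubalgebra ℂ A → Prop)
    (h𝒞C : ∀ S : NonUnitalStarSubalgebra ℂ A, (S ≃⋆ₐ[ℂ] ℂ) → 𝒞 S)
    (h𝒞sum : ∀ S T : NonUnitalStarSubalgebra ℂ A, 𝒞 S → 𝒞 T →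
      (∀ s ∈ S, ∀ t ∈ T, s * t = 0 ∧ t * s = 0) → 𝒞 (S ⊔ T))
    (S : NonUnitalStarSubalgebra ℂ A) (hS : 𝒞 S)
    (q : A) (hq : IsStarProjection q) (ho : ∀ s ∈ S, s * q = 0 ∧ q * s = 0) :
    𝒞 (S ⊔ projLine q hq) := by
  by_cases h0 : q = 0
  · have : S ⊔ projLine q hq = S := by
      apply sup_eq_left.2
      rintro _ ⟨c, rfl⟩
      rw [h0, smul_zero]
      exact zero_mem S
    rwa [this]
  · obtain ⟨g⟩ := projLine_equiv q hq h0
    refine h𝒞sum S _ hS (h𝒞C _ g) ?_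
    rintro s hs _ ⟨c, rfl⟩
    rw [mul_smul_comm, smul_mul_assoc, (ho s hs).1, (ho s hs).2]
    simp

/-- The unit of a *-subalgebra is a projection. -/
theorem unit_isStarProjection {A : Type u} [CStarAlgebra A] (S : NonUnitalStarSubalgebra ℂ A)
    (e : A) (he : e ∈ S) (hu : ∀ x ∈ S, e * x = x ∧ x * e = x) : IsStarProjection e := by
  refine ⟨(hu e he).1, ?_⟩
  have h1 : e * star e = star e := (hu _ (star_mem he)).1
  have h2 := congrArg star h1
  rw [star_mul, star_star, h1] at h2
  exact h2

/-- Adding a unit. -/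
theorem exists_unitization {A : Type u} [CStarAlgebra A]
    (𝒞 : NonUnitalStarSubalgebra ℂ A → Prop)
    (h𝒞unital : ∀ S, 𝒞 S → ∃ e ∈ S, ∀ x ∈ S, e * x = x ∧ x * e = x)
    (h𝒞C : ∀ S : NonUnitalStarSubalgebra ℂ A, (S ≃⋆ₐ[ℂ] ℂ) → 𝒞 S)
    (h𝒞sum : ∀ S T : NonUnitalStarSubalgebra ℂ A, 𝒞 S → 𝒞 T →
      (∀ s ∈ S, ∀ t ∈ T, s * t = 0 ∧ t * s = 0) → 𝒞 (S ⊔ T))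
    (S : NonUnitalStarSubalgebra ℂ A) (hS : 𝒞 S) :
    ∃ S' : NonUnitalStarSubalgebra ℂ A, 𝒞 S' ∧ S ≤ S' ∧ (1 : A) ∈ S' := by
  obtain ⟨e, he, hu⟩ := h𝒞unital S hS
  have hp := unit_isStarProjection S e he hu
  refine ⟨S ⊔ projLine (1 - e) hp.one_sub,
    class_sup_projLine 𝒞 h𝒞C h𝒞sum S hS _ _ ?_, le_sup_left, ?_⟩
  · intro s hs
    rw [mul_sub, sub_mul, (hu s hs).1, (hu s hs).2]
    simp
  · have h1 : e ∈ S ⊔ projLine (1 - e) hp.one_sub :=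
      (le_sup_left : S ≤ S ⊔ projLine (1 - e) hp.one_sub) he
    have h2 : (1 - e) ∈ S ⊔ projLine (1 - e) hp.one_sub :=
      (le_sup_right : _ ≤ S ⊔ projLine (1 - e) hp.one_sub) ⟨1, by simp⟩
    have := add_mem h1 h2
    simpa using this

theorem norm_one_le' {A : Type u} [CStarAlgebra A] : ‖(1 : A)‖ ≤ 1 :=
  IsStarProjection.norm_le (1 : A) (IsStarProjection.one A)

/-- A positive contraction close to a unital subalgebra is close to a positive contraction of it. -/
theorem exists_pos_contraction {A : Type u} [CStarAlgebra A] (S : NonUnitalStarSubalgebra ℂ A)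
    (h1 : (1 : A) ∈ S) (h : A) (hpos : ∃ x : A, h = star x * x) (hn : ‖h‖ ≤ 1) (s : A)
    (hs : s ∈ S) (η : ℝ) (hη : 0 < η) (hd : ‖h - s‖ ≤ η) :
    ∃ k ∈ S, (∃ x : A, k = star x * x) ∧ ‖k‖ ≤ 1 ∧ ‖h - k‖ ≤ 4 * η := by
  letI := CStarAlgebra.spectralOrder A
  haveI := CStarAlgebra.spectralOrderedRing A
  have hh : 0 ≤ h := CStarAlgebra.nonneg_iff_eq_star_mul_self.2 hpos
  have hsa : IsSelfAdjoint h := IsSelfAdjoint.of_nonneg hh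
  set a : A := (2⁻¹ : ℂ) • (s + star s) with ha
  have haS : a ∈ S := SMulMemClass.smul_mem _ (add_mem hs (star_mem hs))
  have hasa : IsSelfAdjoint a := by
    rw [ha, IsSelfAdjoint, star_smul, star_add, star_star, add_comm (star s) s]
    congr 1
    simp
  have had : ‖a - h‖ ≤ η := by
    have e : a - h = (2⁻¹ : ℂ) • (-(h - s) - star (h - s)) := by
      rw [ha, star_sub, hsa.star_eq]
      module
    rw [e, norm_smul]
    have := norm_sub_le (-(h - s)) (star (h - s))
    rw [norm_neg, norm_star] at this
    have h2 : ‖(2⁻¹ : ℂ)‖ = 2⁻¹ := by norm_num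
    rw [h2]
    linarith
  have hb : 0 ≤ a + (η : ℂ) • (1 : A) := by
    have h2 := (hasa.sub hsa).neg_algebraMap_norm_le_self
    have h3 : algebraMap ℝ A ‖a - h‖ ≤ algebraMap ℝ A η := algebraMap_mono A had
    have h4 : algebraMap ℝ A η = (η : ℂ) • (1 : A) := by
      rw [Algebra.algebraMap_eq_smul_one, Complex.coe_smul]
    rw [← h4]
    have h5 : 0 ≤ (a - h) + algebraMap ℝ A η := by
      have := add_le_add h2 h3
      simpa using this
    have := add_nonneg h5 hh
    convert this using 1
    abel
  have hpos' : (0 : ℝ) < 1 + 2 * η := by positivity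
  set k : A := (1 + 2 * η)⁻¹ • (a + (η : ℂ) • (1 : A)) with hk
  have hkS : k ∈ S := by
    have : k = (((1 + 2 * η)⁻¹ : ℝ) : ℂ) • (a + (η : ℂ) • (1 : A)) := by
      rw [hk]
      exact (Complex.coe_smul (1 + 2 * η)⁻¹ _).symm
    rw [this]
    exact SMulMemClass.smul_mem _ (add_mem haS (SMulMemClass.smul_mem _ h1))
  have hη1 : ‖(η : ℂ) • (1 : A)‖ ≤ η := by
    rw [norm_smul, Complex.norm_real, Real.norm_of_nonneg hη.le]
    have := norm_one_le' (A := A)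
    nlinarith
  have hkn : ‖k‖ ≤ 1 := by
    rw [hk, norm_smul, Real.norm_of_nonneg (by positivity), inv_mul_le_iff₀ hpos']
    have e : a + (η : ℂ) • (1 : A) = (a - h) + h + (η : ℂ) • (1 : A) := by abel
    rw [e]
    have := norm_add₃_le (a := a - h) (b := h) (c := (η : ℂ) • (1 : A))
    linarith
  refine ⟨k, hkS, ?_, hkn, ?_⟩
  · exact CStarAlgebra.nonneg_iff_eq_star_mul_self.1 (smul_nonneg (by positivity) hb)
  · have e0 : (1 + 2 * η) • k = a + (η : ℂ) • (1 : A) := by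
      rw [hk, smul_inv_smul₀ hpos'.ne']
    have e : h - k = (-(a - h)) + (-((η : ℂ) • (1 : A))) + (2 * η) • k := by
      have : (2 * η) • k = a + (η : ℂ) • (1 : A) - k := by
        rw [← e0]
        module
      rw [this]
      abel
    rw [e]
    have h6 := norm_add₃_le (a := -(a - h)) (b := -((η : ℂ) • (1 : A))) (c := (2 * η) • k)
    have h7 : ‖(2 * η) • k‖ ≤ 2 * η := by
      rw [norm_smul, Real.norm_of_nonneg (by positivity)]
      nlinarith
    rw [norm_neg, norm_neg] at h6
    linarith

/-- Almost idempotents are close to projections. -/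
theorem exists_projection {A : Type u} [CStarAlgebra A] (k : A) (hk : IsSelfAdjoint k) (η : ℝ)
    (hη : η < 1 / 4) (hd : ‖k - k * k‖ ≤ η) :
    ∃ q g : A, IsStarProjection q ∧ q = g * k ∧ ‖k - q‖ ≤ 2 * η := by
  have hη0 : 0 ≤ η := (norm_nonneg _).trans hd
  have hsp : ∀ x ∈ spectrum ℝ k, |x - x * x| ≤ η := by
    intro x hx
    have e : cfc (fun x : ℝ => x - x * x) k = k - k * k := by
      rw [cfc_sub (fun x : ℝ => x) (fun x : ℝ => x * x) k, cfc_mul (fun x : ℝ => x) (fun x => x) k,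
        cfc_id' ℝ k]
    have h2 := (norm_cfc_le_iff (fun x : ℝ => x - x * x) k hη0).1 (by rw [e]; exact hd) x hx
    simpa using h2
  have hne : ∀ x ∈ spectrum ℝ k, x ≠ 1 / 2 := by
    rintro x hx rfl
    have := hsp _ hx
    norm_num [abs_of_pos] at this
    linarith
  let G : ℝ → ℝ := fun x => if x < 1 / 2 then 0 else x⁻¹
  let F : ℝ → ℝ := fun x => G x * x
  have hGc : ContinuousOn G (spectrum ℝ k) := by
    intro x hx
    apply ContinuousAt.continuousWithinAt
    rcases lt_or_gt_of_ne (hne x hx) with hlt | hgt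
    · have : G =ᶠ[nhds x] fun _ => 0 := by
        filter_upwards [Iio_mem_nhds hlt] with y hy
        exact if_pos hy
      exact continuousAt_const.congr this.symm
    · have : G =ᶠ[nhds x] fun y => y⁻¹ := by
        filter_upwards [Ioi_mem_nhds hgt] with y hy
        exact if_neg (not_lt.2 (le_of_lt hy))
      exact (continuousAt_inv₀ (by linarith)).congr this.symm
  have hFc : ContinuousOn F (spectrum ℝ k) := hGc.mul continuousOn_id
  have hF : ∀ x, F x = if x < 1 / 2 then 0 else 1 := by
    intro x
    by_cases h : x < 1 / 2
    · simp only [F, G, if_pos h, zero_mul]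
    · simp only [F, G, if_neg h]
      exact inv_mul_cancel₀ (by linarith)
  refine ⟨cfc F k, cfc G k, ⟨?_, ?_⟩, ?_, ?_⟩
  · rw [IsIdempotentElem, ← cfc_mul F F k]
    congr 1
    funext x
    rw [hF]
    split_ifs <;> simp
  · exact cfc_predicate F k
  · conv_rhs => rw [← cfc_id' ℝ k]
    rw [cfc_id' ℝ k, cfc_mul G (fun x => x) k, cfc_id' ℝ k]
  · have e : k - cfc F k = cfc (fun x => x - F x) k := by
      rw [cfc_sub (fun x : ℝ => x) F k, cfc_id' ℝ k]
    rw [e]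
    apply norm_cfc_le (by positivity)
    intro x hx
    have h1 := hsp x hx
    rw [Real.norm_eq_abs, hF]
    have e2 : x - x * x = x * (1 - x) := by ring
    rw [e2, abs_mul] at h1
    split_ifs with h
    · rw [sub_zero]
      have : 1 / 2 ≤ |1 - x| := by rw [abs_of_pos (by linarith)]; linarith
      nlinarith [abs_nonneg x]
    · have : 1 / 2 ≤ |x| := by rw [abs_of_pos (by linarith)]; linarith
      rw [abs_sub_comm]
      nlinarith [abs_nonneg (1 - x)]

/-- The corner estimates. -/
theorem corner_estimate {A : Type u} [CStarAlgebra A] (E : NonUnitalStarSubalgebra ℂ A)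
    (p : A) (hpE : p ∈ E) (hu : ∀ x ∈ E, p * x = x ∧ x * p = x) (h : A) (hsa : IsSelfAdjoint h)
    (hn : ‖h‖ ≤ 1) (δ : ℝ) (hδ1 : δ ≤ 1 / 20)
    (e₁ : A) (he₁ : e₁ ∈ E) (hd₁ : ‖h * p - e₁‖ < δ)
    (e₂ : A) (he₂ : e₂ ∈ E) (hd₂ : ‖h * (1 - h) - e₂‖ < δ) :
    ∃ q : A, IsStarProjection q ∧ q * p = 0 ∧ p * q = 0 ∧ ‖h - (e₁ + q)‖ ≤ 9 * δ := by
  have hp := unit_isStarProjection E p hpE hu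
  have hpn : ‖p‖ ≤ 1 := IsStarProjection.norm_le p hp
  have hrn : ‖1 - p‖ ≤ 1 := IsStarProjection.norm_le _ hp.one_sub
  have hpp : p * p = p := hp.isIdempotentElem.eq
  have hps : star p = p := hp.isSelfAdjoint.star_eq
  have hmul : ∀ a b : A, ‖a‖ ≤ 1 → ‖a * b‖ ≤ ‖b‖ := fun a b ha =>
    (norm_mul_le a b).trans (by nlinarith [norm_nonneg b])
  have hmul' : ∀ a b : A, ‖b‖ ≤ 1 → ‖a * b‖ ≤ ‖a‖ := fun a b ha =>
    (norm_mul_le a b).trans (by nlinarith [norm_nonneg a])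
  -- the off-diagonal corners
  have hoff : ‖(1 - p) * h * p‖ ≤ δ := by
    have e : (1 - p) * h * p = (1 - p) * (h * p - e₁) := by
      rw [mul_sub (1 - p), sub_mul 1 p e₁, (hu e₁ he₁).1]
      simp [mul_assoc]
    rw [e]
    exact (hmul _ _ hrn).trans hd₁.le
  have hoff' : ‖p * h * (1 - p)‖ ≤ δ := by
    have e : p * h * (1 - p) = star ((1 - p) * h * p) := by
      simp only [star_mul, star_sub, star_one, hps, hsa.star_eq, mul_assoc]
    rw [e, norm_star]
    exact hoff
  set k := (1 - p) * h * (1 - p) with hk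
  have hksa : IsSelfAdjoint k := by
    simp only [hk, IsSelfAdjoint, star_mul, star_sub, star_one, hps, hsa.star_eq, mul_assoc]
  have hkk : ‖k - k * k‖ ≤ 3 * δ := by
    have e : k - k * k = (1 - p) * (h * (1 - h) - e₂) * (1 - p)
        + ((1 - p) * h * p) * (p * h * (1 - p)) := by
      have e0 : (1 - p) * e₂ = 0 := by rw [sub_mul, (hu e₂ he₂).1]; simp
      have e3 : (1 - p) * (h * (1 - h) - e₂) * (1 - p) = (1 - p) * (h * (1 - h)) * (1 - p) := by
        rw [mul_sub (1 - p), e0, sub_zero]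
      have e4 : ((1 - p) * h * p) * (p * h * (1 - p)) = (1 - p) * h * p * h * (1 - p) := by
        simp only [mul_assoc]
        rw [← mul_assoc p p, hpp]
      have e5 : k * k = (1 - p) * h * (1 - p) * h * (1 - p) := by
        have : (1 - p) * (1 - p) = 1 - p := hp.one_sub.isIdempotentElem.eq
        rw [hk]
        simp only [mul_assoc]
        rw [← mul_assoc (1 - p) (1 - p), this]
      rw [e3, e4, e5, hk]
      noncomm_ring
    rw [e]
    have t1 : ‖(1 - p) * (h * (1 - h) - e₂) * (1 - p)‖ ≤ δ :=
      (hmul' _ _ hrn).trans ((hmul _ _ hrn).trans hd₂.le)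
    have t2 : ‖((1 - p) * h * p) * (p * h * (1 - p))‖ ≤ δ := by
      refine (hmul _ _ (hoff.trans (by linarith))).trans hoff'
    have := norm_add_le ((1 - p) * (h * (1 - h) - e₂) * (1 - p))
      (((1 - p) * h * p) * (p * h * (1 - p)))
    linarith [norm_nonneg (h * p - e₁)]
  obtain ⟨q, g, hq, hqg, hkq⟩ := exists_projection k hksa (3 * δ) (by linarith) hkk
  have hqp : q * p = 0 := by
    rw [hqg, hk]
    have e0 : (1 - p) * p = 0 := by rw [sub_mul, hpp]; simp
    simp only [mul_assoc, e0, mul_zero]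
  have hpq : p * q = 0 := by
    have := congrArg star hqp
    rwa [star_mul, hps, hq.isSelfAdjoint.star_eq, star_zero] at this
  refine ⟨q, hq, hqp, hpq, ?_⟩
  have e : h - (e₁ + q) = (h * p - e₁) + p * h * (1 - p) + (k - q) := by
    rw [hk]
    noncomm_ring
  rw [e]
  have := norm_add₃_le (a := h * p - e₁) (b := p * h * (1 - p)) (c := k - q)
  linarith [norm_nonneg (h * p - e₁)]

/-- Elements of the unit ball of `E ⊕ ℂq ⊕ ℂr`. -/
theorem scalar_bound {A : Type u} [CStarAlgebra A] (q : A) (hq : IsStarProjection q) (y : A)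
    (hy : ‖y‖ ≤ 1) (c : ℂ) (hc : y * q = c • q) : ∃ d : ℂ, ‖d‖ ≤ 1 ∧ c • q = d • q := by
  by_cases h0 : q = 0
  · exact ⟨0, by simp, by simp [h0]⟩
  · refine ⟨c, ?_, rfl⟩
    have h1 : ‖c‖ * ‖q‖ ≤ ‖y‖ * ‖q‖ := by
      rw [← norm_smul, ← hc]
      exact norm_mul_le _ _
    exact (le_of_mul_le_mul_right h1 (norm_pos_iff.2 h0)).trans hy

theorem approx_subset {A : Type u} [CStarAlgebra A] (E C C' : NonUnitalStarSubalgebra ℂ A)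
    (hCC : C ≤ C') (h1 : (1 : A) ∈ C') (δ : ℝ) (hδ : 0 < δ) (hδ1 : δ ≤ 1 / 20)
    (hEC : SubsetEps δ (E : Set A) (C : Set A))
    (p : A) (hpE : p ∈ E) (hpn : ‖p‖ ≤ 1) (h : A) (hh : MemEps δ (C' : Set A) h)
    (e₁ q : A) (he₁ : e₁ ∈ E) (hn₁ : ‖e₁‖ ≤ 2) (hd : ‖h - (e₁ + q)‖ ≤ 9 * δ)
    (e y : A) (he : e ∈ E) (hen : ‖e‖ ≤ 1) (c d : ℂ) (hc : ‖c‖ ≤ 1) (hd' : ‖d‖ ≤ 1)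
    (hy : y = e + c • q + d • (1 - p - q)) (hyn : ‖y‖ ≤ 1) :
    ∃ t ∈ C', ‖t‖ ≤ 1 ∧ ‖y - t‖ < 60 * δ := by
  obtain ⟨a, ha, -, hae⟩ := hEC e he hen
  obtain ⟨b, hb, -, hbp⟩ := hEC p hpE hpn
  obtain ⟨f, hf, -, hfe⟩ := hEC ((2⁻¹ : ℂ) • e₁) (SMulMemClass.smul_mem _ he₁) (by
    rw [norm_smul]; norm_num; linarith)
  obtain ⟨u, hu, huh⟩ := hh
  have hfe' : ‖e₁ - (2 : ℂ) • f‖ ≤ 2 * δ := by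
    have e0 : e₁ - (2 : ℂ) • f = (2 : ℂ) • ((2⁻¹ : ℂ) • e₁ - f) := by module
    rw [e0, norm_smul]
    norm_num
    linarith
  set v : A := u - (2 : ℂ) • f with hv
  have hvC : v ∈ C' := sub_mem hu (SMulMemClass.smul_mem _ (hCC hf))
  have hvq : ‖q - v‖ ≤ 12 * δ := by
    have e0 : q - v = -(h - (e₁ + q)) + (h - u) + -(e₁ - (2 : ℂ) • f) := by
      rw [hv]; abel
    rw [e0]
    have := norm_add₃_le (a := -(h - (e₁ + q))) (b := h - u) (c := -(e₁ - (2 : ℂ) • f))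
    rw [norm_neg, norm_neg] at this
    linarith
  set w : A := 1 - b - v with hw
  have hwC : w ∈ C' := sub_mem (sub_mem h1 (hCC hb)) hvC
  have hwr : ‖(1 - p - q) - w‖ ≤ 13 * δ := by
    have e0 : (1 - p - q) - w = -(p - b) + -(q - v) := by rw [hw]; abel
    rw [e0]
    have := norm_add_le (-(p - b)) (-(q - v))
    rw [norm_neg, norm_neg] at this
    linarith
  set z : A := a + c • v + d • w with hz
  have hzC : z ∈ C' := add_mem (add_mem (hCC ha) (SMulMemClass.smul_mem _ hvC))
    (SMulMemClass.smul_mem _ hwC)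
  have hyz : ‖y - z‖ ≤ 26 * δ := by
    have e0 : y - z = (e - a) + c • (q - v) + d • ((1 - p - q) - w) := by
      rw [hy, hz]; module
    rw [e0]
    have := norm_add₃_le (a := e - a) (b := c • (q - v)) (c := d • ((1 - p - q) - w))
    rw [norm_smul, norm_smul] at this
    nlinarith [norm_nonneg (q - v), norm_nonneg ((1 - p - q) - w)]
  have hpos : (0 : ℝ) < 1 + 26 * δ := by positivity
  set t : A := (1 + 26 * δ)⁻¹ • z with ht
  have htz : (1 + 26 * δ) • t = z := by rw [ht, smul_inv_smul₀ hpos.ne']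
  have htn : ‖t‖ ≤ 1 := by
    rw [ht, norm_smul, Real.norm_of_nonneg (by positivity), inv_mul_le_iff₀ hpos]
    have := norm_sub_norm_le z y
    rw [norm_sub_rev] at this
    linarith
  refine ⟨t, ?_, htn, ?_⟩
  · have : t = (((1 + 26 * δ)⁻¹ : ℝ) : ℂ) • z := by rw [ht, Complex.coe_smul]
    rw [this]
    exact SMulMemClass.smul_mem _ hzC
  · have e0 : y - t = (y - z) + (26 * δ) • t := by
      rw [← htz]; module
    rw [e0]
    have h5 := norm_add_le (y - z) ((26 * δ) • t)
    have h6 : ‖(26 * δ) • t‖ ≤ 26 * δ := by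
      rw [norm_smul, Real.norm_of_nonneg (by positivity)]
      nlinarith
    linarith

/-- Let `𝒞` be a class of unital C*-algebras that contains `ℂ`, is closed
under finite direct sums (internally: orthogonal pairs of subalgebras), and is closed under
*-isomorphism, modeled as a predicate on (closed, unital) C*-subalgebras of `A`.  Then a
unital C*-algebra `A` decomposes over `𝒞` if and only if the decomposition subalgebras can
be taken to contain `1_A` and the cutting element `h` can be taken inside `E`. -/
theorem decomposes_iff_unital_version {A : Type u} [CStarAlgebra A]
    (𝒞 : NonUnitalStarSubalgebra ℂ A → Prop)
    (h𝒞closed : ∀ S, 𝒞 S → IsClosed (S : Set A))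
    (h𝒞unital : ∀ S, 𝒞 S → ∃ e ∈ S, ∀ x ∈ S, e * x = x ∧ x * e = x)
    (h𝒞C : ∀ S : NonUnitalStarSubalgebra ℂ A, (S ≃⋆ₐ[ℂ] ℂ) → 𝒞 S)
    (h𝒞sum : ∀ S T : NonUnitalStarSubalgebra ℂ A, 𝒞 S → 𝒞 T →
      (∀ s ∈ S, ∀ t ∈ T, s * t = 0 ∧ t * s = 0) → 𝒞 (S ⊔ T))
    (h𝒞iso : ∀ S T : NonUnitalStarSubalgebra ℂ A, (S ≃⋆ₐ[ℂ] T) → 𝒞 S → 𝒞 T) :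
    Decomposes A 𝒞 ↔
      ∀ (X : Finset A) (ε : ℝ), 0 < ε →
        ∃ C D E : NonUnitalStarSubalgebra ℂ A, 𝒞 C ∧ 𝒞 D ∧ 𝒞 E ∧
          (1 : A) ∈ C ∧ (1 : A) ∈ D ∧ (1 : A) ∈ E ∧
          ∃ h ∈ E, (∃ x : A, h = star x * x) ∧ ‖h‖ ≤ 1 ∧
            (∀ x ∈ X, ‖h * x - x * h‖ < ε) ∧
            (∀ x ∈ X, MemEps ε (C : Set A) (h * x)) ∧
            (∀ x ∈ X, MemEps ε (D : Set A) ((1 - h) * x)) ∧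
            (∀ x ∈ X, MemEps ε (E : Set A) (h * ((1 - h) * x))) ∧
            SubsetEps ε (E : Set A) (C : Set A) ∧
            SubsetEps ε (E : Set A) (D : Set A) := by
  classical
  constructor
  · intro hdec X ε hε
    obtain ⟨M, hM1, hM⟩ : ∃ M : ℝ, 1 ≤ M ∧ ∀ x ∈ X, ‖x‖ ≤ M := by
      refine ⟨1 + ∑ x ∈ X, ‖x‖, ?_, ?_⟩
      · have : 0 ≤ ∑ x ∈ X, ‖x‖ := Finset.sum_nonneg fun _ _ => norm_nonneg _
        linarith
      · intro x hx
        have := Finset.single_le_sum (f := fun x : A => ‖x‖) (fun _ _ => norm_nonneg _) hx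
        linarith
    obtain ⟨δ, hδ, hδ1, hδε⟩ : ∃ δ : ℝ, 0 < δ ∧ δ ≤ 1 / 20 ∧ 100 * M * δ ≤ ε := by
      have hM0 : 0 < 100 * M := by linarith
      refine ⟨min (1 / 20) (ε / (100 * M)), lt_min (by norm_num) (by positivity),
        min_le_left _ _, ?_⟩
      calc 100 * M * min (1 / 20) (ε / (100 * M)) ≤ 100 * M * (ε / (100 * M)) := by
            gcongr
            exact min_le_right _ _
        _ = ε := by field_simp
    have hMδ : δ ≤ M * δ := by nlinarith
    obtain ⟨C, D, E, hC, hD, hE, h, hpos, hn, hcomm, hXC, hXD, hXE, hEC, hED, hhE⟩ :=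
      hdec (insert 1 X) δ hδ
    obtain ⟨p, hpE, hu⟩ := h𝒞unital E hE
    have hp := unit_isStarProjection E p hpE hu
    have hpn : ‖p‖ ≤ 1 := IsStarProjection.norm_le p hp
    have hsa : IsSelfAdjoint h := by
      obtain ⟨x, rfl⟩ := hpos
      exact IsSelfAdjoint.star_mul_self x
    obtain ⟨e₁, he₁, hd₁⟩ := hhE p hpE hpn
    obtain ⟨e₂, he₂, hd₂⟩ := hXE 1 (Finset.mem_insert_self _ _)
    rw [mul_one] at hd₂
    obtain ⟨q, hq, hqp, hpq, hdq⟩ :=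
      corner_estimate E p hpE hu h hsa hn δ hδ1 e₁ he₁ hd₁ e₂ he₂ hd₂
    have hn₁ : ‖e₁‖ ≤ 2 := by
      have t1 := norm_sub_norm_le e₁ (h * p)
      rw [norm_sub_rev] at t1
      have t2 := norm_mul_le h p
      nlinarith [norm_nonneg h, norm_nonneg p]
    obtain ⟨C', hC', hCC, h1C⟩ := exists_unitization 𝒞 h𝒞unital h𝒞C h𝒞sum C hC
    obtain ⟨D', hD', hDD, h1D⟩ := exists_unitization 𝒞 h𝒞unital h𝒞C h𝒞sum D hD
    -- the new `E`
    have hEq : ∀ s ∈ E, s * q = 0 ∧ q * s = 0 := by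
      intro s hs
      constructor
      · rw [← (hu s hs).2, mul_assoc, hpq, mul_zero]
      · rw [← (hu s hs).1, ← mul_assoc, hqp, zero_mul]
    have hqq : q * q = q := hq.isIdempotentElem.eq
    have hpp : p * p = p := hp.isIdempotentElem.eq
    have hr : IsStarProjection (1 - p - q) := by
      refine ⟨?_, ?_⟩
      · rw [IsIdempotentElem]
        simp only [sub_mul, mul_sub, one_mul, mul_one, hqq, hpp, hqp, hpq]
        abel
      · exact hp.one_sub.isSelfAdjoint.sub hq.isSelfAdjoint
    have hrE : ∀ s ∈ E ⊔ projLine q hq, s * (1 - p - q) = 0 ∧ (1 - p - q) * s = 0 := by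
      intro s hs
      obtain ⟨t, ht, c, rfl⟩ := mem_sup_projLine E q hq hEq hs
      constructor
      · simp only [add_mul, mul_sub, mul_one, smul_mul_assoc, hqq, hqp, (hu t ht).2, (hEq t ht).1]
        simp
      · simp only [mul_add, sub_mul, one_mul, mul_smul_comm, hqq, hpq, (hu t ht).1, (hEq t ht).2]
        simp
    set E' := (E ⊔ projLine q hq) ⊔ projLine (1 - p - q) hr with hE'def
    have hE' : 𝒞 E' :=
      class_sup_projLine 𝒞 h𝒞C h𝒞sum _ (class_sup_projLine 𝒞 h𝒞C h𝒞sum E hE q hq hEq) _ hr hrE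
    have hEE : E ≤ E' := le_sup_left.trans le_sup_left
    have hqE : q ∈ E' := by
      have : projLine q hq ≤ E' := le_sup_right.trans le_sup_left
      exact this ⟨1, by simp⟩
    have hrE' : 1 - p - q ∈ E' := by
      have : projLine (1 - p - q) hr ≤ E' := le_sup_right
      exact this ⟨1, by simp⟩
    have h1E : (1 : A) ∈ E' := by
      have := add_mem (add_mem (hEE hpE) hqE) hrE'
      convert this using 1
      abel
    have hform : ∀ y ∈ E', ‖y‖ ≤ 1 → ∃ e ∈ E, ‖e‖ ≤ 1 ∧ ∃ c d : ℂ, ‖c‖ ≤ 1 ∧ ‖d‖ ≤ 1 ∧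
        y = e + c • q + d • (1 - p - q) := by
      intro y hy hyn
      obtain ⟨s, hs, d, hyd⟩ := mem_sup_projLine _ _ hr hrE hy
      obtain ⟨e, he, c, hsc⟩ := mem_sup_projLine E q hq hEq hs
      have hyform : y = e + c • q + d • (1 - p - q) := by rw [hyd, hsc]
      have y1 : y * p = e := by
        rw [hyform]
        simp only [add_mul, sub_mul, one_mul, smul_mul_assoc, hpp, hqp, (hu e he).2]
        simp
      have y2 : y * q = c • q := by
        rw [hyform]
        simp only [add_mul, sub_mul, one_mul, smul_mul_assoc, hqq, hpq, (hEq e he).1]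
        simp
      have y3 : y * (1 - p - q) = d • (1 - p - q) := by
        rw [hyd, add_mul, (hrE s hs).1, smul_mul_assoc, hr.isIdempotentElem.eq, zero_add]
      obtain ⟨c', hc', hcc⟩ := scalar_bound q hq y hyn c y2
      obtain ⟨d', hd', hdd⟩ := scalar_bound _ hr y hyn d y3
      refine ⟨e, he, ?_, c', d', hc', hd', ?_⟩
      · rw [← y1]
        exact (norm_mul_le y p).trans (by nlinarith [norm_nonneg y, norm_nonneg p])
      · rw [← hcc, ← hdd, hyform]
    obtain ⟨k, hkE, hkpos, hkn, hhk⟩ := exists_pos_contraction E' h1E h hpos hn (e₁ + q)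
      (add_mem (hEE he₁) hqE) (9 * δ) (by positivity) hdq
    have hhk' : ‖k - h‖ ≤ 36 * δ := by rw [norm_sub_rev]; linarith
    have hkx : ∀ x ∈ X, ‖(k - h) * x‖ ≤ 36 * (M * δ) := by
      intro x hx
      have := hM x hx
      calc ‖(k - h) * x‖ ≤ ‖k - h‖ * ‖x‖ := norm_mul_le _ _
        _ ≤ (36 * δ) * M := by gcongr
        _ = 36 * (M * δ) := by ring
    have hxk : ∀ x ∈ X, ‖x * (k - h)‖ ≤ 36 * (M * δ) := by
      intro x hx
      have := hM x hx
      calc ‖x * (k - h)‖ ≤ ‖x‖ * ‖k - h‖ := norm_mul_le _ _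
        _ ≤ M * (36 * δ) := by gcongr
        _ = 36 * (M * δ) := by ring
    have hM0 : 0 < M * δ := by positivity
    refine ⟨C', D', E', hC', hD', hE', h1C, h1D, h1E, k, hkE, hkpos, hkn, ?_, ?_, ?_, ?_, ?_, ?_⟩
    · intro x hx
      have e0 : k * x - x * k = (h * x - x * h) + (k - h) * x + -(x * (k - h)) := by
        noncomm_ring
      rw [e0]
      have t := norm_add₃_le (a := h * x - x * h) (b := (k - h) * x) (c := -(x * (k - h)))
      rw [norm_neg] at t
      linarith [hcomm x (Finset.mem_insert_of_mem hx), hkx x hx, hxk x hx]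
    · intro x hx
      obtain ⟨s, hs, hsx⟩ := hXC x (Finset.mem_insert_of_mem hx)
      refine ⟨s, hCC hs, ?_⟩
      have e0 : k * x - s = (h * x - s) + (k - h) * x := by noncomm_ring
      rw [e0]
      linarith [norm_add_le (h * x - s) ((k - h) * x), hkx x hx]
    · intro x hx
      obtain ⟨s, hs, hsx⟩ := hXD x (Finset.mem_insert_of_mem hx)
      refine ⟨s, hDD hs, ?_⟩
      have e0 : (1 - k) * x - s = ((1 - h) * x - s) + -((k - h) * x) := by noncomm_ring
      rw [e0]
      have t := norm_add_le ((1 - h) * x - s) (-((k - h) * x))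
      rw [norm_neg] at t
      linarith [hkx x hx]
    · intro x hx
      obtain ⟨s, hs, hsx⟩ := hXE x (Finset.mem_insert_of_mem hx)
      refine ⟨s, hEE hs, ?_⟩
      have e0 : k * ((1 - k) * x) - s
          = (h * ((1 - h) * x) - s) + (k - h) * (1 - k) * x + -(h * ((k - h) * x)) := by
        noncomm_ring
      have hk1 : ‖1 - k‖ ≤ 1 := by
        letI := CStarAlgebra.spectralOrder A
        haveI := CStarAlgebra.spectralOrderedRing A
        have k0 : 0 ≤ k := CStarAlgebra.nonneg_iff_eq_star_mul_self.2 hkpos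
        have k1 : k ≤ 1 := (CStarAlgebra.norm_le_one_iff_of_nonneg k).1 hkn
        exact (CStarAlgebra.norm_le_one_iff_of_nonneg (1 - k) (sub_nonneg.2 k1)).2
          (sub_le_self 1 k0)
      have t1 : ‖(k - h) * (1 - k) * x‖ ≤ 36 * (M * δ) := by
        have := hM x hx
        calc ‖(k - h) * (1 - k) * x‖ ≤ ‖k - h‖ * ‖1 - k‖ * ‖x‖ := norm_mul₃_le
          _ ≤ (36 * δ) * 1 * M := by gcongr
          _ = 36 * (M * δ) := by ring
      have t2 : ‖h * ((k - h) * x)‖ ≤ 36 * (M * δ) := by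
        calc ‖h * ((k - h) * x)‖ ≤ ‖h‖ * ‖(k - h) * x‖ := norm_mul_le _ _
          _ ≤ 1 * (36 * (M * δ)) := by
            gcongr
            exact hkx x hx
          _ = 36 * (M * δ) := by ring
      rw [e0]
      have t := norm_add₃_le (a := h * ((1 - h) * x) - s) (b := (k - h) * (1 - k) * x)
        (c := -(h * ((k - h) * x)))
      rw [norm_neg] at t
      linarith
    · intro y hy hyn
      obtain ⟨e, he, hen, c, d, hc, hd, hyf⟩ := hform y hy hyn
      have hh : MemEps δ (C' : Set A) h := by
        obtain ⟨s, hs, hsx⟩ := hXC 1 (Finset.mem_insert_self _ _)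
        rw [mul_one] at hsx
        exact ⟨s, hCC hs, hsx⟩
      obtain ⟨t, ht, htn, hyt⟩ := approx_subset E C C' hCC h1C δ hδ hδ1 hEC p hpE hpn h hh e₁ q he₁
        hn₁ hdq e y he hen c d hc hd hyf hyn
      exact ⟨t, ht, htn, by linarith⟩
    · intro y hy hyn
      obtain ⟨e, he, hen, c, d, hc, hd, hyf⟩ := hform y hy hyn
      have hh : MemEps δ (D' : Set A) h := by
        obtain ⟨s, hs, hsx⟩ := hXD 1 (Finset.mem_insert_self _ _)
        rw [mul_one] at hsx
        refine ⟨1 - s, sub_mem h1D (hDD hs), ?_⟩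
        have e0 : h - (1 - s) = -(1 - h - s) := by abel
        rw [e0, norm_neg]
        exact hsx
      obtain ⟨t, ht, htn, hyt⟩ := approx_subset E D D' hDD h1D δ hδ hδ1 hED p hpE hpn h hh e₁ q he₁
        hn₁ hdq e y he hen c d hc hd hyf hyn
      exact ⟨t, ht, htn, by linarith⟩
  · intro hun X ε hε
    obtain ⟨C, D, E, hC, hD, hE, -, -, -, h, hhE, hpos, hn, h1, h2, h3, h4, h5, h6⟩ := hun X ε hε
    refine ⟨C, D, E, hC, hD, hE, h, hpos, hn, h1, h2, h3, h4, h5, h6, ?_⟩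
    intro e he _
    exact ⟨h * e, mul_mem hhE he, by simpa using hε⟩
end

section
/- A unital C*-algebra A has complexity rank at most one if and only if it has the following property: for any finite subset X of the closed unit ball of A and any ε > 0 there exist finite-dimensional C*-subalgebras C, D, E of A that contain the unit 1_A, and a positive contraction h ∈ E, such that (i) ‖[h, x]‖ < ε for all x ∈ X; (ii) hx ∈_ε C, (1_A − h)x ∈_ε D, and (1_A − h)hx ∈_ε E for all x ∈ X; and (iii) E is contained in both C and D. -/
universe u

/-- A C*-subalgebra of `A` which is a unital, locally finite-dimensional C*-algebra in its
own right: it is closed, has a unit, and every finite subset is approximated by a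
finite-dimensional C*-subalgebra of it.  This is the class `D₀` of the complexity
hierarchy, as a predicate on C*-subalgebras of `A`. -/
def IsUnitalLocFinDimSub {A : Type u} [CStarAlgebra A]
    (S : NonUnitalStarSubalgebra ℂ A) : Prop :=
  IsClosed (S : Set A) ∧
  (∃ e ∈ S, ∀ x ∈ S, e * x = x ∧ x * e = x) ∧
  (∀ (Y : Finset A), (↑Y : Set A) ⊆ (S : Set A) → ∀ δ : ℝ, 0 < δ →
    ∃ G : NonUnitalStarSubalgebra ℂ A, G ≤ S ∧ FiniteDimensional ℂ G ∧
      ∀ y ∈ Y, MemEps δ (G : Set A) y)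

/-- A unital C*-algebra has complexity rank at most one iff it decomposes over the class
`D₀` of unital locally finite-dimensional C*-algebras. -/
def ComplexityRankLeOne (A : Type u) [CStarAlgebra A] : Prop :=
  Decomposes A (IsUnitalLocFinDimSub (A := A))

section PolarClamp
variable {A : Type u} [CStarAlgebra A]

/-- spectrum of an element close to `1`. -/
lemma aux_spectrum_near_one {b : A} {t : ℝ} (hb : ‖b - 1‖ ≤ t) {x : ℝ}
    (hx : x ∈ spectrum ℝ b) : |x - 1| ≤ t := by
  rcases subsingleton_or_nontrivial A with hA | hA
  · simp [spectrum.of_subsingleton] at hx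
  have h1 : x - 1 ∈ spectrum ℝ (b - 1) := by
    have := spectrum.sub_singleton_eq (R := ℝ) b (1:ℝ)
    rw [map_one] at this
    rw [← this]
    exact Set.sub_mem_sub hx rfl
  have := spectrum.norm_le_norm_of_mem h1
  rw [Real.norm_eq_abs] at this
  exact this.trans hb

lemma aux_scalar {x t : ℝ} (ht : t ≤ 1/2) (hx : |x - 1| ≤ t) : |1 - 1 / √x| ≤ t := by
  have h1 := abs_le.1 hx
  have hx0 : (1:ℝ)/2 ≤ x := by linarith
  have hs : (1:ℝ)/2 ≤ √x := by
    apply Real.le_sqrt_of_sq_le; nlinarith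
  have hsq : √x * √x = x := Real.mul_self_sqrt (by linarith)
  have hpos : 0 < √x := by linarith
  have key : 1 - 1/√x = (x - 1) / (√x + x) := by
    rw [div_eq_mul_inv, eq_div_iff (by linarith)]
    field_simp
    nlinarith
  rw [key, abs_div, abs_of_pos (show 0 < √x + x by linarith)]
  refine (div_le_self (abs_nonneg _) (by linarith)).trans hx

/-- Polar decomposition for elements close to unitaries. -/
lemma aux_polar (S : StarSubalgebra ℂ A) (hS : IsClosed (S : Set A)) {a w : A} (ha : a ∈ S)
    (hw : w ∈ unitary A) (haw : ‖a - w‖ < 1) {t : ℝ} (ht : t ≤ 1/2)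
    (hat : ‖star a * a - 1‖ ≤ t) :
    ∃ r : A, (a * r) ∈ unitary A ∧ a * r ∈ S ∧ ‖a - a * r‖ ≤ 2 * t ∧
      ∀ y, Commute y (star a * a) → Commute y r := by
  have ht0 : 0 ≤ t := (norm_nonneg _).trans hat
  set b := star a * a with hbdef
  have hbsa : IsSelfAdjoint b := IsSelfAdjoint.star_mul_self a
  have hspec : ∀ x ∈ spectrum ℝ b, |x - 1| ≤ t := fun x hx => aux_spectrum_near_one hat hx
  have hcont : ContinuousOn (fun x : ℝ => 1 / √x) (spectrum ℝ b) := by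
    apply ContinuousOn.div continuousOn_const Real.continuous_sqrt.continuousOn
    intro x hx
    have := abs_le.1 (hspec x hx)
    exact (Real.sqrt_pos.2 (by linarith)).ne'
  set r := cfc (fun x : ℝ => 1 / √x) b with hr
  have hrsa : IsSelfAdjoint r := cfc_predicate _ _
  have hcomm : ∀ y, Commute y b → Commute y r := fun y hy => (hy.symm.cfc_real _).symm
  have hrbr : r * b * r = 1 := by
    have hb' : b = cfc (fun x : ℝ => x) b := (cfc_id' ℝ b).symm
    conv_lhs => rw [hr]
    nth_rewrite 2 [hb']
    rw [← cfc_mul _ _ b hcont (continuousOn_id' _),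
      ← cfc_mul (fun x : ℝ => 1 / √x * x) _ b (hcont.mul (continuousOn_id' _)) hcont]
    conv_rhs => rw [← cfc_one ℝ b]
    apply cfc_congr
    intro x hx
    have := abs_le.1 (hspec x hx)
    have h0 : 0 < x := by linarith
    have hsq : √x * √x = x := Real.mul_self_sqrt h0.le
    have hsp := Real.sqrt_pos.2 h0
    simp only [Pi.one_apply]
    field_simp
    rw [sq, hsq]
  have hunit : IsUnit a := by
    have h1 : ‖1 - star w * a‖ < 1 := by
      have : (1 - star w * a) = star w * (w - a) := by
        rw [mul_sub, Unitary.star_mul_self_of_mem hw]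
      rw [this]
      rw [CStarRing.norm_mem_unitary_mul _ (Unitary.star_mem hw), norm_sub_rev]; exact haw
    have h2 := isUnit_one_sub_of_norm_lt_one h1
    rw [sub_sub_cancel] at h2
    have h3 : a = w * (star w * a) := by
      rw [← mul_assoc, Unitary.mul_star_self_of_mem hw, one_mul]
    rw [h3]
    refine IsUnit.mul ?_ h2
    exact ⟨⟨w, star w, Unitary.mul_star_self_of_mem hw, Unitary.star_mul_self_of_mem hw⟩, rfl⟩
  have hsu : star (a * r) * (a * r) = 1 := by
    rw [star_mul, hrsa.star_eq, ← hrbr, hbdef]; simp only [mul_assoc]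
  have hbu : IsUnit b := by rw [hbdef]; exact hunit.star.mul hunit
  have hru : IsUnit r := by
    have hcr : Commute b r := hcomm b (Commute.refl b)
    have h1 : r * (b * r) = 1 := by rw [← mul_assoc]; exact hrbr
    have h2 : (b * r) * r = 1 := by rw [hcr.eq, hrbr]
    exact ⟨⟨r, b * r, h1, h2⟩, rfl⟩
  refine ⟨r, ?_, ?_, ?_, hcomm⟩
  · rw [Unitary.mem_iff]
    refine ⟨hsu, ?_⟩
    obtain ⟨v, hv⟩ := hunit.mul hru
    have h1 : (a * r) * (↑v⁻¹ : A) = 1 := by rw [← hv]; exact v.mul_inv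
    rw [left_inv_eq_right_inv hsu h1]; exact h1
  · refine mul_mem ha ?_
    refine cfc_mem (𝕜' := ℂ) (hs := hS) _ ?_
    exact mul_mem (star_mem ha) ha
  · have h1 : ‖1 - r‖ ≤ t := by
      have : 1 - r = cfc (fun x : ℝ => 1 - 1 / √x) b := by
        rw [cfc_sub _ _ b continuousOn_const hcont, cfc_const_one ℝ b]
      rw [this]
      refine norm_cfc_le ht0 fun x hx => ?_
      exact aux_scalar ht (hspec x hx)
    have h2 : ‖a‖ ≤ 2 := by
      rcases subsingleton_or_nontrivial A with hA | hA
      · rw [Subsingleton.elim a 0]; simp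
      have h3 : ‖b‖ ≤ 1 + t := by
        calc ‖b‖ = ‖(b - 1) + 1‖ := by rw [sub_add_cancel]
          _ ≤ ‖b - 1‖ + ‖(1:A)‖ := norm_add_le _ _
          _ ≤ 1 + t := by rw [norm_one]; linarith
      rw [hbdef, CStarRing.norm_star_mul_self] at h3
      nlinarith [norm_nonneg a]
    calc ‖a - a * r‖ = ‖a * (1 - r)‖ := by rw [mul_sub, mul_one]
      _ ≤ ‖a‖ * ‖1 - r‖ := norm_mul_le _ _
      _ ≤ 2 * t := by gcongr

/-- Clamping a selfadjoint near a positive contraction. -/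
lemma aux_clamp (S : StarSubalgebra ℂ A) (hS : IsClosed (S : Set A)) {y h : A} (hy : y ∈ S)
    (hysa : IsSelfAdjoint y) (hpos : ∃ x : A, h = star x * x) (hh : ‖h‖ ≤ 1) {t : ℝ}
    (ht : ‖y - h‖ ≤ t) :
    ∃ h' ∈ S, (∃ x : A, h' = star x * x) ∧ ‖h'‖ ≤ 1 ∧ ‖h' - h‖ ≤ 2 * t := by
  have ht0 : 0 ≤ t := (norm_nonneg _).trans ht
  let _ := CStarAlgebra.spectralOrder A
  have := CStarAlgebra.spectralOrderedRing A
  have hh0 : 0 ≤ h := by obtain ⟨x, rfl⟩ := hpos; exact star_mul_self_nonneg x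
  have hhsa : IsSelfAdjoint h := IsSelfAdjoint.of_nonneg hh0
  have hh1 : h ≤ algebraMap ℝ A 1 := by
    refine hhsa.le_algebraMap_norm_self.trans ?_
    exact algebraMap_mono A hh
  have hd1 : y - h ≤ algebraMap ℝ A t :=
    ((hysa.sub hhsa).le_algebraMap_norm_self).trans (algebraMap_mono A ht)
  have hd2 : -algebraMap ℝ A t ≤ y - h :=
    (neg_le_neg (algebraMap_mono A ht)).trans (hysa.sub hhsa).neg_algebraMap_norm_le_self
  have hup : y ≤ algebraMap ℝ A (1 + t) := by
    rw [map_add]; have := add_le_add hh1 hd1; rwa [add_sub_cancel] at this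
  have hlo : algebraMap ℝ A (-t) ≤ y := by
    rw [map_neg]; have := add_le_add hh0 hd2; rwa [add_sub_cancel, zero_add] at this
  have hspec : ∀ x ∈ spectrum ℝ y, -t ≤ x ∧ x ≤ 1 + t := fun x hx =>
    ⟨(algebraMap_le_iff_le_spectrum (a := y)).1 hlo x hx,
     (le_algebraMap_iff_spectrum_le (a := y)).1 hup x hx⟩
  have hc : Continuous (fun x : ℝ => max 0 (min x 1)) := by fun_prop
  have hc2 : Continuous (fun x : ℝ => √(max 0 (min x 1))) := by fun_prop
  refine ⟨cfc (fun x : ℝ => max 0 (min x 1)) y, cfc_mem (𝕜' := ℂ) (hs := hS) _ hy,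
    ⟨cfc (fun x : ℝ => √(max 0 (min x 1))) y, ?_⟩, ?_, ?_⟩
  · have : IsSelfAdjoint (cfc (fun x : ℝ => √(max 0 (min x 1))) y) := cfc_predicate _ _
    rw [this.star_eq, ← cfc_mul _ _ y hc2.continuousOn hc2.continuousOn]
    apply cfc_congr
    intro x hx
    exact (Real.mul_self_sqrt (le_max_left _ _)).symm
  · refine norm_cfc_le zero_le_one fun x hx => ?_
    rw [Real.norm_eq_abs, abs_of_nonneg (le_max_left _ _)]
    exact max_le zero_le_one (min_le_right _ _)
  · have h1 : ‖cfc (fun x : ℝ => max 0 (min x 1)) y - y‖ ≤ t := by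
      have : cfc (fun x : ℝ => max 0 (min x 1)) y - y
          = cfc (fun x : ℝ => max 0 (min x 1) - x) y := by
        rw [cfc_sub _ _ y hc.continuousOn (continuousOn_id' _), cfc_id' ℝ y]
      rw [this]
      refine norm_cfc_le ht0 fun x hx => ?_
      have := hspec x hx
      rw [Real.norm_eq_abs, abs_le]
      rcases le_total x 1 with h | h <;> rcases le_total 0 x with h' | h' <;>
        simp [h, h'] <;> (try constructor) <;> linarith
    calc _ = ‖(cfc (fun x : ℝ => max 0 (min x 1)) y - y) + (y - h)‖ := by abel_nf
      _ ≤ _ := norm_add_le _ _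
      _ ≤ 2 * t := by linarith

/-- A self-adjoint approximate projection is near a projection. -/
lemma aux_proj {b f : A} (hb : IsSelfAdjoint b) (hfs : IsSelfAdjoint f) (hbf : b * f = b)
    {t : ℝ} (ht : t < 1 / 4)
    (hbt : ‖b - b * b‖ ≤ t) :
    ∃ q : A, IsSelfAdjoint q ∧ q * q = q ∧ q * f = q ∧ f * q = q ∧ ‖q - b‖ ≤ 2 * t := by
  have ht0 : 0 ≤ t := (norm_nonneg _).trans hbt
  have hbb : b - b * b = cfc (fun x : ℝ => x - x * x) b := by
    rw [cfc_sub _ _ b, cfc_mul _ _ b, cfc_id' ℝ b]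
  have hspec : ∀ x ∈ spectrum ℝ b, |x - x * x| ≤ t := by
    intro x hx
    have := norm_apply_le_norm_cfc (fun x : ℝ => x - x * x) b hx
    rw [← hbb, Real.norm_eq_abs] at this
    exact this.trans hbt
  set g : ℝ → ℝ := fun x => if 1 / 2 < x then 1 / x else 0 with hg
  have hgc : ContinuousOn g (spectrum ℝ b) := by
    intro x hx
    apply ContinuousAt.continuousWithinAt
    have h1 := abs_le.1 (hspec x hx)
    rcases lt_trichotomy x (1 / 2) with h | h | h
    · have : g =ᶠ[nhds x] fun _ => 0 := by
        filter_upwards [Iio_mem_nhds h] with y hy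
        simp only [hg]
        rw [if_neg (not_lt.2 (le_of_lt hy))]
      exact (continuousAt_const).congr this.symm
    · subst h; norm_num at h1; linarith
    · have : g =ᶠ[nhds x] fun y => 1 / y := by
        filter_upwards [Ioi_mem_nhds h] with y hy
        simp only [hg]
        rw [if_pos (Set.mem_Ioi.1 hy)]
      refine ContinuousAt.congr ?_ this.symm
      exact continuousAt_const.div continuousAt_id (by linarith)
  have hqq : cfc (fun x => g x * x) b = cfc g b * b := by
    rw [cfc_mul g (fun x => x) b hgc (continuousOn_id' _), cfc_id' ℝ b]
  have hgc' : ContinuousOn (fun x => g x * x) (spectrum ℝ b) := hgc.mul (continuousOn_id' _)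
  have hsa : IsSelfAdjoint (cfc (fun x => g x * x) b) := cfc_predicate _ _
  have hqf : cfc (fun x => g x * x) b * f = cfc (fun x => g x * x) b := by
    rw [hqq, mul_assoc, hbf]
  refine ⟨cfc (fun x => g x * x) b, hsa, ?_, hqf, ?_, ?_⟩
  · rw [← cfc_mul _ _ b hgc' hgc']
    apply cfc_congr
    intro x hx
    simp only [hg]
    split_ifs with h
    · have : x ≠ 0 := by linarith
      field_simp
    · simp
  · have := congrArg star hqf
    rwa [star_mul, hsa.star_eq, hfs.star_eq] at this
  · have : cfc (fun x => g x * x) b - b = cfc (fun x => g x * x - x) b := by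
      rw [cfc_sub _ _ b hgc' (continuousOn_id' _), cfc_id' ℝ b]
    rw [this]
    refine norm_cfc_le (by linarith) fun x hx => ?_
    have h1 := abs_le.1 (hspec x hx)
    have h2 := hspec x hx
    rw [Real.norm_eq_abs]
    simp only [hg]
    split_ifs with h
    · have : x ≠ 0 := by linarith
      rw [one_div_mul_cancel this, abs_le]
      constructor <;> nlinarith
    · rw [abs_le]
      push Not at h
      constructor <;> nlinarith

end PolarClamp

section Newton
variable {A : Type u} [CStarAlgebra A] {G : Type} [Fintype G]

/-- average over a finite type -/
noncomputable def auxAvg (f : G → A) : A := (Fintype.card G : ℂ)⁻¹ • ∑ g, f g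

lemma auxAvg_norm [Nonempty G] (f : G → A) {δ : ℝ} (h : ∀ g, ‖f g‖ ≤ δ) : ‖auxAvg f‖ ≤ δ := by
  have hn : (0:ℝ) < Fintype.card G := by exact_mod_cast Fintype.card_pos
  unfold auxAvg
  rw [norm_smul, norm_inv, Complex.norm_natCast, inv_mul_le_iff₀ hn]
  refine (norm_sum_le _ _).trans ((Finset.sum_le_sum fun g _ => h g).trans ?_)
  simp

lemma auxAvg_const [Nonempty G] (a : A) : auxAvg (fun _ : G => a) = a := by
  have hn : (Fintype.card G : ℂ) ≠ 0 := by exact_mod_cast Fintype.card_ne_zero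
  unfold auxAvg
  rw [Finset.sum_const, Finset.card_univ, ← Nat.cast_smul_eq_nsmul ℂ, smul_smul,
    inv_mul_cancel₀ hn, one_smul]

lemma auxAvg_sub (f f' : G → A) : auxAvg (fun g => f g - f' g) = auxAvg f - auxAvg f' := by
  unfold auxAvg; rw [Finset.sum_sub_distrib, smul_sub]

lemma auxAvg_mul_right (f : G → A) (a : A) : auxAvg (fun g => f g * a) = auxAvg f * a := by
  unfold auxAvg; rw [smul_mul_assoc, Finset.sum_mul]

lemma auxAvg_mul_left (f : G → A) (a : A) : auxAvg (fun g => a * f g) = a * auxAvg f := by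
  unfold auxAvg; rw [mul_smul_comm, Finset.mul_sum]

lemma auxAvg_star (f : G → A) : auxAvg (fun g => star (f g)) = star (auxAvg f) := by
  unfold auxAvg; rw [star_smul, star_sum]; simp

lemma auxAvg_equiv (f : G → A) (e : G ≃ G) : auxAvg (fun g => f (e g)) = auxAvg f := by
  unfold auxAvg; rw [e.sum_comp]

lemma auxAvg_mem (S : StarSubalgebra ℂ A) (f : G → A) (h : ∀ g, f g ∈ S) : auxAvg f ∈ S := by
  unfold auxAvg; exact S.smul_mem (sum_mem fun g _ => h g) _

lemma auxAvg_mul [Nonempty G] (X Y : G → A) (a b : A) {δ : ℝ} (hX : ∀ g, ‖X g - a‖ ≤ δ)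
    (hY : ∀ g, ‖Y g - b‖ ≤ δ) :
    ‖auxAvg (fun g => X g * Y g) - auxAvg X * auxAvg Y‖ ≤ 2 * δ ^ 2 := by
  obtain ⟨g₀⟩ := ‹Nonempty G›
  have hδ : 0 ≤ δ := (norm_nonneg _).trans (hX g₀)
  have h1 : auxAvg (fun g => X g * Y g) - auxAvg X * auxAvg Y
      = auxAvg (fun g => (X g - a) * (Y g - b)) - (auxAvg X - a) * (auxAvg Y - b) := by
    have : (fun g => (X g - a) * (Y g - b))
        = fun g => (X g * Y g - X g * b) - (a * Y g - a * b) := by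
      funext g; noncomm_ring
    rw [this, auxAvg_sub, auxAvg_sub, auxAvg_sub, auxAvg_mul_right, auxAvg_mul_left,
      auxAvg_const]
    noncomm_ring
  have h2 : ‖auxAvg (fun g => (X g - a) * (Y g - b))‖ ≤ δ * δ :=
    auxAvg_norm _ fun g => (norm_mul_le _ _).trans (mul_le_mul (hX g) (hY g) (norm_nonneg _) hδ)
  have h3 : ‖auxAvg X - a‖ ≤ δ := by
    rw [← auxAvg_const (G := G) a, ← auxAvg_sub]; exact auxAvg_norm _ hX
  have h4 : ‖auxAvg Y - b‖ ≤ δ := by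
    rw [← auxAvg_const (G := G) b, ← auxAvg_sub]; exact auxAvg_norm _ hY
  rw [h1]
  refine (norm_sub_le _ _).trans ?_
  have h5 := (norm_mul_le (auxAvg X - a) (auxAvg Y - b)).trans
    (mul_le_mul h3 h4 (norm_nonneg _) hδ)
  nlinarith

lemma aux_norm_unitary_le {w : A} (hw : w ∈ unitary A) : ‖w‖ ≤ 1 := by
  have h := CStarRing.norm_star_mul_self (x := w)
  rw [Unitary.star_mul_self_of_mem hw] at h
  rcases subsingleton_or_nontrivial A with hA | hA
  · rw [Subsingleton.elim w 0]; simp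
  · rw [norm_one] at h; nlinarith [norm_nonneg w]

/-- Approximating a unitary. -/
lemma aux_star_mul_near {a w : A} (hw : w ∈ unitary A) {s : ℝ} (hs : s ≤ 1)
    (h : ‖a - w‖ ≤ s) : ‖star a * a - 1‖ ≤ 3 * s := by
  have hs0 : 0 ≤ s := (norm_nonneg _).trans h
  have hw1 := aux_norm_unitary_le hw
  have ha : ‖a‖ ≤ 2 := by
    calc ‖a‖ = ‖(a - w) + w‖ := by rw [sub_add_cancel]
      _ ≤ ‖a - w‖ + ‖w‖ := norm_add_le _ _
      _ ≤ 2 := by linarith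
  have h1 : star a * a - 1 = star (a - w) * a + star w * (a - w) := by
    rw [star_sub, mul_sub, sub_mul, Unitary.star_mul_self_of_mem hw]; abel
  rw [h1]
  calc _ ≤ ‖star (a - w)‖ * ‖a‖ + ‖star w‖ * ‖a - w‖ :=
        (norm_add_le _ _).trans (add_le_add (norm_mul_le _ _) (norm_mul_le _ _))
    _ ≤ s * 2 + 1 * s := by
        rw [norm_star, norm_star]; gcongr
    _ = 3 * s := by ring

variable [Group G]

lemma auxAvg_mulLeft (f : G → A) (k : G) : auxAvg (fun g => f (k * g)) = auxAvg f :=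
  auxAvg_equiv f (Equiv.mulLeft k)

/-- One Newton step. -/
lemma aux_newton_step (S : StarSubalgebra ℂ A) (hS : IsClosed (S : Set A)) (c : G → A)
    (hcS : ∀ g, c g ∈ S) (hcu : ∀ g, c g ∈ unitary A) {δ : ℝ} (hδ : δ < 1 / 4)
    (hd : ∀ g h, ‖c g * c h - c (g * h)‖ ≤ δ) :
    ∃ c' : G → A, (∀ g, c' g ∈ S) ∧ (∀ g, c' g ∈ unitary A) ∧
      (∀ g h, ‖c' g * c' h - c' (g * h)‖ ≤ 14 * δ ^ 2) ∧
      (∀ g, ‖c' g - c g‖ ≤ δ + 4 * δ ^ 2) := by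
  have hδ0 : 0 ≤ δ := (norm_nonneg _).trans (hd 1 1)
  set X : G → G → A := fun g h => c (g * h) * star (c h) with hX
  set m : G → A := fun g => auxAvg (X g) with hm
  have hXu : ∀ g h, X g h ∈ unitary A := fun g h => mul_mem (hcu _) (Unitary.star_mem (hcu _))
  have hXc : ∀ g h, ‖X g h - c g‖ ≤ δ := by
    intro g h
    have : X g h - c g = (c (g * h) - c g * c h) * star (c h) := by
      rw [sub_mul, mul_assoc, Unitary.mul_star_self_of_mem (hcu h), mul_one]
    rw [this, CStarRing.norm_mul_mem_unitary _ (Unitary.star_mem (hcu h)), norm_sub_rev]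
    exact hd g h
  have hmc : ∀ g, ‖m g - c g‖ ≤ δ := by
    intro g
    rw [hm, ← auxAvg_const (G := G) (c g)]
    simp only
    rw [← auxAvg_sub]
    exact auxAvg_norm _ (hXc g)
  have hm1 : ∀ g, ‖m g‖ ≤ 1 := fun g => auxAvg_norm _ fun h => aux_norm_unitary_le (hXu g h)
  have hmS : ∀ g, m g ∈ S := fun g => auxAvg_mem S _ fun h => mul_mem (hcS _) (star_mem (hcS _))
  have hmm : ∀ g, ‖star (m g) * m g - 1‖ ≤ 2 * δ ^ 2 := by
    intro g
    have h1 := auxAvg_mul (fun h => star (X g h)) (X g) (star (c g)) (c g) (δ := δ)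
      (fun h => by rw [← star_sub, norm_star]; exact hXc g h) (hXc g)
    have h2 : (fun h => star (X g h) * X g h) = fun _ => 1 := by
      funext h; exact Unitary.star_mul_self_of_mem (hXu g h)
    rw [h2, auxAvg_const, auxAvg_star, norm_sub_rev] at h1
    exact h1
  have hmul : ∀ g k, ‖m (g * k) - m g * m k‖ ≤ 2 * δ ^ 2 := by
    intro g k
    have h1 := auxAvg_mul (fun h => X g (k * h)) (X k) (c g) (c k) (δ := δ)
      (fun h => hXc g _) (hXc k)
    have h2 : (fun h => X g (k * h) * X k h) = X (g * k) := by
      funext h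
      simp only [hX]
      rw [mul_assoc, ← mul_assoc (star (c (k * h))), Unitary.star_mul_self_of_mem (hcu _),
        one_mul, mul_assoc]
    rw [h2, auxAvg_mulLeft (X g) k] at h1
    exact h1
  have hpol : ∀ g, ∃ u, u ∈ unitary A ∧ u ∈ S ∧ ‖m g - u‖ ≤ 4 * δ ^ 2 := by
    intro g
    obtain ⟨r, h1, h2, h3, -⟩ := aux_polar S hS (hmS g) (hcu g) ((hmc g).trans_lt (by linarith))
      (t := 2 * δ ^ 2) (by nlinarith) (hmm g)
    exact ⟨_, h1, h2, h3.trans (by linarith)⟩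
  choose c' hc'u hc'S hc'm using hpol
  refine ⟨c', hc'S, hc'u, ?_, ?_⟩
  · intro g k
    have h1 : c' g * c' k - c' (g * k) = -((m g - c' g) * c' k) - m g * (m k - c' k)
        - (m (g * k) - m g * m k) + (m (g * k) - c' (g * k)) := by noncomm_ring
    have n1 : ‖(m g - c' g) * c' k‖ ≤ 4 * δ ^ 2 * 1 :=
      (norm_mul_le _ _).trans (mul_le_mul (hc'm g) (aux_norm_unitary_le (hc'u k))
        (norm_nonneg _) (by positivity))
    have n2 : ‖m g * (m k - c' k)‖ ≤ 1 * (4 * δ ^ 2) :=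
      (norm_mul_le _ _).trans (mul_le_mul (hm1 g) (hc'm k) (norm_nonneg _) (by positivity))
    rw [h1]
    refine (norm_add_le _ _).trans ?_
    have n3 := norm_sub_le (-((m g - c' g) * c' k) - m g * (m k - c' k)) (m (g * k) - m g * m k)
    have n4 := norm_sub_le (-((m g - c' g) * c' k)) (m g * (m k - c' k))
    rw [norm_neg] at n4
    have := hmul g k
    have := hc'm (g * k)
    linarith
  · intro g
    have h1 : c' g - c g = (m g - c g) - (m g - c' g) := by abel
    rw [h1]
    refine (norm_sub_le _ _).trans ?_
    linarith [hmc g, hc'm g]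

/-- Exact representation near an approximate one. -/
lemma aux_exact_rep (S : StarSubalgebra ℂ A) [FiniteDimensional ℂ S] (hS : IsClosed (S : Set A))
    (φ : G →* A) (hφ : ∀ g, φ g ∈ unitary A) {γ : ℝ} (hγ : γ < 1 / 1000)
    (h : ∀ g, ∃ s ∈ S, ‖φ g - s‖ ≤ γ) :
    ∃ c : G →  A, (∀ g, c g ∈ S) ∧ (∀ g, c g ∈ unitary A) ∧ (∀ g h, c g * c h = c (g * h)) ∧
      ∀ g, ‖c g - φ g‖ ≤ 217 * γ := by
  have hγ0 : 0 ≤ γ := by obtain ⟨s, -, hs⟩ := h 1; exact (norm_nonneg _).trans hs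
  -- initial map
  have h0 : ∀ g, ∃ u, u ∈ unitary A ∧ u ∈ S ∧ ‖u - φ g‖ ≤ 7 * γ := by
    intro g
    obtain ⟨s, hs, hsg⟩ := h g
    rw [norm_sub_rev] at hsg
    obtain ⟨r, h1, h2, h3, -⟩ := aux_polar S hS hs (hφ g) (hsg.trans_lt (by linarith))
      (t := 3 * γ) (by linarith) (aux_star_mul_near (hφ g) (by linarith) hsg)
    refine ⟨_, h1, h2, ?_⟩
    have : s * r - φ g = (s - φ g) - (s - s * r) := by abel
    rw [this]
    refine (norm_sub_le _ _).trans ?_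
    linarith
  choose c0 hc0u hc0S hc0 using h0
  have hc0d : ∀ g h, ‖c0 g * c0 h - c0 (g * h)‖ ≤ 21 * γ := by
    intro g k
    have h1 : c0 g * c0 k - c0 (g * k) = (c0 g - φ g) * c0 k + φ g * (c0 k - φ k)
        - (c0 (g * k) - φ (g * k)) := by
      rw [map_mul]; noncomm_ring
    have n1 : ‖(c0 g - φ g) * c0 k‖ ≤ 7 * γ * 1 :=
      (norm_mul_le _ _).trans (mul_le_mul (hc0 g) (aux_norm_unitary_le (hc0u k))
        (norm_nonneg _) (by positivity))
    have n2 : ‖φ g * (c0 k - φ k)‖ ≤ 1 * (7 * γ) :=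
      (norm_mul_le _ _).trans (mul_le_mul (aux_norm_unitary_le (hφ g)) (hc0 k)
        (norm_nonneg _) (by positivity))
    rw [h1]
    refine (norm_sub_le _ _).trans ?_
    have := norm_add_le ((c0 g - φ g) * c0 k) (φ g * (c0 k - φ k))
    have := hc0 (g * k)
    linarith
  -- the compact set
  let dfc : (G → A) → (G × G → A) := fun c p => c p.1 * c p.2 - c (p.1 * p.2)
  let F : (G → A) → ℝ := fun c => 10 * ‖dfc c‖ + ‖fun g => c g - φ g‖
  have hFc : Continuous F := by
    have h1 : Continuous dfc := by fun_prop
    have h2 : Continuous fun c : G → A => fun g => c g - φ g := by fun_prop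
    exact (continuous_const.mul h1.norm).add h2.norm
  let M₁ : Set A := {a | a ∈ S ∧ a ∈ unitary A}
  have hM₁ : IsCompact M₁ := by
    have : ProperSpace S := FiniteDimensional.proper ℂ S
    have h1 : IsCompact ((Subtype.val : S → A) '' (Metric.closedBall 0 1)) :=
      (isCompact_closedBall 0 1).image continuous_subtype_val
    refine h1.of_isClosed_subset ?_ ?_
    · have h2 : IsClosed {a : A | star a * a = 1 ∧ a * star a = 1} :=
        (isClosed_eq (by fun_prop) (by fun_prop)).inter (isClosed_eq (by fun_prop) (by fun_prop))
      exact hS.inter h2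
    · rintro a ⟨ha, hau⟩
      refine ⟨⟨a, ha⟩, ?_, rfl⟩
      rw [mem_closedBall_zero_iff]
      exact (aux_norm_unitary_le hau : ‖a‖ ≤ 1)
  have hM : IsCompact (Set.univ.pi fun _ : G => M₁) := isCompact_univ_pi fun _ => hM₁
  obtain ⟨c, hcM, hmin⟩ := hM.exists_isMinOn ⟨c0, fun g _ => ⟨hc0S g, hc0u g⟩⟩ hFc.continuousOn
  have hcM' : ∀ g, c g ∈ M₁ := fun g => hcM g trivial
  have hF0 : F c ≤ 217 * γ := by
    refine (hmin (a := c0) fun g _ => ⟨hc0S g, hc0u g⟩).trans ?_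
    have h1 : ‖dfc c0‖ ≤ 21 * γ := (pi_norm_le_iff_of_nonneg (by positivity)).2 fun p => hc0d _ _
    have h2 : ‖fun g => c0 g - φ g‖ ≤ 7 * γ :=
      (pi_norm_le_iff_of_nonneg (by positivity)).2 fun p => hc0 _
    simp only [F]
    linarith
  set δ := ‖dfc c‖ with hδ
  have hδ0 : 0 ≤ δ := norm_nonneg _
  have hdist0 : 0 ≤ ‖fun g => c g - φ g‖ := norm_nonneg _
  have hFeq : F c = 10 * δ + ‖fun g => c g - φ g‖ := rfl
  have hδle : δ ≤ 22 * γ := by linarith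
  have hdd : ∀ g h, ‖c g * c h - c (g * h)‖ ≤ δ := fun g h => norm_le_pi_norm (dfc c) (g, h)
  obtain ⟨c', hc'S, hc'u, hc'd, hc'c⟩ := aux_newton_step S hS c (fun g => (hcM' g).1)
    (fun g => (hcM' g).2) (by linarith) hdd
  have hF' : F c ≤ F c' := hmin (a := c') fun g _ => ⟨hc'S g, hc'u g⟩
  have h1 : ‖dfc c'‖ ≤ 14 * δ ^ 2 :=
    (pi_norm_le_iff_of_nonneg (by positivity)).2 fun p => hc'd _ _
  have h2 : ‖fun g => c' g - φ g‖ ≤ (δ + 4 * δ ^ 2) + ‖fun g => c g - φ g‖ := by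
    refine (pi_norm_le_iff_of_nonneg (by positivity)).2 fun g => ?_
    have h3 : c' g - φ g = (c' g - c g) + (c g - φ g) := by abel
    rw [h3]
    refine (norm_add_le _ _).trans (add_le_add (hc'c g) ?_)
    exact norm_le_pi_norm (fun g => c g - φ g) g
  have hF'eq : F c' = 10 * ‖dfc c'‖ + ‖fun g => c' g - φ g‖ := rfl
  have hδz : δ = 0 := by
    by_contra hne
    have hpos : 0 < δ := lt_of_le_of_ne hδ0 (Ne.symm hne)
    have : 9 * δ ≤ 144 * δ ^ 2 := by linarith
    nlinarith
  refine ⟨c, fun g => (hcM' g).1, fun g => (hcM' g).2, fun g k => ?_, fun g => ?_⟩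
  · have := hdd g k
    rw [hδz] at this
    exact sub_eq_zero.1 (norm_le_zero_iff.1 this)
  · have := norm_le_pi_norm (fun g => c g - φ g) g
    linarith

/-- Dimension-free perturbation for group representations. -/
lemma aux_conj_rep (S : StarSubalgebra ℂ A) [FiniteDimensional ℂ S] (hS : IsClosed (S : Set A))
    (φ : G →* A) (hφ : ∀ g, φ g ∈ unitary A) {γ : ℝ} (hγ : γ < 1 / 2000)
    (h : ∀ g, ∃ s ∈ S, ‖φ g - s‖ ≤ γ) :
    ∃ u ∈ unitary A, ‖u - 1‖ ≤ 1600 * γ ∧ ∀ g, u * φ g * star u ∈ S := by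
  have hγ0 : 0 ≤ γ := by obtain ⟨s, -, hs⟩ := h 1; exact (norm_nonneg _).trans hs
  obtain ⟨c, hcS, hcu, hcm, hcφ⟩ := aux_exact_rep S hS φ hφ (by linarith) h
  set v : A := auxAvg (fun g => c g * star (φ g)) with hv
  have hv1 : ‖v - 1‖ ≤ 217 * γ := by
    rw [hv, ← auxAvg_const (G := G) (1 : A), ← auxAvg_sub]
    refine auxAvg_norm _ fun g => ?_
    have : c g * star (φ g) - 1 = (c g - φ g) * star (φ g) := by
      rw [sub_mul, Unitary.mul_star_self_of_mem (hφ g)]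
    rw [this, CStarRing.norm_mul_mem_unitary _ (Unitary.star_mem (hφ g))]
    exact hcφ g
  have intertw : ∀ k, c k * v = v * φ k := by
    intro k
    have h1 : ∀ g, c k * (c g * star (φ g)) = (c (k * g) * star (φ (k * g))) * φ k := by
      intro g
      rw [← mul_assoc, hcm, map_mul, star_mul, mul_assoc, mul_assoc,
        Unitary.star_mul_self_of_mem (hφ k), mul_one]
    rw [hv, ← auxAvg_mul_left]
    simp only [h1]
    rw [auxAvg_mul_right, auxAvg_mulLeft (fun g => c g * star (φ g)) k]
  have hone : (1 : A) ∈ unitary A := one_mem _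
  obtain ⟨r, hu, -, hur, hcomm⟩ := aux_polar (⊤ : StarSubalgebra ℂ A) (by simp)
    (a := v) (by simp) hone (hv1.trans_lt (by linarith)) (t := 3 * (217 * γ)) (by linarith)
    (aux_star_mul_near hone (by linarith) hv1)
  refine ⟨v * r, hu, ?_, fun k => ?_⟩
  · have : v * r - 1 = (v - 1) - (v - v * r) := by abel
    rw [this]
    refine (norm_sub_le _ _).trans ?_
    linarith
  · have hc1 : Commute (φ k) (star v * v) := by
      have h1 : star v * c k = φ k * star v := by
        have h2 := congrArg star (intertw k)
        rw [star_mul, star_mul] at h2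
        have h3 : φ k * (star v * star (c k)) * c k = φ k * (star (φ k) * star v) * c k := by
          rw [h2]
        rw [mul_assoc, mul_assoc, Unitary.star_mul_self_of_mem (hcu k), mul_one, ← mul_assoc (φ k),
          Unitary.mul_star_self_of_mem (hφ k), one_mul] at h3
        exact h3.symm
      show φ k * (star v * v) = star v * v * φ k
      rw [← mul_assoc, ← h1, mul_assoc, intertw, mul_assoc]
    have hc2 := hcomm _ hc1
    have h3 : v * r * φ k = c k * (v * r) := by
      rw [mul_assoc, ← hc2.eq, ← mul_assoc, ← intertw, mul_assoc]
    rw [h3, mul_assoc, Unitary.mul_star_self_of_mem hu, mul_one]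
    exact hcS k

end Newton

section GroupSpan

lemma aux_orth_finite (n : ℕ) : Finite (Matrix.orthogonalGroup (Fin n) ℤ) := by
  have hfin : Set.Finite {M : Matrix (Fin n) (Fin n) ℤ | ∀ i j, M i j ∈ Set.Icc (-1 : ℤ) 1} := by
    have h1 : Set.Finite (Set.univ.pi fun _ : Fin n => Set.univ.pi fun _ : Fin n =>
        Set.Icc (-1 : ℤ) 1) :=
      Set.Finite.pi fun _ => Set.Finite.pi fun _ => Set.finite_Icc _ _
    refine h1.subset ?_
    intro M hM i _ j _
    exact hM i j
  refine Set.Finite.subset hfin ?_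
  intro M hM i j
  have h1 : M * star M = 1 := Unitary.mul_star_self_of_mem hM
  have h2 := congrFun (congrFun h1 i) i
  rw [Matrix.mul_apply, Matrix.one_apply_eq] at h2
  simp only [Matrix.star_apply, star_trivial] at h2
  have h3 : M i j * M i j ≤ 1 := by
    rw [← h2]
    exact Finset.single_le_sum (f := fun k => M i k * M i k) (fun k _ => mul_self_nonneg _)
      (Finset.mem_univ j)
  constructor <;> nlinarith

/-- integral orthogonal matrices as complex matrices -/
noncomputable def auxOrthHom {n : ℕ} (d : Fin n → ℕ) :
    ((i : Fin n) → Matrix.orthogonalGroup (Fin (d i)) ℤ) →*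
      ((i : Fin n) → Matrix (Fin (d i)) (Fin (d i)) ℂ) where
  toFun g i := (g i : Matrix (Fin (d i)) (Fin (d i)) ℤ).map (Int.castRingHom ℂ)
  map_one' := by funext i; simp
  map_mul' g h := by funext i; exact Matrix.map_mul

lemma aux_perm_orth {n : ℕ} (σ : Equiv.Perm (Fin n)) :
    (σ.toPEquiv.toMatrix : Matrix (Fin n) (Fin n) ℤ) ∈ Matrix.orthogonalGroup (Fin n) ℤ := by
  rw [Matrix.mem_orthogonalGroup_iff]
  ext i j
  rw [Matrix.mul_apply, Finset.sum_eq_single (σ i)]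
  · simp [PEquiv.toMatrix_apply, Matrix.one_apply, eq_comm]
  · intro k _ hk
    simp [PEquiv.toMatrix_apply, hk.symm]
  · simp

lemma aux_diag_orth {n : ℕ} (k : Fin n) :
    (Matrix.diagonal (fun i => if i = k then (-1 : ℤ) else 1)) ∈ Matrix.orthogonalGroup (Fin n) ℤ := by
  rw [Matrix.mem_orthogonalGroup_iff, Matrix.diagonal_transpose,
    Matrix.diagonal_mul_diagonal, ← Matrix.diagonal_one]
  congr 1
  funext i
  by_cases h : i = k <;> simp [h]

lemma aux_span_orth {n : ℕ} (d : Fin n → ℕ) :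
    Submodule.span ℂ (Set.range (auxOrthHom d)) = ⊤ := by
  classical
  set V := Submodule.span ℂ (Set.range (auxOrthHom d)) with hV
  -- slots
  have hslot : ∀ (i : Fin n) (M : Matrix.orthogonalGroup (Fin (d i)) ℤ),
      (Pi.single i ((M : Matrix (Fin (d i)) (Fin (d i)) ℤ).map (Int.castRingHom ℂ)) :
        (i : Fin n) → Matrix (Fin (d i)) (Fin (d i)) ℂ) ∈ V := by
    intro i M
    have h1 : auxOrthHom d (Function.update 1 i M) ∈ V := Submodule.subset_span ⟨_, rfl⟩
    have h2 : auxOrthHom d (Function.update 1 i (-M)) ∈ V := Submodule.subset_span ⟨_, rfl⟩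
    have h3 := V.smul_mem (1/2 : ℂ) (V.sub_mem h1 h2)
    convert h3 using 1
    funext j
    by_cases hj : j = i
    · subst hj
      ext a b
      simp [auxOrthHom, Unitary.coe_neg]
      ring
    · simp [auxOrthHom, hj]
  have hunit : ∀ (i : Fin n) (k l : Fin (d i)),
      (Pi.single i (Matrix.single k l (1:ℂ)) :
        (i : Fin n) → Matrix (Fin (d i)) (Fin (d i)) ℂ) ∈ V := by
    intro i k l
    have h1 := hslot i ⟨_, aux_perm_orth (Equiv.swap k l)⟩
    have h2 := hslot i (⟨_, aux_diag_orth k⟩ * ⟨_, aux_perm_orth (Equiv.swap k l)⟩)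
    have h3 := V.smul_mem (1/2 : ℂ) (V.sub_mem h1 h2)
    convert h3 using 1
    rw [← Pi.single_sub, ← Pi.single_smul]
    congr 1
    ext a b
    simp only [Matrix.smul_apply, Matrix.sub_apply, Matrix.map_apply, Submonoid.coe_mul,
      Matrix.diagonal_mul, PEquiv.toMatrix_apply, Equiv.toPEquiv_apply, Matrix.single_apply]
    by_cases ha : a = k
    · subst ha
      by_cases hb : l = b
      · subst hb; simp; norm_num
      · have : ¬ (b = l) := fun h => hb h.symm
        simp [hb]
    · have : ¬ (k = a) := fun h => ha h.symm
      simp [ha, this]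
  rw [eq_top_iff]
  intro x _
  have hx : x = ∑ i, Pi.single i (x i) := (Finset.univ_sum_single x).symm
  rw [hx]
  refine V.sum_mem fun i _ => ?_
  have hxi : x i = ∑ k, ∑ l, Matrix.single k l (x i k l) := Matrix.matrix_eq_sum_single (x i)
  have : (Pi.single i (x i) : (i : Fin n) → Matrix (Fin (d i)) (Fin (d i)) ℂ)
      = ∑ k, ∑ l, (x i k l) • Pi.single i (Matrix.single k l (1:ℂ)) := by
    conv_lhs => rw [hxi]
    funext j
    by_cases hj : j = i
    · subst hj
      simp [Finset.sum_apply, Matrix.smul_single]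
    · simp [hj, Finset.sum_apply]
  rw [this]
  exact V.sum_mem fun k _ => V.sum_mem fun l _ => V.smul_mem _ (hunit i k l)

variable {A : Type u} [CStarAlgebra A]

lemma aux_semisimple (S : StarSubalgebra ℂ A) [FiniteDimensional ℂ S] : IsSemisimpleRing S := by
  have : IsArtinianRing S := IsArtinianRing.of_finite ℂ S
  rw [IsArtinianRing.isSemisimpleRing_iff_jacobson, eq_bot_iff]
  intro x hx
  obtain ⟨n, hn⟩ := IsArtinianRing.isNilpotent_jacobson_bot (R := S)
  rw [Ideal.jacobson_bot] at hn
  have h1 : star x * x ∈ Ring.jacobson S := Ideal.mul_mem_left _ _ hx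
  have h2 : (star x * x) ^ n = 0 := by
    have := Ideal.pow_mem_pow h1 n
    rw [hn] at this
    exact this
  have h3 : (star x * x) ^ 2 ^ n = 0 := pow_eq_zero_of_le (Nat.lt_two_pow_self).le h2
  have h4 : (star (x : A) * x) ^ 2 ^ n = 0 := by
    have := congrArg (Subtype.val : S → A) h3
    simpa using this
  have h5 := (IsSelfAdjoint.star_mul_self (x : A)).nnnorm_pow_two_pow n
  rw [h4, nnnorm_zero] at h5
  have h6 := pow_eq_zero_iff (pow_ne_zero n two_ne_zero) |>.1 h5.symm
  have h7 := CStarRing.star_mul_self_eq_zero_iff (x : A) |>.1 (nnnorm_eq_zero.1 h6)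
  simpa using h7

lemma aux_group_prelim (S : StarSubalgebra ℂ A) [FiniteDimensional ℂ S] :
    ∃ (G : Type) (_ : Group G) (_ : Fintype G) (φ : G →* A),
      (∀ g, φ g ∈ S) ∧ ∀ x ∈ S, x ∈ Submodule.span ℂ (Set.range φ) := by
  have := aux_semisimple S
  obtain ⟨n, d, -, ⟨e⟩⟩ := IsSemisimpleRing.exists_algEquiv_pi_matrix_of_isAlgClosed ℂ S
  have hf : ∀ i, Finite (Matrix.orthogonalGroup (Fin (d i)) ℤ) := fun i => aux_orth_finite _
  have : Finite ((i : Fin n) → Matrix.orthogonalGroup (Fin (d i)) ℤ) := inferInstance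
  refine ⟨_, inferInstance, Fintype.ofFinite ((i : Fin n) → Matrix.orthogonalGroup (Fin (d i)) ℤ),
    (S.subtype : S →* A).comp ((e.symm : _ →* S).comp (auxOrthHom d)), ?_, ?_⟩
  · intro g
    exact (e.symm (auxOrthHom d g)).2
  · intro x hx
    have h1 : e ⟨x, hx⟩ ∈ Submodule.span ℂ (Set.range (auxOrthHom d)) := by
      rw [aux_span_orth]; trivial
    have h2 := Submodule.mem_map_of_mem
      (f := (S.subtype.toAlgHom.toLinearMap).comp e.symm.toLinearMap) h1
    rw [Submodule.map_span, ← Set.range_comp] at h2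
    have h3 : ((S.subtype.toAlgHom.toLinearMap).comp e.symm.toLinearMap) (e ⟨x, hx⟩) = x := by simp
    rw [h3] at h2
    exact h2

lemma aux_group (S : StarSubalgebra ℂ A) [FiniteDimensional ℂ S] (hS : IsClosed (S : Set A)) :
    ∃ (G : Type) (_ : Group G) (_ : Fintype G) (φ : G →* A),
      (∀ g, φ g ∈ S) ∧ (∀ g, φ g ∈ unitary A) ∧
      ∀ x ∈ S, x ∈ Submodule.span ℂ (Set.range φ) := by
  obtain ⟨G, hG, hGf, ψ, hψS, hψ⟩ := aux_group_prelim S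
  let _ := CStarAlgebra.spectralOrder A
  have := CStarAlgebra.spectralOrderedRing A
  set T : A := ∑ g, star (ψ g) * ψ g with hT
  have hT1 : algebraMap ℝ A 1 ≤ T := by
    have h1 : star (ψ 1) * ψ 1 ≤ T :=
      Finset.single_le_sum (f := fun g => star (ψ g) * ψ g)
        (fun g _ => star_mul_self_nonneg _) (Finset.mem_univ 1)
    simpa using h1
  have hTsa : IsSelfAdjoint T := by
    rw [hT, IsSelfAdjoint, star_sum]; simp
  have hTS : T ∈ S := sum_mem fun g _ => mul_mem (star_mem (hψS g)) (hψS g)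
  have hspec : ∀ x ∈ spectrum ℝ T, 1 ≤ x := (algebraMap_le_iff_le_spectrum (a := T)).1 hT1
  have hc1 : ContinuousOn (fun x : ℝ => √x) (spectrum ℝ T) := by fun_prop
  have hc2 : ContinuousOn (fun x : ℝ => 1 / √x) (spectrum ℝ T) := by
    apply ContinuousOn.div continuousOn_const hc1
    intro x hx
    exact (Real.sqrt_pos.2 (by linarith [hspec x hx])).ne'
  set a := cfc (fun x : ℝ => √x) T with ha
  set b := cfc (fun x : ℝ => 1 / √x) T with hb
  have hasa : IsSelfAdjoint a := cfc_predicate _ _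
  have hbsa : IsSelfAdjoint b := cfc_predicate _ _
  have haS : a ∈ S := cfc_mem (𝕜' := ℂ) (hs := hS) _ hTS
  have hbS : b ∈ S := cfc_mem (𝕜' := ℂ) (hs := hS) _ hTS
  have hab : a * b = 1 := by
    rw [ha, hb, ← cfc_mul _ _ T hc1 hc2, ← cfc_one ℝ T]
    apply cfc_congr
    intro x hx
    have := (Real.sqrt_pos.2 (show 0 < x by linarith [hspec x hx])).ne'
    simp [this]
  have hba : b * a = 1 := by rw [← hab]; exact cfc_commute_cfc _ _ _
  have haa : a * a = T := by
    rw [ha, ← cfc_mul _ _ T hc1 hc1]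
    conv_rhs => rw [← cfc_id' ℝ T]
    apply cfc_congr
    intro x hx
    exact Real.mul_self_sqrt (by linarith [hspec x hx])
  have hinv : ∀ g, star (ψ g) * T * ψ g = T := by
    intro g
    rw [hT, Finset.mul_sum, Finset.sum_mul]
    conv_rhs => rw [← Equiv.sum_comp (Equiv.mulRight g)]
    refine Finset.sum_congr rfl fun k _ => ?_
    simp [mul_assoc]
  let φ : G →* A :=
    { toFun := fun g => a * ψ g * b
      map_one' := by simp [hab]
      map_mul' := fun g h => by
        rw [map_mul]
        calc a * (ψ g * ψ h) * b = a * ψ g * (1 * (ψ h * b)) := by simp only [mul_assoc, one_mul]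
          _ = _ := by rw [← hba]; simp only [mul_assoc] }
  have hstar : ∀ g, star (φ g) * φ g = 1 := by
    intro g
    show star (a * ψ g * b) * (a * ψ g * b) = 1
    rw [star_mul, star_mul, hasa.star_eq, hbsa.star_eq]
    calc b * (star (ψ g) * a) * (a * ψ g * b) = b * (star (ψ g) * (a * a) * ψ g) * b := by
          simp only [mul_assoc]
      _ = (b * a) * (a * b) := by rw [haa, hinv, ← haa]; simp only [mul_assoc]
      _ = 1 := by rw [hab, hba, one_mul]
  refine ⟨G, hG, hGf, φ, fun g => mul_mem (mul_mem haS (hψS g)) hbS, fun g => ?_, fun x hx => ?_⟩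
  · rw [Unitary.mem_iff]
    refine ⟨hstar g, ?_⟩
    have h1 : φ g * φ g⁻¹ = 1 := by rw [← map_mul, mul_inv_cancel, map_one]
    rw [left_inv_eq_right_inv (hstar g) h1]
    exact h1
  · have h1 := hψ (b * x * a) (mul_mem (mul_mem hbS hx) haS)
    have h2 := Submodule.mem_map_of_mem
      (f := (LinearMap.mulLeft ℂ a).comp (LinearMap.mulRight ℂ b)) h1
    rw [Submodule.map_span, ← Set.range_comp] at h2
    have h3 : ((LinearMap.mulLeft ℂ a).comp (LinearMap.mulRight ℂ b)) (b * x * a) = x := by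
      simp only [LinearMap.comp_apply, LinearMap.mulLeft_apply, LinearMap.mulRight_apply]
      calc a * (b * x * a * b) = (a * b) * x * (a * b) := by simp only [mul_assoc]
        _ = x := by rw [hab, one_mul, mul_one]
    rw [h3] at h2
    have h4 : (⇑((LinearMap.mulLeft ℂ a).comp (LinearMap.mulRight ℂ b)) ∘ ⇑ψ) = ⇑φ := by
      funext g
      simp [φ, mul_assoc]
    rw [h4] at h2
    exact h2

end GroupSpan

section Assemble
variable {A : Type u} [CStarAlgebra A]

lemma aux_add_proj (S : NonUnitalStarSubalgebra ℂ A) (r : A) (hr : star r = r) (hrr : r * r = r)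
    (h : ∀ s ∈ S, r * s ∈ S ∧ s * r ∈ S) :
    ∃ S' : NonUnitalStarSubalgebra ℂ A, (∀ x, x ∈ S' ↔ ∃ s ∈ S, ∃ c : ℂ, x = s + c • r) ∧
      (FiniteDimensional ℂ S → FiniteDimensional ℂ S') := by
  let S' : NonUnitalStarSubalgebra ℂ A :=
    { carrier := {x | ∃ s ∈ S, ∃ c : ℂ, x = s + c • r}
      add_mem' := by
        rintro _ _ ⟨s, hs, c, rfl⟩ ⟨s', hs', c', rfl⟩
        exact ⟨s + s', add_mem hs hs', c + c', by rw [add_smul]; abel⟩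
      zero_mem' := ⟨0, zero_mem _, 0, by simp⟩
      mul_mem' := by
        rintro _ _ ⟨s, hs, c, rfl⟩ ⟨s', hs', c', rfl⟩
        refine ⟨s * s' + c' • (s * r) + c • (r * s'), add_mem (add_mem (mul_mem hs hs')
          (SMulMemClass.smul_mem _ (h s hs).2)) (SMulMemClass.smul_mem _ (h s' hs').1), c * c', ?_⟩
        simp only [add_mul, mul_add, smul_mul_assoc, mul_smul_comm, hrr]
        module
      smul_mem' := by
        rintro a _ ⟨s, hs, c, rfl⟩
        exact ⟨a • s, SMulMemClass.smul_mem _ hs, a * c, by rw [smul_add, smul_smul]⟩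
      star_mem' := by
        rintro _ ⟨s, hs, c, rfl⟩
        exact ⟨star s, star_mem hs, star c, by rw [star_add, star_smul, hr]⟩ }
  refine ⟨S', fun x => Iff.rfl, fun hfd => ?_⟩
  have h1 : FiniteDimensional ℂ (S.toSubmodule : Submodule ℂ A) := hfd
  have h2 : FiniteDimensional ℂ ↥(S.toSubmodule ⊔ Submodule.span ℂ {r} : Submodule ℂ A) :=
    inferInstance
  have h3 : (S'.toSubmodule : Submodule ℂ A) ≤ S.toSubmodule ⊔ Submodule.span ℂ {r} := by
    rintro x ⟨s, hs, c, rfl⟩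
    exact Submodule.add_mem_sup hs (Submodule.smul_mem _ _ (Submodule.mem_span_singleton_self r))
  exact Submodule.finiteDimensional_of_le h3

lemma aux_fd_closed (S : StarSubalgebra ℂ A) [FiniteDimensional ℂ S] : IsClosed (S : Set A) := by
  have h : FiniteDimensional ℂ (Subalgebra.toSubmodule S.toSubalgebra) :=
    ‹FiniteDimensional ℂ S›
  exact Submodule.closed_of_finiteDimensional (Subalgebra.toSubmodule S.toSubalgebra)

lemma aux_fd_closed' (S : NonUnitalStarSubalgebra ℂ A) (hf : FiniteDimensional ℂ S) :
    IsClosed (S : Set A) := by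
  have h : FiniteDimensional ℂ (S.toSubmodule : Submodule ℂ A) := hf
  exact Submodule.closed_of_finiteDimensional (S.toSubmodule : Submodule ℂ A)

lemma aux_add_one (S : NonUnitalStarSubalgebra ℂ A) :
    ∃ S' : NonUnitalStarSubalgebra ℂ A, (∀ x, x ∈ S' ↔ ∃ s ∈ S, ∃ c : ℂ, x = s + c • 1) ∧
      (FiniteDimensional ℂ S → FiniteDimensional ℂ S') :=
  aux_add_proj S 1 (star_one A) (one_mul 1) fun s hs => by simpa using hs

lemma aux_side (C : NonUnitalStarSubalgebra ℂ A) {δ γ : ℝ} (hδ : 0 < δ)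
    (hγ : γ + δ < 1 / 2000)
    (hC : ∀ (Y : Finset A), (↑Y : Set A) ⊆ (C : Set A) →
      ∃ G : NonUnitalStarSubalgebra ℂ A, G ≤ C ∧ FiniteDimensional ℂ G ∧
      ∀ y ∈ Y, ∃ s ∈ G, ‖y - s‖ < δ)
    {G : Type} [Group G] [Fintype G] (φ : G →* A) (hφ : ∀ g, φ g ∈ unitary A)
    (hnear : ∀ g, ∃ c ∈ C, ∃ z : ℂ, ‖φ g - (c + z • 1)‖ ≤ γ) (Y : Finset A)
    (hY : ∀ y ∈ Y, ‖y‖ ≤ 2 ∧ ∃ c ∈ C, ‖y - c‖ < δ) :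
    ∃ C' : NonUnitalStarSubalgebra ℂ A, FiniteDimensional ℂ C' ∧ 1 ∈ C' ∧ (∀ g, φ g ∈ C') ∧
      ∀ y ∈ Y, ∃ c ∈ C', ‖y - c‖ ≤ 2 * δ + 6400 * (γ + δ) := by
  classical
  choose cg hcg zg hzg using hnear
  choose! cy hcy using fun y hy => (hY y hy).2
  obtain ⟨C0, hC0C, hC0f, hC0⟩ := hC (Finset.univ.image cg ∪ Y.image cy) (by
    intro x hx
    simp only [Finset.coe_union, Finset.coe_image, Finset.coe_univ, Set.image_univ,
      Set.mem_union, Set.mem_range, Set.mem_image] at hx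
    rcases hx with ⟨g, rfl⟩ | ⟨y, hy, rfl⟩
    · exact hcg g
    · exact (hcy y hy).1)
  obtain ⟨C1, hC1, hC1f⟩ := aux_add_one C0
  have hone : (1 : A) ∈ C1 := (hC1 1).2 ⟨0, zero_mem _, 1, by simp⟩
  have hC1f := hC1f hC0f
  let S := C1.toStarSubalgebra hone
  have hmem : ∀ x, x ∈ S ↔ x ∈ C1 := fun x => Iff.rfl
  have hSf : FiniteDimensional ℂ S := hC1f
  obtain ⟨u, hu, hu1, huS⟩ := aux_conj_rep S (aux_fd_closed S) φ hφ hγ (by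
    intro g
    obtain ⟨s, hs, hsg⟩ := hC0 (cg g) (by simp)
    refine ⟨s + zg g • 1, (hC1 _).2 ⟨s, hs, zg g, rfl⟩, ?_⟩
    have : φ g - (s + zg g • 1) = (φ g - (cg g + zg g • 1)) + (cg g - s) := by abel
    rw [this]
    exact (norm_add_le _ _).trans (add_le_add (hzg g) hsg.le))
  let f := Unitary.conjStarAlgAut ℂ A ⟨star u, Unitary.star_mem hu⟩
  have hf : ∀ x, f x = star u * x * u := by
    intro x; simp [f, Unitary.conjStarAlgAut_apply]
  refine ⟨NonUnitalStarSubalgebra.map f C1, ?_, ?_, ?_, ?_⟩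
  · have h1 : FiniteDimensional ℂ (C1.toSubmodule : Submodule ℂ A) := hC1f
    let fl : A →ₗ[ℂ] A := (LinearMap.mulLeft ℂ (star u)).comp (LinearMap.mulRight ℂ u)
    have h2 : FiniteDimensional ℂ ((C1.toSubmodule : Submodule ℂ A).map fl) := inferInstance
    have h3 : ((NonUnitalStarSubalgebra.map f C1).toSubmodule : Submodule ℂ A)
        ≤ (C1.toSubmodule : Submodule ℂ A).map fl := by
      rintro x ⟨y, hy, rfl⟩
      refine ⟨y, hy, ?_⟩
      have := hf y
      simp only [fl, LinearMap.comp_apply, LinearMap.mulLeft_apply, LinearMap.mulRight_apply]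
      rw [← mul_assoc]
      exact this.symm
    exact Submodule.finiteDimensional_of_le h3
  · exact ⟨1, hone, by
      have := hf 1
      rw [mul_one, Unitary.star_mul_self_of_mem hu] at this
      exact this⟩
  · intro g
    refine ⟨u * φ g * star u, huS g, ?_⟩
    have := hf (u * φ g * star u)
    refine Eq.trans this ?_
    calc star u * (u * φ g * star u) * u = (star u * u) * φ g * (star u * u) := by
          simp only [mul_assoc]
      _ = φ g := by rw [Unitary.star_mul_self_of_mem hu, one_mul, mul_one]
  · intro y hy
    obtain ⟨s, hs, hsy⟩ := hC0 (cy y) (by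
      simp only [Finset.mem_union, Finset.mem_image]; exact Or.inr ⟨y, hy, rfl⟩)
    refine ⟨star u * s * u, ⟨s, (hC1 _).2 ⟨s, hs, 0, by simp⟩, hf s⟩, ?_⟩
    have hys : ‖y - s‖ ≤ 2 * δ := by
      have : y - s = (y - cy y) + (cy y - s) := by abel
      rw [this]
      refine (norm_add_le _ _).trans ?_
      linarith [(hcy y hy).2]
    have h1 : y - star u * s * u = star u * ((u - 1) * y - y * (u - 1)) + star u * (y - s) * u := by
      have : star u * ((u - 1) * y - y * (u - 1)) + star u * (y - s) * u
          = (star u * u) * y - star u * s * u := by noncomm_ring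
      rw [this, Unitary.star_mul_self_of_mem hu, one_mul]
    have hy2 := (hY y hy).1
    have n1 : ‖(u - 1) * y‖ ≤ 1600 * (γ + δ) * 2 :=
      (norm_mul_le _ _).trans (mul_le_mul hu1 hy2 (norm_nonneg _)
        ((norm_nonneg _).trans hu1))
    have n2 : ‖y * (u - 1)‖ ≤ 2 * (1600 * (γ + δ)) :=
      (norm_mul_le _ _).trans (mul_le_mul hy2 hu1 (norm_nonneg _) (by norm_num))
    rw [h1]
    refine (norm_add_le _ _).trans ?_
    rw [CStarRing.norm_mul_mem_unitary _ hu, CStarRing.norm_mem_unitary_mul _ (Unitary.star_mem hu),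
      CStarRing.norm_mem_unitary_mul _ (Unitary.star_mem hu)]
    have := norm_sub_le ((u - 1) * y) (y * (u - 1))
    linarith

lemma aux_proj_norm {p : A} (hp : star p = p) (hpp : p * p = p) : ‖p‖ ≤ 1 := by
  have h := CStarRing.norm_star_mul_self (x := p)
  rw [hp, hpp] at h
  by_contra hne
  push Not at hne
  nlinarith

lemma aux_one_norm : ‖(1 : A)‖ ≤ 1 := aux_proj_norm (star_one A) (one_mul 1)

lemma aux_scal {x q : A} (hx : ‖x‖ ≤ 1) {b : ℂ} (h : x * q = b • q) :
    ∃ b' : ℂ, ‖b'‖ ≤ 1 ∧ x * q = b' • q := by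
  by_cases hq : q = 0
  · exact ⟨0, by simp, by simp [hq]⟩
  · refine ⟨b, ?_, h⟩
    have hq0 : 0 < ‖q‖ := norm_pos_iff.2 hq
    have h1 : ‖b‖ * ‖q‖ ≤ 1 * ‖q‖ := by
      rw [← norm_smul, ← h]
      exact (norm_mul_le _ _).trans (by gcongr)
    exact le_of_mul_le_mul_right h1 hq0

/-- elements of the enlarged algebra are near `T`. -/
lemma aux_near (T : NonUnitalStarSubalgebra ℂ A) (hT1 : (1 : A) ∈ T) {δ : ℝ} {E : Set A}
    (hE : ∀ e ∈ E, ‖e‖ ≤ 1 → ∃ t ∈ T, ‖t‖ ≤ 1 ∧ ‖e - t‖ ≤ δ) {h p q : A} (hh : ‖h‖ ≤ 1)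
    (hpE : p ∈ E) (hps : star p = p) (hpp : p * p = p)
    (hth : ∃ t ∈ T, ‖h - t‖ ≤ δ) (hq : ‖q - (h - h * p)‖ ≤ 5 * δ)
    {x : A} (hx : ‖x‖ ≤ 1) (hxp : x * p ∈ E) {b c : ℂ} (hxq : x * q = b • q)
    (hxr : x * (1 - p - q) = c • (1 - p - q)) :
    ∃ t ∈ T, ‖x - t‖ ≤ 18 * δ := by
  obtain ⟨th, hthT, hth⟩ := hth
  have hδ : 0 ≤ δ := (norm_nonneg _).trans hth
  have hp1 := aux_proj_norm hps hpp
  obtain ⟨tp, htpT, htp1, htp⟩ := hE p hpE hp1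
  obtain ⟨te, hteT, -, hte⟩ := hE (x * p) hxp
    ((norm_mul_le _ _).trans (mul_le_one₀ hx (norm_nonneg _) hp1))
  obtain ⟨b', hb', hxq⟩ := aux_scal hx hxq
  obtain ⟨c', hc', hxr⟩ := aux_scal hx hxr
  have hq8 : ‖q - (th - th * tp)‖ ≤ 8 * δ := by
    have h1 : q - (th - th * tp) = (q - (h - h * p)) + (h - th) - h * (p - tp) - (h - th) * tp := by
      noncomm_ring
    have n1 : ‖h * (p - tp)‖ ≤ 1 * δ :=
      (norm_mul_le _ _).trans (mul_le_mul hh htp (norm_nonneg _) (by norm_num))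
    have n2 : ‖(h - th) * tp‖ ≤ δ * 1 :=
      (norm_mul_le _ _).trans (mul_le_mul hth htp1 (norm_nonneg _) hδ)
    have n3 := norm_add_le (q - (h - h * p)) (h - th)
    have n4 := norm_sub_le ((q - (h - h * p)) + (h - th)) (h * (p - tp))
    rw [h1]
    refine (norm_sub_le _ _).trans ?_
    linarith
  set tq := th - th * tp with htq
  have htqT : tq ∈ T := sub_mem hthT (mul_mem hthT htpT)
  have hr9 : ‖(1 - p - q) - (1 - tp - tq)‖ ≤ 9 * δ := by
    have h1 : (1 - p - q) - (1 - tp - tq) = -(p - tp) - (q - tq) := by abel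
    rw [h1]
    refine (norm_sub_le _ _).trans ?_
    rw [norm_neg]; linarith
  refine ⟨te + b' • tq + c' • (1 - tp - tq), add_mem (add_mem hteT (SMulMemClass.smul_mem _ htqT))
    (SMulMemClass.smul_mem _ (sub_mem (sub_mem hT1 htpT) htqT)), ?_⟩
  have h1 : x = x * p + x * q + x * (1 - p - q) := by noncomm_ring
  have h2 : x - (te + b' • tq + c' • (1 - tp - tq))
      = (x * p - te) + b' • (q - tq) + c' • ((1 - p - q) - (1 - tp - tq)) := by
    conv_lhs => rw [h1, hxq, hxr]
    simp only [smul_sub]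
    abel
  rw [h2]
  have n1 : ‖b' • (q - tq)‖ ≤ 1 * (8 * δ) := by
    rw [norm_smul]; exact mul_le_mul hb' hq8 (norm_nonneg _) (by norm_num)
  have n2 : ‖c' • ((1 - p - q) - (1 - tp - tq))‖ ≤ 1 * (9 * δ) := by
    rw [norm_smul]; exact mul_le_mul hc' hr9 (norm_nonneg _) (by norm_num)
  refine (norm_add_le _ _).trans ?_
  have := norm_add_le (x * p - te) (b' • (q - tq))
  linarith

lemma aux_norm_mul_right {x f : A} (hf : ‖f‖ ≤ 1) : ‖x * f‖ ≤ ‖x‖ :=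
  (norm_mul_le _ _).trans (mul_le_of_le_one_right (norm_nonneg _) hf)

lemma aux_norm_mul_left {x f : A} (hf : ‖f‖ ≤ 1) : ‖f * x‖ ≤ ‖x‖ :=
  (norm_mul_le _ _).trans (mul_le_of_le_one_left (norm_nonneg _) hf)

/-- construction of the projection `q`. -/
lemma aux_q {h p s0 e1 : A} {δ : ℝ} (hδ : δ < 1 / 16) (hh : IsSelfAdjoint h)
    (hps : star p = p) (hpp : p * p = p) (hs0 : p * s0 = s0) (he1 : p * e1 = e1)
    (hs : ∃ s, p * s = s ∧ ‖h * p - s‖ ≤ δ ∧ ‖s - s0‖ ≤ δ)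
    (he : ‖h * (1 - h) - e1‖ ≤ δ) :
    ∃ q : A, star q = q ∧ q * q = q ∧ q * p = 0 ∧ p * q = 0 ∧ ‖q - (h - h * p)‖ ≤ 5 * δ ∧
      ‖((1/2 : ℂ) • (s0 + star s0) + q) - h‖ ≤ 8 * δ := by
  obtain ⟨s, hps', hs1, hs2⟩ := hs
  have hδ0 : 0 ≤ δ := (norm_nonneg _).trans hs1
  have hp1 := aux_proj_norm hps hpp
  set f := 1 - p with hf
  have hfs : star f = f := by rw [hf, star_sub, star_one, hps]
  have hfp : f * p = 0 := by rw [hf, sub_mul, one_mul, hpp, sub_self]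
  have hpf : p * f = 0 := by rw [hf, mul_sub, mul_one, hpp, sub_self]
  have hff : f * f = f := by rw [hf, mul_sub, mul_one, ← hf, hfp, sub_zero]
  have hf1 := aux_proj_norm hfs hff
  have hfhp : ‖f * h * p‖ ≤ δ := by
    have h1 : f * h * p = f * (h * p - s) := by
      rw [mul_sub, ← hps', ← mul_assoc f p, hfp, zero_mul, sub_zero, mul_assoc]
    rw [h1]
    exact (aux_norm_mul_left hf1).trans hs1
  have hphf : ‖p * h * f‖ ≤ δ := by
    have : p * h * f = star (f * h * p) := by
      rw [star_mul, star_mul, hps, hfs, hh.star_eq, mul_assoc]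
    rw [this, norm_star]; exact hfhp
  set b := f * h * f with hb
  have hbsa : IsSelfAdjoint b := by
    rw [IsSelfAdjoint, hb, star_mul, star_mul, hfs, hh.star_eq, mul_assoc]
  have hbb : ‖b - b * b‖ ≤ 2 * δ := by
    have h1 : b - b * b = f * (h * (1 - h) - e1) * f + (f * h * p) * (p * h * f) := by
      have e0 : f * e1 = 0 := by rw [← he1, ← mul_assoc, hfp, zero_mul]
      have e2 : f * (h * (1 - h) - e1) * f = f * h * f - f * h * h * f := by
        rw [mul_sub f (h * (1 - h)) e1, e0, sub_zero]; noncomm_ring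
      have e3 : (f * h * p) * (p * h * f) = f * h * (p * p) * h * f := by noncomm_ring
      have e4 : b * b = f * h * (f * f) * h * f := by rw [hb]; noncomm_ring
      rw [e2, e3, e4, hpp, hff, hb]
      have e5 : f * h * f * h * f = f * h * h * f - f * h * p * h * f := by
        conv_lhs => rw [mul_assoc (f * h * f), mul_assoc (f * h) f]
        nth_rewrite 2 [hf]
        noncomm_ring
      rw [e5]; abel
    rw [h1]
    refine (norm_add_le _ _).trans ?_
    have n1 : ‖f * (h * (1 - h) - e1) * f‖ ≤ δ :=
      (aux_norm_mul_right hf1).trans ((aux_norm_mul_left hf1).trans he)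
    have n2 : ‖(f * h * p) * (p * h * f)‖ ≤ δ * δ :=
      (norm_mul_le _ _).trans (mul_le_mul hfhp hphf (norm_nonneg _) hδ0)
    nlinarith
  obtain ⟨q, hqsa, hqq, hqf, hfq, hqb⟩ := aux_proj hbsa (f := f) hfs
    (by rw [hb, mul_assoc, hff]) (t := 2 * δ) (by linarith) hbb
  refine ⟨q, hqsa, hqq, ?_, ?_, ?_, ?_⟩
  · rw [← hqf, mul_assoc, hfp, mul_zero]
  · rw [← hfq, ← mul_assoc, hpf, zero_mul]
  · have h1 : q - (h - h * p) = (q - b) - p * h * f := by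
      rw [hb, hf]; noncomm_ring
    rw [h1]
    refine (norm_sub_le _ _).trans ?_
    linarith
  · have h1 : ((1/2 : ℂ) • (s0 + star s0) + q) - h
        = ((1/2 : ℂ) • (s0 + star s0) - p * h * p) + (q - b) - p * h * f - f * h * p := by
      rw [hb, hf]; noncomm_ring
    have n0 : ‖s0 - p * h * p‖ ≤ 2 * δ := by
      have : s0 - p * h * p = p * (-(s - s0) - (h * p - s)) := by
        rw [mul_sub, mul_neg, mul_sub, mul_sub, hs0, hps', ← mul_assoc]; abel
      rw [this]
      refine (aux_norm_mul_left hp1).trans ((norm_sub_le _ _).trans ?_)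
      rw [norm_neg]; linarith
    have n0' : ‖star s0 - p * h * p‖ ≤ 2 * δ := by
      have : star s0 - p * h * p = star (s0 - p * h * p) := by
        rw [star_sub, star_mul, star_mul, hps, hh.star_eq, mul_assoc]
      rw [this, norm_star]; exact n0
    have n1 : ‖(1/2 : ℂ) • (s0 + star s0) - p * h * p‖ ≤ 2 * δ := by
      have : (1/2 : ℂ) • (s0 + star s0) - p * h * p
          = (1/2 : ℂ) • ((s0 - p * h * p) + (star s0 - p * h * p)) := by
        module
      rw [this, norm_smul]
      have := norm_add_le (s0 - p * h * p) (star s0 - p * h * p)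
      have : ‖(1/2 : ℂ)‖ = 1/2 := by norm_num
      rw [this]; linarith
    rw [h1]
    have m1 := norm_add_le ((1/2 : ℂ) • (s0 + star s0) - p * h * p) (q - b)
    have m2 := norm_sub_le ((1/2 : ℂ) • (s0 + star s0) - p * h * p + (q - b)) (p * h * f)
    refine (norm_sub_le _ _).trans ?_
    linarith

end Assemble

section Main
variable {A : Type u} [CStarAlgebra A]

lemma aux_backward
    (H : ∀ (X : Finset A), (∀ x ∈ X, ‖x‖ ≤ 1) → ∀ ε : ℝ, 0 < ε →
        ∃ C D E : NonUnitalStarSubalgebra ℂ A,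
          FiniteDimensional ℂ C ∧ FiniteDimensional ℂ D ∧ FiniteDimensional ℂ E ∧
          (1 : A) ∈ C ∧ (1 : A) ∈ D ∧ (1 : A) ∈ E ∧
          ∃ h ∈ E, (∃ x : A, h = star x * x) ∧ ‖h‖ ≤ 1 ∧
            (∀ x ∈ X, ‖h * x - x * h‖ < ε) ∧
            (∀ x ∈ X, MemEps ε (C : Set A) (h * x)) ∧
            (∀ x ∈ X, MemEps ε (D : Set A) ((1 - h) * x)) ∧
            (∀ x ∈ X, MemEps ε (E : Set A) ((1 - h) * (h * x))) ∧
            E ≤ C ∧ E ≤ D) : ComplexityRankLeOne A := by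
  classical
  intro X ε hε
  obtain ⟨M, hM1, hM⟩ : ∃ M : ℝ, 1 ≤ M ∧ ∀ x ∈ X, ‖x‖ ≤ M := by
    refine ⟨1 + ∑ x ∈ X, ‖x‖, ?_, ?_⟩
    · have := Finset.sum_nonneg (s := X) (f := fun x => ‖x‖) fun x _ => norm_nonneg x
      linarith
    · intro x hx
      have := Finset.single_le_sum (s := X) (f := fun x => ‖x‖) (fun x _ => norm_nonneg x) hx
      linarith
  have hM0 : 0 < M := by linarith
  have hMc : (M : ℂ) ≠ 0 := by exact_mod_cast hM0.ne'
  have hnM : ‖(M : ℂ)‖ = M := by rw [Complex.norm_real, Real.norm_of_nonneg hM0.le]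
  obtain ⟨C, D, E, hCf, hDf, hEf, hC1, hD1, hE1, h, hhE, hpos, hh, hcomm, hC, hD, hE, hEC, hED⟩ :=
    H (X.image fun x => (M : ℂ)⁻¹ • x) (by
      intro y hy
      obtain ⟨x, hx, rfl⟩ := Finset.mem_image.1 hy
      rw [norm_smul, norm_inv, hnM, inv_mul_le_iff₀ hM0, mul_one]
      exact hM x hx) (ε / M) (by positivity)
  have hcl : ∀ (S : NonUnitalStarSubalgebra ℂ A), FiniteDimensional ℂ S → (1 : A) ∈ S →
      IsUnitalLocFinDimSub S := by
    intro S hf h1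
    refine ⟨aux_fd_closed' S hf, ⟨1, h1, by simp⟩, fun Y hY δ hδ => ⟨S, le_rfl, hf, fun y hy =>
      ⟨y, hY hy, by simpa using hδ⟩⟩⟩
  have hres : ∀ (S : NonUnitalStarSubalgebra ℂ A) (z : A),
      MemEps (ε / M) (S : Set A) ((M : ℂ)⁻¹ • z) → MemEps ε (S : Set A) z := by
    rintro S z ⟨s, hs, hsz⟩
    refine ⟨(M : ℂ) • s, SMulMemClass.smul_mem _ hs, ?_⟩
    have : z - (M : ℂ) • s = (M : ℂ) • ((M : ℂ)⁻¹ • z - s) := by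
      rw [smul_sub, smul_inv_smul₀ hMc]
    rw [this, norm_smul, hnM]
    rwa [lt_div_iff₀' hM0] at hsz
  have him : ∀ x ∈ X, (M : ℂ)⁻¹ • x ∈ X.image fun x => (M : ℂ)⁻¹ • x :=
    fun x hx => Finset.mem_image_of_mem _ hx
  have hsub : ∀ S T : NonUnitalStarSubalgebra ℂ A, S ≤ T → SubsetEps ε (S : Set A) (T : Set A) :=
    fun S T hST s hs hs1 => ⟨s, hST hs, hs1, by simpa using hε⟩
  refine ⟨C, D, E, hcl C hCf hC1, hcl D hDf hD1, hcl E hEf hE1, h, hpos, hh, ?_, ?_, ?_, ?_,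
    hsub _ _ hEC, hsub _ _ hED, fun e he _ => ⟨h * e, mul_mem hhE he, by simpa using hε⟩⟩
  · intro x hx
    have := hcomm _ (him x hx)
    rw [mul_smul_comm, smul_mul_assoc, ← smul_sub, norm_smul, norm_inv, hnM,
      inv_mul_lt_iff₀ hM0] at this
    rwa [mul_div_cancel₀ _ hM0.ne'] at this
  · intro x hx
    have := hC _ (him x hx)
    rw [mul_smul_comm] at this
    exact hres _ _ this
  · intro x hx
    have := hD _ (him x hx)
    rw [mul_smul_comm] at this
    exact hres _ _ this
  · intro x hx
    have := hE _ (him x hx)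
    rw [mul_smul_comm, mul_smul_comm] at this
    have := hres _ _ this
    have e : h * ((1 - h) * x) = (1 - h) * (h * x) := by noncomm_ring
    rwa [e]

lemma aux_forward (H : ComplexityRankLeOne A) (X : Finset A) (hX : ∀ x ∈ X, ‖x‖ ≤ 1)
    (ε : ℝ) (hε : 0 < ε) :
        ∃ C D E : NonUnitalStarSubalgebra ℂ A,
          FiniteDimensional ℂ C ∧ FiniteDimensional ℂ D ∧ FiniteDimensional ℂ E ∧
          (1 : A) ∈ C ∧ (1 : A) ∈ D ∧ (1 : A) ∈ E ∧
          ∃ h ∈ E, (∃ x : A, h = star x * x) ∧ ‖h‖ ≤ 1 ∧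
            (∀ x ∈ X, ‖h * x - x * h‖ < ε) ∧
            (∀ x ∈ X, MemEps ε (C : Set A) (h * x)) ∧
            (∀ x ∈ X, MemEps ε (D : Set A) ((1 - h) * x)) ∧
            (∀ x ∈ X, MemEps ε (E : Set A) ((1 - h) * (h * x))) ∧
            E ≤ C ∧ E ≤ D := by
  classical
  obtain ⟨δ, hδ, hδ1, hδε⟩ : ∃ δ : ℝ, 0 < δ ∧ 1000000 * δ ≤ 1 ∧ 1000000 * δ ≤ ε := by
    refine ⟨min ε 1 / 1000000, by positivity, ?_, ?_⟩
    · have := min_le_right ε 1; linarith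
    · have := min_le_left ε 1; linarith
  obtain ⟨C, D, E, hCl, hDl, hEl, h, hpos, hh, hcomm, hCx, hDx, hEx, hEC, hED, hhE⟩ :=
    H (insert 1 X) δ hδ
  have h1X : (1 : A) ∈ insert 1 X := Finset.mem_insert_self _ _
  have hhsa : IsSelfAdjoint h := by
    obtain ⟨x, rfl⟩ := hpos; exact IsSelfAdjoint.star_mul_self x
  -- the unit of `E`
  obtain ⟨p, hpE, hpu⟩ := hEl.2.1
  have hps : star p = p := by
    have e1 : p * star p = star p := (hpu _ (star_mem hpE)).1
    have e2 : star (p * star p) = p * star p := by rw [star_mul, star_star]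
    rw [e1, star_star] at e2
    exact e2.symm
  have hpp : p * p = p := (hpu p hpE).1
  have hp1 := aux_proj_norm hps hpp
  obtain ⟨s, hsE, hs⟩ := hhE p hpE hp1
  choose! ex hexE hex using hEx
  obtain ⟨E0, hE0E, hE0f, hE0⟩ := hEl.2.2 (insert s ((insert 1 X).image ex)) (by
    intro y hy
    rw [Finset.mem_coe, Finset.mem_insert, Finset.mem_image] at hy
    rcases hy with rfl | ⟨x, hx, rfl⟩
    · exact hsE
    · exact hexE x hx) δ hδ
  obtain ⟨s0, hs0, hs0s⟩ := hE0 s (Finset.mem_insert_self _ _)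
  have hs0E : s0 ∈ E := hE0E hs0
  obtain ⟨q, hqs, hqq, hqp, hpq, hqn, hyn⟩ := aux_q (h := h) (p := p) (s0 := s0) (e1 := ex 1)
    (δ := δ) (by linarith) hhsa hps hpp (hpu _ hs0E).1 (hpu _ (hexE 1 h1X)).1
    ⟨s, (hpu _ hsE).1, hs.le, hs0s.le⟩ (by
      have := hex 1 h1X
      rw [mul_one] at this
      exact this.le)
  -- the enlarged algebra
  obtain ⟨P, hP, hPf⟩ := aux_add_proj E0 p hps hpp (fun x hx => by
    rw [(hpu x (hE0E hx)).1, (hpu x (hE0E hx)).2]; exact ⟨hx, hx⟩)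
  have hPf := hPf hE0f
  have hPE : ∀ x ∈ P, x ∈ E := by
    intro x hx
    obtain ⟨a, ha, c, rfl⟩ := (hP x).1 hx
    exact add_mem (hE0E ha) (SMulMemClass.smul_mem _ hpE)
  have hqE : ∀ x ∈ E, q * x = 0 ∧ x * q = 0 := by
    intro x hx
    constructor
    · rw [← (hpu x hx).1, ← mul_assoc, hqp, zero_mul]
    · rw [← (hpu x hx).2, mul_assoc, hpq, mul_zero]
  obtain ⟨Q, hQ, hQf⟩ := aux_add_proj P q hqs hqq (fun x hx => by
    rw [(hqE x (hPE x hx)).1, (hqE x (hPE x hx)).2]; exact ⟨zero_mem _, zero_mem _⟩)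
  have hQf := hQf hPf
  obtain ⟨R, hR, hRf⟩ := aux_add_one Q
  have hRf := hRf hQf
  have hR1 : (1 : A) ∈ R := (hR 1).2 ⟨0, zero_mem _, 1, by simp⟩
  have hQR : ∀ x ∈ Q, x ∈ R := fun x hx => (hR x).2 ⟨x, hx, 0, by simp⟩
  have hPR : ∀ x ∈ P, x ∈ R := fun x hx => hQR x ((hQ x).2 ⟨x, hx, 0, by simp⟩)
  have hE0R : ∀ x ∈ E0, x ∈ R := fun x hx => hPR x ((hP x).2 ⟨x, hx, 0, by simp⟩)
  have hqR : q ∈ R := hQR q ((hQ q).2 ⟨0, zero_mem _, 1, by simp⟩)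
  let S := R.toStarSubalgebra hR1
  have hSR : ∀ x, x ∈ S ↔ x ∈ R := fun x => Iff.rfl
  have hSf : FiniteDimensional ℂ S := hRf
  have hScl := aux_fd_closed S
  obtain ⟨h', hh'S, hpos', hh', hhh⟩ := aux_clamp S hScl (y := (1/2 : ℂ) • (s0 + star s0) + q)
    (h := h) (t := 8 * δ)
    ((hSR _).2 (add_mem (SMulMemClass.smul_mem _ (add_mem (hE0R _ hs0) (star_mem (hE0R _ hs0))))
      hqR)) (by
      rw [IsSelfAdjoint, star_add, star_smul, star_add, star_star, hqs, add_comm (star s0)]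
      congr 2
      simp) hpos hh hyn
  obtain ⟨G, instG, instF, φ, hφS, hφu, hspan⟩ := aux_group S hScl
  -- the group elements
  have hφ1 : ∀ g, ‖φ g‖ ≤ 1 := by
    intro g
    have e := CStarRing.norm_star_mul_self (x := φ g)
    rw [Unitary.star_mul_self_of_mem (hφu g)] at e
    have := aux_one_norm (A := A)
    nlinarith [norm_nonneg (φ g)]
  have hdec : ∀ x ∈ S, x * p ∈ E ∧ (∃ b : ℂ, x * q = b • q) ∧
      ∃ c : ℂ, x * (1 - p - q) = c • (1 - p - q) := by
    intro x hx
    obtain ⟨y, hy, c, rfl⟩ := (hR x).1 hx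
    obtain ⟨e, he, b, rfl⟩ := (hQ y).1 hy
    have heE := hPE e he
    have e1 := (hpu e heE).2
    have e2 := (hqE e heE).2
    refine ⟨?_, ⟨b + c, ?_⟩, ⟨c, ?_⟩⟩
    · have : (e + b • q + c • 1) * p = e + c • p := by
        simp only [add_mul, smul_mul_assoc, one_mul, e1, hqp, smul_zero, add_zero]
      rw [this]
      exact add_mem heE (SMulMemClass.smul_mem _ hpE)
    · simp only [add_mul, smul_mul_assoc, one_mul, e2, hqq, add_smul, zero_add]
    · simp only [add_mul, mul_sub, smul_mul_assoc, one_mul, mul_one, e1, e2, hqp, hqq]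
      module
  have hside : ∀ (K : NonUnitalStarSubalgebra ℂ A), IsUnitalLocFinDimSub K →
      SubsetEps δ (E : Set A) (K : Set A) → (∃ c ∈ K, ∃ z : ℂ, ‖h - (c + z • 1)‖ ≤ δ) →
      ∀ k : A, ‖k‖ ≤ 2 → (∀ x ∈ X, MemEps δ (K : Set A) (k * x)) →
      ∃ K' : NonUnitalStarSubalgebra ℂ A, FiniteDimensional ℂ K' ∧ 1 ∈ K' ∧ R ≤ K' ∧
        ∀ x ∈ X, ∃ c ∈ K', ‖k * x - c‖ ≤ 121602 * δ := by
    intro K hK hEK hhK k hk hkx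
    obtain ⟨T, hT, -⟩ := aux_add_one K
    have hT1 : (1 : A) ∈ T := (hT 1).2 ⟨0, zero_mem _, 1, by simp⟩
    obtain ⟨K', hK'f, hK'1, hK'φ, hK'⟩ := aux_side K (δ := δ) (γ := 18 * δ) hδ (by linarith)
      (fun Y hY => hK.2.2 Y hY δ hδ) φ hφu (by
        intro g
        obtain ⟨d1, ⟨b, d2⟩, ⟨c, d3⟩⟩ := hdec _ (hφS g)
        obtain ⟨t, ht, htg⟩ := aux_near T hT1 (δ := δ) (E := (E : Set A)) (by
          intro e he he1
          obtain ⟨t, ht, ht1, hte⟩ := hEK e he he1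
          exact ⟨t, (hT t).2 ⟨t, ht, 0, by simp⟩, ht1, hte.le⟩) hh hpE hps hpp (by
          obtain ⟨c, hc, z, hz⟩ := hhK
          exact ⟨c + z • 1, (hT _).2 ⟨c, hc, z, rfl⟩, hz⟩) hqn (hφ1 g) d1 d2 d3
        obtain ⟨a, ha, z, rfl⟩ := (hT t).1 ht
        exact ⟨a, ha, z, htg⟩) (X.image fun x => k * x) (by
        intro y hy
        obtain ⟨x, hx, rfl⟩ := Finset.mem_image.1 hy
        refine ⟨?_, hkx x hx⟩
        exact (aux_norm_mul_right (hX x hx)).trans hk)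
    refine ⟨K', hK'f, hK'1, ?_, ?_⟩
    · intro x hx
      have := hspan x hx
      have hle : Submodule.span ℂ (Set.range φ) ≤ (K'.toSubmodule : Submodule ℂ A) := by
        rw [Submodule.span_le]
        rintro _ ⟨g, rfl⟩
        exact hK'φ g
      exact hle this
    · intro x hx
      obtain ⟨c, hc, hcx⟩ := hK' (k * x) (Finset.mem_image_of_mem _ hx)
      exact ⟨c, hc, hcx.trans (by linarith)⟩
  have hXi : ∀ x ∈ X, x ∈ insert 1 X := fun x hx => Finset.mem_insert_of_mem hx
  obtain ⟨C', hC'f, hC'1, hRC, hC'⟩ := hside C hCl hEC (by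
    obtain ⟨c, hc, hcx⟩ := hCx 1 h1X
    rw [mul_one] at hcx
    exact ⟨c, hc, 0, by simpa using hcx.le⟩) h (by linarith) (fun x hx => hCx x (hXi x hx))
  obtain ⟨D', hD'f, hD'1, hRD, hD'⟩ := hside D hDl hED (by
    obtain ⟨c, hc, hcx⟩ := hDx 1 h1X
    rw [mul_one] at hcx
    refine ⟨-c, neg_mem hc, 1, ?_⟩
    have : h - (-c + (1 : ℂ) • 1) = -(1 - h - c) := by rw [one_smul]; abel
    rw [this, norm_neg]; exact hcx.le) (1 - h) (by
      have := norm_sub_le (1 : A) h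
      have := aux_one_norm (A := A)
      linarith) (fun x hx => hDx x (hXi x hx))
  have hdx : ∀ x ∈ X, ‖(h' - h) * x‖ ≤ 16 * δ := fun x hx =>
    (aux_norm_mul_right (hX x hx)).trans (by linarith)
  have hxd : ∀ x ∈ X, ‖x * (h' - h)‖ ≤ 16 * δ := fun x hx =>
    (aux_norm_mul_left (hX x hx)).trans (by linarith)
  refine ⟨C', D', R, hC'f, hD'f, hRf, hC'1, hD'1, hR1, h', hh'S, hpos', hh', ?_, ?_, ?_, ?_,
    hRC, hRD⟩
  · intro x hx
    have e : h' * x - x * h' = (h * x - x * h) + (h' - h) * x - x * (h' - h) := by noncomm_ring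
    rw [e]
    have n1 := hcomm x (hXi x hx)
    have n2 := norm_add_le (h * x - x * h) ((h' - h) * x)
    refine (norm_sub_le _ _).trans_lt ?_
    linarith [hdx x hx, hxd x hx]
  · intro x hx
    obtain ⟨c, hc, hcx⟩ := hC' x hx
    refine ⟨c, hc, ?_⟩
    have e : h' * x - c = (h * x - c) + (h' - h) * x := by noncomm_ring
    rw [e]
    refine (norm_add_le _ _).trans_lt ?_
    linarith [hdx x hx]
  · intro x hx
    obtain ⟨c, hc, hcx⟩ := hD' x hx
    refine ⟨c, hc, ?_⟩
    have e : (1 - h') * x - c = ((1 - h) * x - c) - (h' - h) * x := by noncomm_ring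
    rw [e]
    refine (norm_sub_le _ _).trans_lt ?_
    linarith [hdx x hx]
  · intro x hx
    obtain ⟨c, hc, hcx⟩ := hE0 (ex x) (Finset.mem_insert_of_mem
      (Finset.mem_image_of_mem _ (hXi x hx)))
    refine ⟨c, hE0R c hc, ?_⟩
    have e : (1 - h') * (h' * x) - c = (h * ((1 - h) * x) - ex x) + (ex x - c)
        + (h' - h) * x - h' * ((h' - h) * x) - (h' - h) * (h * x) := by noncomm_ring
    rw [e]
    have n1 := hex x (hXi x hx)
    have n2 := norm_add_le (h * ((1 - h) * x) - ex x) (ex x - c)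
    have n3 := norm_add_le (h * ((1 - h) * x) - ex x + (ex x - c)) ((h' - h) * x)
    have n4 := norm_sub_le (h * ((1 - h) * x) - ex x + (ex x - c) + (h' - h) * x)
      (h' * ((h' - h) * x))
    have n5 : ‖h' * ((h' - h) * x)‖ ≤ 16 * δ := (aux_norm_mul_left hh').trans (hdx x hx)
    have n6 : ‖(h' - h) * (h * x)‖ ≤ 16 * δ :=
      (aux_norm_mul_right ((aux_norm_mul_left hh).trans (hX x hx))).trans (by linarith)
    refine (norm_sub_le _ _).trans_lt ?_
    linarith [hdx x hx]

end Main

/-- Proposition 2.13 of the paper.  A unital C*-algebra `A` has complexity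
rank at most one if and only if: for any finite subset `X` of the closed unit ball of `A` and
any `ε > 0` there exist finite-dimensional C*-subalgebras `C`, `D`, `E` of `A` containing
`1_A`, and a positive contraction `h ∈ E`, such that (i) `‖[h,x]‖ < ε` for `x ∈ X`;
(ii) `hx ∈_ε C`, `(1-h)x ∈_ε D`, `(1-h)hx ∈_ε E` for `x ∈ X`; (iii) `E ⊆ C` and `E ⊆ D`. -/
theorem complexityRankLeOne_iff {A : Type u} [CStarAlgebra A] :
    ComplexityRankLeOne A ↔
      ∀ (X : Finset A), (∀ x ∈ X, ‖x‖ ≤ 1) → ∀ ε : ℝ, 0 < ε →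
        ∃ C D E : NonUnitalStarSubalgebra ℂ A,
          FiniteDimensional ℂ C ∧ FiniteDimensional ℂ D ∧ FiniteDimensional ℂ E ∧
          (1 : A) ∈ C ∧ (1 : A) ∈ D ∧ (1 : A) ∈ E ∧
          ∃ h ∈ E, (∃ x : A, h = star x * x) ∧ ‖h‖ ≤ 1 ∧
            (∀ x ∈ X, ‖h * x - x * h‖ < ε) ∧
            (∀ x ∈ X, MemEps ε (C : Set A) (h * x)) ∧
            (∀ x ∈ X, MemEps ε (D : Set A) ((1 - h) * x)) ∧
            (∀ x ∈ X, MemEps ε (E : Set A) ((1 - h) * (h * x))) ∧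
            E ≤ C ∧ E ≤ D := by
  exact ⟨fun H X hX ε hε => aux_forward H X hX ε hε, aux_backward⟩
end

section
/- For any ordinal α, the class D_α is closed under taking quotient C*-algebras: if A is a unital C*-algebra in D_α and I is a closed two-sided ideal of A with I ≠ A, then the quotient C*-algebra A/I is in D_α. -/
universe u

/-- A unital C*-algebra is locally finite-dimensional. -/
def IsLocFinDim (A : Type u) [CStarAlgebra A] : Prop :=
  ∀ (X : Finset A) (ε : ℝ), 0 < ε →
    ∃ F : NonUnitalStarSubalgebra ℂ A, FiniteDimensional ℂ F ∧
      ∀ x ∈ X, MemEps ε (F : Set A) x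

/-- The C*-subalgebra `S` of `A` is *-isomorphic to the C*-algebra `B`. -/
def SubIso {A : Type u} [CStarAlgebra A] (S : NonUnitalStarSubalgebra ℂ A)
    (B : Type u) [CStarAlgebra B] : Prop :=
  Nonempty (S ≃⋆ₐ[ℂ] B)

/-- Membership in the class `D_α` of the complexity hierarchy (Definition 2.4 of the paper):
`D₀` consists of the unital locally finite-dimensional C*-algebras, and for `α > 0`, `D_α`
consists of the unital C*-algebras decomposing over the class `⋃_{β<α} D_β`; a C*-subalgebra
belongs to that class when it is closed and *-isomorphic to some unital C*-algebra in some
`D_β` with `β < α`. -/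
def InD (α : Ordinal.{u}) (A : Type u) [CStarAlgebra A] : Prop :=
  (α = 0 ∧ IsLocFinDim A) ∨
  (α ≠ 0 ∧ Decomposes A fun S =>
      IsClosed (S : Set A) ∧
      ∃ β : {b : Ordinal.{u} // b < α}, ∃ (B : Type u) (instB : CStarAlgebra B),
        @InD β.1 B instB ∧ @SubIso A _ S B instB)
termination_by α
decreasing_by exact β.2

/-- Exact norm-controlled lifting along *-homomorphisms. -/
theorem exists_lift_norm_le {P Q : Type*} [NonUnitalCStarAlgebra P] [NonUnitalCStarAlgebra Q]
    (ψ : P →⋆ₙₐ[ℂ] Q) (x : P) : ∃ x' : P, ψ x' = ψ x ∧ ‖x'‖ ≤ ‖ψ x‖ := by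
  rcases (norm_nonneg (ψ x)).eq_or_lt with h0 | hr
  · refine ⟨0, ?_, by simp⟩
    rw [map_zero]
    exact (norm_eq_zero.mp h0.symm).symm
  set r := ‖ψ x‖ with hrdef
  let k : ℝ → ℝ := fun t => 1 - r / max r (Real.sqrt |t|)
  have hmax : ∀ t : ℝ, 0 < max r (Real.sqrt |t|) := fun t => lt_max_of_lt_left hr
  have hk : Continuous k := by
    refine continuous_const.sub (continuous_const.div ?_ fun t => (hmax t).ne')
    fun_prop
  have hk0 : k 0 = 0 := by
    simp [k, max_eq_left hr.le, div_self hr.ne']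
  have hsa : IsSelfAdjoint (star x * x) := IsSelfAdjoint.star_mul_self x
  have hsa' : IsSelfAdjoint (star (ψ x) * ψ x) := IsSelfAdjoint.star_mul_self _
  have hψ : Continuous ψ := by
    refine AddMonoidHomClass.continuous_of_bound ψ 1 fun a => ?_
    simpa using NonUnitalStarAlgHom.norm_apply_le ψ a
  refine ⟨x - x * cfcₙ k (star x * x), ?_, ?_⟩
  · have h1 : ψ (cfcₙ k (star x * x)) = cfcₙ k (star (ψ x) * ψ x) := by
      have := NonUnitalStarAlgHom.map_cfcₙ (R := ℝ) (S := ℂ) ψ k (star x * x)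
        hk.continuousOn hk0 hψ hsa (by rw [map_mul, map_star]; exact hsa')
      rwa [map_mul, map_star] at this
    have h2 : cfcₙ k (star (ψ x) * ψ x) = 0 := by
      rw [← cfcₙ_const_zero ℝ (star (ψ x) * ψ x)]
      apply cfcₙ_congr
      intro t ht
      have hn := NonUnitalIsometricContinuousFunctionalCalculus.norm_quasispectrum_le
        (𝕜 := ℝ) (star (ψ x) * ψ x) ht hsa'
      rw [CStarRing.norm_star_mul_self, Real.norm_eq_abs, ← hrdef] at hn
      have : Real.sqrt |t| ≤ r := by
        rw [Real.sqrt_le_left hr.le]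
        nlinarith
      simp [k, max_eq_left this, div_self hr.ne']
    rw [map_sub, map_mul, h1, h2, mul_zero, sub_zero]
  · have hks : star (cfcₙ k (star x * x)) = cfcₙ k (star x * x) :=
      (cfcₙ_predicate (R := ℝ) (p := IsSelfAdjoint) k (star x * x)).star_eq
    have hid : cfcₙ (fun t : ℝ => t) (star x * x) = star x * x := cfcₙ_id' ℝ _ hsa
    have key : star (x - x * cfcₙ k (star x * x)) * (x - x * cfcₙ k (star x * x))
        = cfcₙ (fun t => (t - k t * t) - (t - k t * t) * k t) (star x * x) := by
      rw [cfcₙ_sub (fun t => t - k t * t) (fun t => (t - k t * t) * k t) (star x * x)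
          (by fun_prop) (by simp) (by fun_prop) (by simp),
        cfcₙ_mul (fun t => t - k t * t) k (star x * x)
          (by fun_prop) (by simp) (by fun_prop) hk0,
        cfcₙ_sub (fun t => t) (fun t => k t * t) (star x * x)
          (by fun_prop) (by simp) (by fun_prop) (by simp),
        cfcₙ_mul k (fun t => t) (star x * x)
          (by fun_prop) hk0 (by fun_prop) (by simp), hid]
      rw [star_sub, star_mul, hks]
      noncomm_ring
    have hle : ‖star (x - x * cfcₙ k (star x * x)) * (x - x * cfcₙ k (star x * x))‖ ≤ r * r := by
      rw [key]
      refine norm_cfcₙ_le fun t _ => ?_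
      have h3 : (t - k t * t) - (t - k t * t) * k t
          = t * (r / max r (Real.sqrt |t|)) ^ 2 := by
        simp only [k]; ring
      rw [h3, Real.norm_eq_abs, abs_mul, abs_of_nonneg (sq_nonneg (r / max r (Real.sqrt |t|))), div_pow,
        mul_div_assoc', div_le_iff₀ (pow_pos (hmax t) 2)]
      have h4 : |t| ≤ max r (Real.sqrt |t|) ^ 2 := by
        calc |t| = Real.sqrt |t| ^ 2 := (Real.sq_sqrt (abs_nonneg t)).symm
          _ ≤ _ := pow_le_pow_left₀ (Real.sqrt_nonneg _) (le_max_right _ _) 2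
      nlinarith [mul_pos hr hr]
    rw [CStarRing.norm_star_mul_self] at hle
    exact abs_le_of_sq_le_sq' (by nlinarith) hr.le |>.2

/-- The range of a *-homomorphism between C*-algebras is closed. -/
theorem isClosed_range_starHom {P Q : Type*} [NonUnitalCStarAlgebra P] [NonUnitalCStarAlgebra Q]
    (ψ : P →⋆ₙₐ[ℂ] Q) : IsClosed (Set.range ψ) := by
  let f : NormedAddGroupHom P Q :=
    { toFun := ψ
      map_add' := map_add ψ
      bound' := ⟨1, fun a => by simpa using NonUnitalStarAlgHom.norm_apply_le ψ a⟩ }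
  let K : AddSubgroup Q := f.toAddMonoidHom.range
  have hK : (K : Set Q) = Set.range ψ := by
    ext y
    exact Iff.rfl
  have hs : f.SurjectiveOnWith K 1 := by
    rintro _ ⟨x, rfl⟩
    obtain ⟨x', h1, h2⟩ := exists_lift_norm_le ψ x
    exact ⟨x', h1, by rw [one_mul]; exact h2⟩
  have hc := controlled_closure_of_complete one_pos one_pos hs
  rw [← hK, ← closure_subset_iff_isClosed]
  intro y hy
  obtain ⟨g, hg, -⟩ := hc y hy
  exact ⟨g, hg⟩

section
variable {A B : Type u} [CStarAlgebra A] [CStarAlgebra B]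

theorem coe_map_eq_range (φ : A →⋆ₙₐ[ℂ] B) (C : NonUnitalStarSubalgebra ℂ A) :
    ((C.map φ : NonUnitalStarSubalgebra ℂ B) : Set B)
      = Set.range (φ.comp (NonUnitalStarSubalgebraClass.subtype C)) := by
  ext y
  constructor
  · rintro ⟨x, hx, rfl⟩
    exact ⟨⟨x, hx⟩, rfl⟩
  · rintro ⟨x, rfl⟩
    exact ⟨x, x.2, rfl⟩

theorem isClosed_map (φ : A →⋆ₙₐ[ℂ] B) (C : NonUnitalStarSubalgebra ℂ A)
    (hC : IsClosed (C : Set A)) :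
    IsClosed ((C.map φ : NonUnitalStarSubalgebra ℂ B) : Set B) := by
  rw [coe_map_eq_range]
  have := hC
  exact isClosed_range_starHom _

theorem exists_lift_mem (φ : A →⋆ₙₐ[ℂ] B) (C : NonUnitalStarSubalgebra ℂ A)
    (hC : IsClosed (C : Set A)) (y : B) (hy : y ∈ C.map φ) :
    ∃ x ∈ C, φ x = y ∧ ‖x‖ ≤ ‖y‖ := by
  have := hC
  obtain ⟨x, hx, rfl⟩ := hy
  obtain ⟨x', h1, h2⟩ := exists_lift_norm_le
    (φ.comp (NonUnitalStarSubalgebraClass.subtype C)) ⟨x, hx⟩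
  exact ⟨x', x'.2, h1, h2⟩

theorem memEps_map (φ : A →⋆ₙₐ[ℂ] B) (C : NonUnitalStarSubalgebra ℂ A) {ε : ℝ} {a : A}
    (h : MemEps ε (C : Set A) a) :
    MemEps ε ((C.map φ : NonUnitalStarSubalgebra ℂ B) : Set B) (φ a) := by
  obtain ⟨s, hs, hlt⟩ := h
  refine ⟨φ s, ⟨s, hs, rfl⟩, ?_⟩
  rw [← map_sub]
  exact (NonUnitalStarAlgHom.norm_apply_le φ _).trans_lt hlt

theorem subsetEps_map (φ : A →⋆ₙₐ[ℂ] B) (C E : NonUnitalStarSubalgebra ℂ A) {ε : ℝ}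
    (hE : IsClosed (E : Set A)) (h : SubsetEps ε (E : Set A) (C : Set A)) :
    SubsetEps ε ((E.map φ : NonUnitalStarSubalgebra ℂ B) : Set B)
      ((C.map φ : NonUnitalStarSubalgebra ℂ B) : Set B) := by
  intro s hs hs1
  obtain ⟨e, he, rfl, hn⟩ := exists_lift_mem φ E hE s hs
  obtain ⟨t, ht, ht1, hlt⟩ := h e he (hn.trans hs1)
  refine ⟨φ t, ⟨t, ht, rfl⟩, (NonUnitalStarAlgHom.norm_apply_le φ _).trans ht1, ?_⟩
  rw [← map_sub]
  exact (NonUnitalStarAlgHom.norm_apply_le φ _).trans_lt hlt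

/-- A closed *-subalgebra with a unit is a unital C*-algebra. -/
noncomputable abbrev cstarOfUnit (S : NonUnitalStarSubalgebra ℂ B) (hS : IsClosed (S : Set B))
    (e : S) (he : ∀ x : S, e * x = x) (he' : ∀ x : S, x * e = x) : CStarAlgebra S :=
  letI i0 : NonUnitalCStarAlgebra S :=
    @NonUnitalStarSubalgebra.nonUnitalCStarAlgebra _ B _ _ _ _ _ S hS
  letI i1 : NormedRing S :=
    { i0.toNonUnitalNormedRing with
      one := e
      one_mul := he
      mul_one := he' }
  letI i2 : Algebra ℂ S := Algebra.ofModule (fun r x y => smul_mul_assoc r x y)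
    (fun r x y => mul_smul_comm r x y)
  { i1, i0 with
    toAlgebra := i2
    norm_smul_le := fun r x => i0.toNormedSpace.norm_smul_le r x }

end

theorem quotient_aux (α : Ordinal.{u}) : ∀ (A B : Type u) [CStarAlgebra A] [CStarAlgebra B]
    (φ : A →⋆ₐ[ℂ] B) (_ : Function.Surjective φ) (_ : InD α A), InD α B := by
  induction α using WellFoundedLT.induction with
  | ind α ih =>
  intro A B _ _ φ hφ hA
  classical
  let φ' : A →⋆ₙₐ[ℂ] B := φ.toNonUnitalStarAlgHom
  choose σ hσ using hφ
  rw [InD] at hA ⊢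
  rcases hA with ⟨h0, hA⟩ | ⟨h0, hA⟩
  · left
    refine ⟨h0, fun X ε hε => ?_⟩
    obtain ⟨F, hF, hX⟩ := hA (X.image σ) ε hε
    refine ⟨F.map φ', ?_, fun x hx => ?_⟩
    · have : FiniteDimensional ℂ F.toNonUnitalSubalgebra.toSubmodule := hF
      exact (inferInstance : FiniteDimensional ℂ
        (F.toNonUnitalSubalgebra.toSubmodule.map (φ.toAlgHom.toLinearMap)))
    · have := memEps_map φ' F (hX (σ x) (Finset.mem_image_of_mem σ hx))
      rwa [show φ' (σ x) = x from hσ x] at this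
  · right
    refine ⟨h0, fun X ε hε => ?_⟩
    obtain ⟨C, D, E, hC, hD, hE, h, ⟨y, hy⟩, hn, hcomm, hXC, hXD, hXE, hEC, hED, hhE⟩ :=
      hA (X.image σ) ε hε
    have hσ' : ∀ x, φ' (σ x) = x := hσ
    have hone : φ' 1 = 1 := map_one φ
    have hcls : ∀ C : NonUnitalStarSubalgebra ℂ A, (IsClosed (C : Set A) ∧
      ∃ β : {b : Ordinal.{u} // b < α}, ∃ (B : Type u) (instB : CStarAlgebra B),
        @InD β.1 B instB ∧ @SubIso A _ C B instB) →
        (IsClosed ((C.map φ' : NonUnitalStarSubalgebra ℂ B) : Set B) ∧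
      ∃ β : {b : Ordinal.{u} // b < α}, ∃ (B' : Type u) (instB : CStarAlgebra B'),
        @InD β.1 B' instB ∧ @SubIso B _ (C.map φ') B' instB) := by
      rintro C ⟨hC, β, B', instB', hB', ⟨e⟩⟩
      have hcl := isClosed_map φ' C hC
      refine ⟨hcl, β, ?_⟩
      let ρ : B' → (C.map φ' : NonUnitalStarSubalgebra ℂ B) :=
        fun b => ⟨φ' (e.symm b : C), ⟨(e.symm b : C), (e.symm b).2, rfl⟩⟩
      have hρ : Function.Surjective ρ := by
        rintro ⟨_, x, hx, rfl⟩
        refine ⟨e ⟨x, hx⟩, Subtype.ext ?_⟩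
        simp [ρ]
        rfl
      have hmul : ∀ a b, ρ (a * b) = ρ a * ρ b := fun a b => Subtype.ext (by simp [ρ])
      have hadd : ∀ a b, ρ (a + b) = ρ a + ρ b := fun a b => Subtype.ext (by simp [ρ])
      have hsmul : ∀ (c : ℂ) a, ρ (c • a) = c • ρ a := fun c a => Subtype.ext (by simp [ρ])
      have hstar : ∀ a, ρ (star a) = star (ρ a) := fun a => Subtype.ext (by simp [ρ, map_star])
      have h1 : ∀ x, ρ 1 * x = x := by
        intro x
        obtain ⟨b, rfl⟩ := hρ x
        rw [← hmul, one_mul]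
      have h2 : ∀ x, x * ρ 1 = x := by
        intro x
        obtain ⟨b, rfl⟩ := hρ x
        rw [← hmul, mul_one]
      let inst := cstarOfUnit (C.map φ' : NonUnitalStarSubalgebra ℂ B) hcl (ρ 1) h1 h2
      refine ⟨(C.map φ' : NonUnitalStarSubalgebra ℂ B), inst, ?_, ?_⟩
      · let ρ' : B' →⋆ₐ[ℂ] (C.map φ' : NonUnitalStarSubalgebra ℂ B) :=
          { toFun := ρ
            map_one' := rfl
            map_mul' := hmul
            map_zero' := by
              have := hsmul 0 0
              rw [zero_smul, zero_smul] at this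
              exact this
            map_add' := hadd
            commutes' := fun c => by
              rw [Algebra.algebraMap_eq_smul_one, Algebra.algebraMap_eq_smul_one]
              exact hsmul c 1
            map_star' := hstar }
        exact ih β.1 β.2 B' _ ρ' hρ hB'
      · exact ⟨StarAlgEquiv.refl _ _⟩
    refine ⟨C.map φ', D.map φ', E.map φ', hcls C hC, hcls D hD, hcls E hE, φ' h,
      ⟨φ' y, by rw [hy, map_mul, map_star]⟩,
      (NonUnitalStarAlgHom.norm_apply_le φ' _).trans hn, ?_, ?_, ?_, ?_,
      subsetEps_map φ' C E hE.1 hEC, subsetEps_map φ' D E hE.1 hED, ?_⟩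
    · intro x hx
      have := hcomm (σ x) (Finset.mem_image_of_mem σ hx)
      have h3 := (NonUnitalStarAlgHom.norm_apply_le φ' _).trans_lt this
      rwa [map_sub, map_mul, map_mul, hσ'] at h3
    · intro x hx
      have := memEps_map φ' C (hXC (σ x) (Finset.mem_image_of_mem σ hx))
      rwa [map_mul, hσ'] at this
    · intro x hx
      have := memEps_map φ' D (hXD (σ x) (Finset.mem_image_of_mem σ hx))
      rwa [map_mul, map_sub, hone, hσ'] at this
    · intro x hx
      have := memEps_map φ' E (hXE (σ x) (Finset.mem_image_of_mem σ hx))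
      rwa [map_mul, map_mul, map_sub, hone, hσ'] at this
    · intro e he he1
      obtain ⟨x, hx, rfl, hxn⟩ := exists_lift_mem φ' E hE.1 e he
      have := memEps_map φ' E (hhE x hx (hxn.trans he1))
      rwa [map_mul] at this

/-- Lemma 2.7 of the paper.  For any ordinal `α`, the class `D_α` is closed
under taking quotient C*-algebras.  Since the quotient of a unital C*-algebra `A` by a closed
two-sided ideal `I ≠ A` is (up to *-isomorphism) exactly the image of a surjective unital
*-homomorphism from `A` onto a nonzero unital C*-algebra, we formalize the statement as: if
`A ∈ D_α` and `φ : A → B` is a surjective unital *-homomorphism onto a nonzero unital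
C*-algebra `B`, then `B ∈ D_α`. -/
theorem quotient_inD (α : Ordinal.{u}) (A B : Type u) [CStarAlgebra A] [CStarAlgebra B]
    [Nontrivial B] (φ : A →⋆ₐ[ℂ] B) (hφ : Function.Surjective φ) (hA : InD α A) :
    InD α B := by
  exact quotient_aux α A B φ hφ hA
end

section
/- If A is a unital C*-algebra with weak finite complexity (that is, A belongs to the class WD_α for some ordinal α), then the linear span of the projections in A is dense in A. -/
universe u

/-- A unital C*-algebra `A` weakly decomposes over a class `𝒞` of C*-subalgebras of `A`
(Definition 2.14 of the paper). -/
def WeakDecomposes (A : Type u) [CStarAlgebra A]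
    (𝒞 : NonUnitalStarSubalgebra ℂ A → Prop) : Prop :=
  ∀ (X : Finset A) (ε : ℝ), 0 < ε →
    ∃ C D : NonUnitalStarSubalgebra ℂ A, 𝒞 C ∧ 𝒞 D ∧
      ∃ h : A, (∃ x : A, h = star x * x) ∧ ‖h‖ ≤ 1 ∧
        (∀ x ∈ X, ‖h * x - x * h‖ < ε) ∧
        (∀ x ∈ X, MemEps ε (C : Set A) (h * x)) ∧
        (∀ x ∈ X, MemEps ε (D : Set A) ((1 - h) * x))

/-- Membership in the class `WD_α` of the weak complexity hierarchy (Definition 2.15 of the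
paper): `WD₀` consists of the unital locally finite-dimensional C*-algebras, and for
`α > 0`, `WD_α` consists of the unital C*-algebras weakly decomposing over the class
`⋃_{β<α} WD_β`. -/
def InWD (α : Ordinal.{u}) (A : Type u) [CStarAlgebra A] : Prop :=
  (α = 0 ∧ IsLocFinDim A) ∨
  (α ≠ 0 ∧ WeakDecomposes A fun S =>
      IsClosed (S : Set A) ∧
      ∃ β : {b : Ordinal.{u} // b < α}, ∃ (B : Type u) (instB : CStarAlgebra B),
        @InWD β.1 B instB ∧ @SubIso A _ S B instB)
termination_by α
decreasing_by exact β.2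

/-- Projections map to projections under a star homomorphism, and the map is contractive. -/
theorem mem_closure_span_of_iso {A : Type u} [CStarAlgebra A] {B : Type u} [CStarAlgebra B]
    (f : B →⋆ₙₐ[ℂ] A)
    (hB : Dense (↑(Submodule.span ℂ {p : B | star p = p ∧ p * p = p}) : Set B)) (b : B) :
    f b ∈ (Submodule.span ℂ {p : A | star p = p ∧ p * p = p}).topologicalClosure := by
  have hcont : Continuous f :=
    AddMonoidHomClass.continuous_of_bound f 1 fun x => by
      simpa using NonUnitalStarAlgHom.norm_apply_le f x
  have hm : Set.MapsTo f (↑(Submodule.span ℂ {p : B | star p = p ∧ p * p = p}) : Set B)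
      (↑(Submodule.span ℂ {p : A | star p = p ∧ p * p = p}) : Set A) := by
    intro x hx
    induction hx using Submodule.span_induction with
    | mem x h =>
      refine Submodule.subset_span ⟨?_, ?_⟩
      · rw [← map_star, h.1]
      · rw [← map_mul, h.2]
    | zero => simp
    | add x y _ _ hx hy => simpa using Submodule.add_mem _ hx hy
    | smul c x _ hx => simpa using Submodule.smul_mem _ c hx
  exact map_mem_closure hcont (hB b) hm

theorem spectrum_finite_of_mem {A : Type u} [CStarAlgebra A] (F : NonUnitalStarSubalgebra ℂ A)
    [FiniteDimensional ℂ F] (a : A) (ha : a ∈ F) : (spectrum ℂ a).Finite := by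
  classical
  have hmem : ∀ p : Polynomial ℂ, a * Polynomial.aeval a p ∈ F := by
    intro p
    induction p using Polynomial.induction_on with
    | C c =>
      rw [Polynomial.aeval_C, Algebra.algebraMap_eq_smul_one, mul_smul_comm, mul_one]
      exact SMulMemClass.smul_mem c ha
    | add p q hp hq => rw [map_add, mul_add]; exact add_mem hp hq
    | monomial n c h =>
      have : a * Polynomial.aeval a (Polynomial.C c * Polynomial.X ^ (n + 1))
          = (a * Polynomial.aeval a (Polynomial.C c * Polynomial.X ^ n)) * a := by
        simp [pow_succ, mul_assoc]
      rw [this]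
      exact mul_mem h ha
  let φ : Polynomial ℂ →ₗ[ℂ] F :=
    { toFun := fun p => ⟨a * Polynomial.aeval a p, hmem p⟩
      map_add' := fun p q => by ext; simp [mul_add]
      map_smul' := fun c p => by ext; simp }
  have hninj : ¬ Function.Injective φ := fun hinj =>
    Polynomial.not_finite (R := ℂ) (Module.Finite.of_injective φ hinj)
  rw [← LinearMap.ker_eq_bot, Submodule.eq_bot_iff] at hninj
  push Not at hninj
  obtain ⟨p, hp, hp0⟩ := hninj
  have h0 : Polynomial.aeval a (Polynomial.X * p) = 0 := by
    have := congrArg Subtype.val (LinearMap.mem_ker.mp hp)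
    simpa [φ] using this
  have hq0 : Polynomial.X * p ≠ 0 := mul_ne_zero Polynomial.X_ne_zero hp0
  refine ((Polynomial.X * p).roots.toFinset.finite_toSet).subset ?_
  intro z hz
  have hz' := spectrum.subset_polynomial_aeval a (Polynomial.X * p) ⟨z, hz, rfl⟩
  rw [h0] at hz'
  have : Nontrivial A := by
    by_contra hn
    rw [not_nontrivial_iff_subsingleton] at hn
    simp [spectrum.of_subsingleton] at hz
  rw [spectrum.zero_eq] at hz'
  simp only [Finset.mem_coe, Multiset.mem_toFinset]
  exact (Polynomial.mem_roots hq0).mpr hz'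

theorem sa_mem_span {A : Type u} [CStarAlgebra A] (a : A) (ha : IsSelfAdjoint a)
    (hf : (spectrum ℂ a).Finite) :
    a ∈ Submodule.span ℂ {p : A | star p = p ∧ p * p = p} := by
  classical
  have hn : IsStarNormal a := ha.isStarNormal
  have hc : ∀ g : ℂ → ℂ, ContinuousOn g (spectrum ℂ a) := fun g => hf.continuousOn g
  have h1 : a = cfc (∑ z ∈ hf.toFinset, fun w : ℂ => z * (if w = z then 1 else 0)) a := by
    conv_lhs => rw [← cfc_id ℂ a]
    refine cfc_congr ?_
    intro w hw
    simp [hw]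
  rw [h1, cfc_sum _ _ _ (fun i _ => hc _)]
  refine Submodule.sum_mem _ fun z _ => ?_
  rw [cfc_const_mul z _ a (hc _)]
  refine Submodule.smul_mem _ _ (Submodule.subset_span ⟨?_, ?_⟩)
  · rw [← cfc_star]
    congr 1
    ext w
    split_ifs <;> simp
  · rw [← cfc_mul _ _ a (hc _) (hc _)]
    congr 1
    ext w
    split_ifs <;> simp

theorem mem_span_of_mem_finDim {A : Type u} [CStarAlgebra A] (F : NonUnitalStarSubalgebra ℂ A)
    [FiniteDimensional ℂ F] (a : A) (ha : a ∈ F) :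
    a ∈ Submodule.span ℂ {p : A | star p = p ∧ p * p = p} := by
  have hs : star a ∈ F := star_mem ha
  have h1 : a + star a ∈ Submodule.span ℂ {p : A | star p = p ∧ p * p = p} :=
    sa_mem_span _ (IsSelfAdjoint.add_star_self a)
      (spectrum_finite_of_mem F _ (add_mem ha hs))
  have h2 : Complex.I • (a - star a) ∈ Submodule.span ℂ {p : A | star p = p ∧ p * p = p} := by
    refine sa_mem_span _ ?_ (spectrum_finite_of_mem F _ (SMulMemClass.smul_mem _ (sub_mem ha hs)))
    rw [isSelfAdjoint_iff]
    simp only [star_smul, star_sub, star_star, Complex.star_def, Complex.conj_I]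
    rw [neg_smul, ← smul_neg, neg_sub]
  have h3 : a = (1 / 2 : ℂ) • (a + star a)
      + (-(1 / 2 : ℂ) * Complex.I) • (Complex.I • (a - star a)) := by
    rw [smul_smul, mul_assoc, Complex.I_mul_I]
    module
  rw [h3]
  exact add_mem (Submodule.smul_mem _ _ h1) (Submodule.smul_mem _ _ h2)

theorem dense_span_of_InWD (α : Ordinal.{u}) : ∀ (A : Type u) [CStarAlgebra A], InWD α A →
    Dense (↑(Submodule.span ℂ {p : A | star p = p ∧ p * p = p}) : Set A) := by
  induction α using WellFoundedLT.induction with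
  | ind α ih =>
  intro A _ h
  rw [InWD] at h
  rcases h with ⟨_, h⟩ | ⟨_, h⟩
  · intro x
    rw [Metric.mem_closure_iff]
    intro ε hε
    obtain ⟨F, hF, hx⟩ := h {x} ε hε
    obtain ⟨s, hs, hxs⟩ := hx x (by simp)
    exact ⟨s, mem_span_of_mem_finDim F s hs, by rwa [dist_eq_norm]⟩
  · have key : ∀ S : NonUnitalStarSubalgebra ℂ A, (IsClosed (S : Set A) ∧
        ∃ β : {b : Ordinal.{u} // b < α}, ∃ (B : Type u) (instB : CStarAlgebra B),
        @InWD β.1 B instB ∧ @SubIso A _ S B instB) → ∀ s ∈ S,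
        s ∈ (Submodule.span ℂ {p : A | star p = p ∧ p * p = p}).topologicalClosure := by
      rintro S ⟨_, β, B, instB, hB, ⟨e⟩⟩ s hs
      have := mem_closure_span_of_iso
        ((NonUnitalStarSubalgebraClass.subtype S).comp (e.symm : B →⋆ₙₐ[ℂ] S))
        (ih β.1 β.2 B hB) (e ⟨s, hs⟩)
      simpa using this
    intro x
    rw [← closure_closure, Metric.mem_closure_iff]
    intro ε hε
    obtain ⟨C, D, hC, hD, k, _, _, _, h1, h2⟩ := h {x} (ε / 2) (by positivity)
    obtain ⟨c, hc, hxc⟩ := h1 x (by simp)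
    obtain ⟨d, hd, hxd⟩ := h2 x (by simp)
    refine ⟨c + d, add_mem (key C hC c hc) (key D hD d hd), ?_⟩
    rw [dist_eq_norm]
    have : x - (c + d) = (k * x - c) + ((1 - k) * x - d) := by noncomm_ring
    rw [this]
    exact (norm_add_le _ _).trans_lt (by linarith)

/-- Lemma 2.17 of the paper.  If `A` is a unital C*-algebra with weak
finite complexity (i.e. `A ∈ WD_α` for some ordinal `α`), then the linear span of the
projections in `A` is dense in `A`. -/
theorem dense_span_projections_of_weak_finite_complexity
    (A : Type u) [CStarAlgebra A] (h : ∃ α : Ordinal.{u}, InWD α A) :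
    Dense (↑(Submodule.span ℂ {p : A | star p = p ∧ p * p = p}) : Set A) := by
  obtain ⟨α, h⟩ := h
  exact dense_span_of_InWD α A h
end
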